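/- There exists ν₀ > 0 such that for all 0 < ν ≤ ν₀ and all μ with 0 < μ ≤ ν/20 there exists n₀ = n₀(μ, ν, r) with the following property: for every n ≥ n₀, every r-edge-coloured graph on n vertices that is (μ, ν)-robustly 2-matchable admits a partition of its vertex set into at most (1/μ + 200)·r² vertex-disjoint monochromatic cycles. -/

import Mathlib

/-!
STATEMENT 4: There exists `ν₀ > 0` such that for all `0 < ν ≤ ν₀` and all `μ` with
`0 < μ ≤ ν/20` there exists `n₀ = n₀(μ, ν, r)` such that for every `n ≥ n₀`, every
`r`-edge-coloured graph on `n` vertices that is `(μ, ν)`-robustly 2-matchable admits a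
partition of its vertex set into at most `(1/μ + 200)·r²` vertex-disjoint monochromatic
cycles.
-/

namespace Paper

variable {V : Type*}

/-- `S` is the vertex set of a monochromatic proper cycle of `G` under the colouring `c`. -/
def IsMonoProperCycle {r : ℕ} (G : SimpleGraph V) (c : Sym2 V → Fin r) (S : Set V) : Prop :=
  ∃ (i : Fin r) (v : V) (w : G.Walk v v), w.IsCycle ∧ (∀ e ∈ w.edges, c e = i) ∧
    S = {x | x ∈ w.support}

/-- `S` is a (possibly degenerate) monochromatic cycle: the empty set, a single vertex,
a single edge, or a monochromatic proper cycle. -/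
def IsMonoCycle {r : ℕ} (G : SimpleGraph V) (c : Sym2 V → Fin r) (S : Set V) : Prop :=
  S = ∅ ∨ (∃ v, S = {v}) ∨ (∃ u v, G.Adj u v ∧ S = {u, v}) ∨ IsMonoProperCycle G c S

/-- The vertex set of `G` can be partitioned into at most `k` vertex-disjoint
monochromatic cycles. -/
def MonoCyclePartition {r : ℕ} (G : SimpleGraph V) (c : Sym2 V → Fin r) (k : ℕ) : Prop :=
  ∃ f : Fin k → Set V,
    (∀ i j : Fin k, i ≠ j → Disjoint (f i) (f j)) ∧
    (⋃ i, f i) = Set.univ ∧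
    ∀ i, IsMonoCycle G c (f i)

/-- The number of edges of `H` with both endpoints in `S`. -/
noncomputable def edgesIn (H : SimpleGraph V) (S : Set V) : ℕ :=
  {e : Sym2 V | e ∈ H.edgeSet ∧ ∀ x ∈ e, x ∈ S}.ncard

/-- `H` is `(μ,ν)`-robustly 2-matchable of type 1. -/
def RobMat1 (H : SimpleGraph V) (μ ν : ℝ) : Prop :=
  (∀ v : V, (1 / 2 - μ) * (Nat.card V : ℝ) ≤ ((H.neighborSet v).ncard : ℝ)) ∧
  ∀ S : Set V, (1 / 2 - ν) * (Nat.card V : ℝ) ≤ (S.ncard : ℝ) →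
    ν * (Nat.card V : ℝ) ^ 2 ≤ (edgesIn H S : ℝ)

/-- `H` is `(μ,ν)`-robustly 2-matchable of type 2, witnessed by the bipartition `{A,B}`. -/
def RobMat2With (H : SimpleGraph V) (μ : ℝ) (A B : Set V) : Prop :=
  A ∪ B = Set.univ ∧ Disjoint A B ∧ A.ncard = B.ncard ∧
  (∀ u v : V, H.Adj u v → (u ∈ A ∧ v ∈ B) ∨ (u ∈ B ∧ v ∈ A)) ∧
  (∀ v : V, (1 / 32 - μ) * (Nat.card V : ℝ) ≤ ((H.neighborSet v).ncard : ℝ)) ∧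
  ({v : V | ((H.neighborSet v).ncard : ℝ) < (1 / 3 - μ) * (Nat.card V : ℝ)}.ncard : ℝ)
    ≤ (1 / 64 + μ) * (Nat.card V : ℝ)

/-- `H` is `(μ,ν)`-robustly 2-matchable of type 2. -/
def RobMat2 (H : SimpleGraph V) (μ : ℝ) : Prop := ∃ A B : Set V, RobMat2With H μ A B

/-- `H` is `(μ,ν)`-robustly 2-matchable. -/
def RobMat (H : SimpleGraph V) (μ ν : ℝ) : Prop := RobMat1 H μ ν ∨ RobMat2 H μ

/-- The list `l` enumerates, in cyclic order, a (possibly degenerate) cycle of the relation `R`. -/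
def IsCyc (R : V → V → Prop) (l : List V) : Prop :=
  l.Nodup ∧ (l.length ≤ 1 ∨ ∀ a ∈ l.head?, List.IsChain R (l ++ [a]))

lemma exists_walk_of_isChain {r : ℕ} (G : SimpleGraph V) (col : Sym2 V → Fin r) (c : Fin r)
    (l : List V) : ∀ a b : V,
    List.IsChain (fun u v => G.Adj u v ∧ col s(u, v) = c) (a :: l ++ [b]) →
    ∃ w : G.Walk a b, w.support = a :: l ++ [b] ∧ ∀ e ∈ w.edges, col e = c := by
  induction l with
  | nil =>
    intro a b h
    have h' : G.Adj a b ∧ col s(a, b) = c := by simpa using h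
    exact ⟨.cons h'.1 .nil, by simp, by simpa using h'.2⟩
  | cons x t ih =>
    intro a b h
    have h' := List.isChain_cons_cons.1 h
    obtain ⟨w, hw, hc⟩ := ih x b h'.2
    refine ⟨.cons h'.1.1 w, by simp [hw], ?_⟩
    intro e he
    rw [SimpleGraph.Walk.edges_cons, List.mem_cons] at he
    rcases he with rfl | he
    · exact h'.1.2
    · exact hc e he

lemma IsCyc.isMonoCycle {r : ℕ} (G : SimpleGraph V) (col : Sym2 V → Fin r) (c : Fin r)
    (l : List V) (h : IsCyc (fun u v => G.Adj u v ∧ col s(u, v) = c) l) :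
    IsMonoCycle G col {x | x ∈ l} := by
  match l, h with
  | [], _ => left; ext; simp
  | [a], _ => right; left; exact ⟨a, by ext; simp⟩
  | [a, b], h =>
    right; right; left
    have h2 := (h.2.resolve_left (by simp)) a (by simp)
    exact ⟨a, b, (List.isChain_cons_cons.1 h2).1.1, by ext; simp⟩
  | a :: b :: x :: t, h =>
    right; right; right
    have h2 := (h.2.resolve_left (by simp)) a (by simp)
    have hab := List.isChain_cons_cons.1 h2
    have hbx := List.isChain_cons_cons.1 hab.2
    obtain ⟨w, hw, hc⟩ := exists_walk_of_isChain G col c t x a hbx.2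
    have hnd := h.1
    simp only [List.nodup_cons, List.mem_cons, not_or] at hnd
    obtain ⟨⟨hab', hax, hat⟩, ⟨hbx', hbt⟩, hxt, ht⟩ := hnd
    refine ⟨c, a, .cons hab.1.1 (.cons hbx.1.1 w), ?_, ?_, ?_⟩
    · rw [SimpleGraph.Walk.cons_isCycle_iff]
      constructor
      · rw [SimpleGraph.Walk.isPath_def, SimpleGraph.Walk.support_cons, hw]
        simp only [List.cons_append, List.nodup_cons, List.mem_cons, List.mem_append,
          List.not_mem_nil, or_false, not_or]
        refine ⟨⟨hbx', hbt, fun h => hab' h.symm⟩, ⟨hxt, fun h => hax h.symm⟩, ?_⟩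
        rw [List.nodup_append]
        refine ⟨ht, by simp, ?_⟩
        rintro y hy z hz rfl
        simp at hz; subst hz; exact hat hy
      · rw [SimpleGraph.Walk.edges_cons, List.mem_cons, not_or]
        constructor
        · intro he
          rw [Sym2.eq_iff] at he
          rcases he with he | he
          · exact hab' he.1
          · exact hax he.1
        · intro he
          have := w.snd_mem_support_of_mem_edges he
          rw [hw] at this
          simp only [List.cons_append, List.mem_cons, List.mem_append,
            List.not_mem_nil, or_false] at this
          rcases this with h | h | h
          · exact hbx' h
          · exact hbt h
          · exact hab' h.symm
    · intro e he
      simp only [SimpleGraph.Walk.edges_cons, List.mem_cons] at he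
      rcases he with rfl | rfl | he
      · exact hab.1.2
      · exact hbx.1.2
      · exact hc e he
    · ext y
      simp only [SimpleGraph.Walk.support_cons, hw]
      simp
      tauto

lemma monoCyclePartition_of_family {r : ℕ} (G : SimpleGraph V) (col : Sym2 V → Fin r)
    {κ : Type*} [Fintype κ] (f : κ → List V)
    (hcyc : ∀ k, ∃ c, IsCyc (fun u v => G.Adj u v ∧ col s(u, v) = c) (f k))
    (hdis : ∀ k k', k ≠ k' → List.Disjoint (f k) (f k'))
    (hcov : ∀ v, ∃ k, v ∈ f k) : MonoCyclePartition G col (Fintype.card κ) := by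
  let e := Fintype.equivFin κ
  refine ⟨fun i => {x | x ∈ f (e.symm i)}, ?_, ?_, ?_⟩
  · intro i j hij
    rw [Set.disjoint_left]
    intro x hx hx'
    exact hdis _ _ (fun h => hij (e.symm.injective h)) hx hx'
  · ext v
    obtain ⟨k, hk⟩ := hcov v
    simp only [Set.mem_iUnion, Set.mem_univ, iff_true]
    exact ⟨e k, by simpa using hk⟩
  · intro i
    obtain ⟨c, hc⟩ := hcyc (e.symm i)
    exact hc.isMonoCycle G col c _

lemma isCyc_of_length_le {R : V → V → Prop} {l : List V} (hl : l.length ≤ 1) : IsCyc R l :=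
  ⟨by match l, hl with
      | [], _ => simp
      | [a], _ => simp, Or.inl hl⟩

/-- Replacing each entry of a cyclic sequence by a block gives a cycle, if consecutive blocks
can be joined. -/
lemma isChain_flatMap {S : Type*} {R : V → V → Prop} {Q : S → S → Prop} (B : S → List V)
    (l : List S) (hQ : List.IsChain Q l) (hne : ∀ s ∈ l, B s ≠ [])
    (hB : ∀ s ∈ l, List.IsChain R (B s))
    (hj : ∀ s ∈ l, ∀ t ∈ l, Q s t → ∀ x ∈ (B s).getLast?, ∀ y ∈ (B t).head?, R x y) :
    List.IsChain R (l.flatMap B) := by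
  induction l with
  | nil => simp
  | cons s t ih =>
    rw [List.flatMap_cons, List.isChain_append]
    refine ⟨hB s (by simp), ih hQ.tail (fun s hs => hne s (by simp [hs]))
      (fun s hs => hB s (by simp [hs]))
      (fun s hs t ht => hj s (by simp [hs]) t (by simp [ht])), ?_⟩
    cases t with
    | nil => simp
    | cons s' t =>
      intro x hx y hy
      refine hj s (by simp) s' (by simp) (List.isChain_cons_cons.1 hQ).1 x hx y ?_
      rw [List.flatMap_cons] at hy
      obtain ⟨b, bs, hb⟩ := List.exists_cons_of_ne_nil (hne s' (by simp))
      rw [hb] at hy ⊢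
      simpa using hy

lemma isCyc_flatMap {S : Type*} {R : V → V → Prop} {Q : S → S → Prop} (B : S → List V)
    (l : List S) (hl : ∀ a ∈ l.head?, List.IsChain Q (l ++ [a])) (hnd : l.Nodup)
    (hne : ∀ s ∈ l, B s ≠ [])
    (hB : ∀ s ∈ l, List.IsChain R (B s)) (hBn : ∀ s ∈ l, (B s).Nodup)
    (hdis : ∀ s ∈ l, ∀ t ∈ l, s ≠ t → List.Disjoint (B s) (B t))
    (hj : ∀ s ∈ l, ∀ t ∈ l, Q s t → ∀ x ∈ (B s).getLast?, ∀ y ∈ (B t).head?, R x y) :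
    IsCyc R (l.flatMap B) := by
  refine ⟨?_, Or.inr ?_⟩
  · rw [List.nodup_flatMap]
    refine ⟨hBn, ?_⟩
    exact List.Pairwise.imp_of_mem (fun ha hb hab => hdis _ ha _ hb hab) hnd
  · intro a ha
    cases l with
    | nil => simp at ha
    | cons s t =>
      have hc := hl s (by simp)
      obtain ⟨b, bs, hb⟩ := List.exists_cons_of_ne_nil (hne s (by simp))
      have hab : a = b := by
        rw [List.flatMap_cons, hb] at ha
        simpa using ha.symm
      subst hab
      have hmem : ∀ x, x ∈ s :: t ++ [s] → x ∈ s :: t := by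
        intro x hx; simp at hx ⊢; tauto
      have := isChain_flatMap (R := R) (Q := Q) B (s :: t ++ [s]) hc
        (fun x hx => hne x (hmem x hx)) (fun x hx => hB x (hmem x hx))
        (fun x hx y hy => hj x (hmem x hx) y (hmem y hy))
      rw [List.flatMap_append] at this
      simp only [List.flatMap_cons, List.flatMap_nil, List.append_nil] at this ⊢
      rw [hb] at this ⊢
      rw [show (a :: bs ++ List.flatMap B t ++ a :: bs)
        = (a :: bs ++ List.flatMap B t ++ [a]) ++ bs by simp] at this
      exact (List.isChain_append.1 this).1

/-- Cyclic successor in a list. -/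
lemma exists_next {S : Type*} (l : List S) (hl : l.Nodup) :
    ∃ nx : S → S, (∀ s ∈ l, nx s ∈ l) ∧
      ∀ a ∈ l.head?, List.IsChain (fun x y => y = nx x) (l ++ [a]) := by
  classical
  cases l with
  | nil => exact ⟨id, by simp, by simp⟩
  | cons a t =>
    refine ⟨fun x => if h : x ∈ a :: t then (a :: t).next x h else x, ?_, ?_⟩
    · intro s hs
      simp only [hs, dite_true]
      exact List.next_mem _ _ _
    · intro b hb
      obtain rfl : a = b := by simpa using hb
      rw [List.isChain_iff_getElem]
      intro i hi
      have hi' : i < (a :: t).length := by simpa using hi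
      rw [List.getElem_append_left hi']
      dsimp only
      rw [dif_pos (List.getElem_mem hi'), List.next_getElem _ hl _ hi']
      simp only [List.getElem_append]
      split_ifs with h
      · congr 1
        rw [Nat.mod_eq_of_lt h]
      · have : i + 1 = (a :: t).length := by omega
        simp [this]

/-- A weight that is negated along every edge sums to zero over every cycle with an edge. -/
lemma IsCyc.sum_eq_zero {R : V → V → Prop} {l : List V} (h : IsCyc R l) (hl : l.length ≠ 1)
    (f : V → ℤ) (hf : ∀ u v, R u v → f u + f v = 0) : (l.map f).sum = 0 := by
  have key : ∀ (t : List V) (a b : V), List.IsChain R (a :: t ++ [b]) →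
      2 * ((a :: t).map f).sum = f a - f b := by
    intro t
    induction t with
    | nil =>
      intro a b h
      have := hf a b (by simpa using h)
      simp; linarith
    | cons x t ih =>
      intro a b h
      have h' := List.isChain_cons_cons.1 h
      have h1 := hf _ _ h'.1
      have h2 := ih x b h'.2
      simp only [List.map_cons, List.sum_cons] at h2 ⊢
      linarith
  cases l with
  | nil => simp
  | cons a t =>
    rcases h.2 with h2 | h2
    · exfalso; apply hl; simp at h2 ⊢; exact h2
    · have := key t a a (h2 a (by simp)); omega

/-- Greedy choice of pairwise compatible objects. -/
lemma exists_greedy {S α : Type*} [DecidableEq S] (Pd : S → α → Prop) (dis : α → α → Prop)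
    (hdis : ∀ a b, dis a b → dis b a) [Nonempty α] (S₀ : Finset S)
    (h : ∀ S' ⊆ S₀, ∀ s ∈ S₀, s ∉ S' → ∀ f : S → α, (∀ t ∈ S', Pd t (f t)) →
      (∀ t ∈ S', ∀ t' ∈ S', t ≠ t' → dis (f t) (f t')) →
      ∃ a, Pd s a ∧ ∀ t ∈ S', dis a (f t)) :
    ∃ f : S → α, (∀ t ∈ S₀, Pd t (f t)) ∧ ∀ t ∈ S₀, ∀ t' ∈ S₀, t ≠ t' → dis (f t) (f t') := by
  suffices H : ∀ S' ⊆ S₀, ∃ f : S → α, (∀ t ∈ S', Pd t (f t)) ∧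
      ∀ t ∈ S', ∀ t' ∈ S', t ≠ t' → dis (f t) (f t') from H S₀ subset_rfl
  intro S'
  induction S' using Finset.induction_on with
  | empty => intro _; exact ⟨fun _ => Classical.arbitrary α, by simp, by simp⟩
  | insert s S' hs ih =>
    intro hsub
    obtain ⟨f, hf, hd⟩ := ih (fun x hx => hsub (by simp [hx]))
    obtain ⟨a, ha, hda⟩ := h S' (fun x hx => hsub (by simp [hx])) s (hsub (by simp)) hs f hf hd
    refine ⟨Function.update f s a, ?_, ?_⟩
    · intro t ht₀
      rcases Finset.mem_insert.1 ht₀ with rfl | ht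
      · simpa using ha
      · rw [Function.update_of_ne (by rintro rfl; exact hs ht)]; exact hf t ht
    · intro t ht₀ t' ht₀' hne
      rcases Finset.mem_insert.1 ht₀ with rfl | ht <;> rcases Finset.mem_insert.1 ht₀' with rfl | ht'
      · exact absurd rfl hne
      · rw [Function.update_self, Function.update_of_ne hne.symm]; exact hda t' ht'
      · rw [Function.update_self, Function.update_of_ne hne]; exact hdis _ _ (hda t ht)
      · rw [Function.update_of_ne (by rintro rfl; exact hs ht),
          Function.update_of_ne (by rintro rfl; exact hs ht')]
        exact hd t ht t' ht' hne

lemma exists_last_split (P : V → Prop) (t : List V) :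
    (∀ x ∈ t, ¬ P x) ∨ ∃ p w q, t = p ++ w :: q ∧ P w ∧ ∀ x ∈ q, ¬ P x := by
  induction t with
  | nil => left; simp
  | cons a t ih =>
    rcases ih with h | ⟨p, w, q, rfl, hw, hq⟩
    · by_cases ha : P a
      · exact Or.inr ⟨[], a, t, rfl, ha, h⟩
      · left
        intro x hx
        rcases List.mem_cons.1 hx with rfl | hx
        · exact ha
        · exact h x hx
    · exact Or.inr ⟨a :: p, w, q, rfl, hw, hq⟩

/-- Some vertex has its whole neighbourhood on a cycle through it. -/
lemma exists_cyc_containing_neighbours [DecidableEq V] {R : V → V → Prop}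
    (hsymm : ∀ u v, R u v → R v u) (Z : Finset V) (hZ : Z.Nonempty) :
    ∃ v l, v ∈ l ∧ IsCyc R l ∧ (∀ x ∈ l, x ∈ Z) ∧ ∀ x ∈ Z, x ≠ v → R v x → x ∈ l := by
  classical
  obtain ⟨z, hz⟩ := hZ
  let good : ℕ → Prop := fun k =>
    ∃ l : List V, l.length = k + 1 ∧ l.Nodup ∧ List.IsChain R l ∧ ∀ x ∈ l, x ∈ Z
  have hbd : ∀ k, good k → k ≤ Z.card := by
    rintro k ⟨l, hl, hn, -, hm⟩
    have := Finset.card_le_card (s := l.toFinset) (t := Z) (by intro x; simpa using hm x)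
    rw [List.toFinset_card_of_nodup hn] at this
    omega
  have h0 : good 0 := ⟨[z], by simp, by simp, by simp, by simpa using hz⟩
  have hmax := Nat.findGreatest_spec (P := good) (Nat.zero_le Z.card) h0
  obtain ⟨l, hl, hn, hc, hm⟩ := hmax
  obtain ⟨v, t, rfl⟩ := List.exists_cons_of_length_pos (l := l) (by omega)
  have hnb : ∀ x ∈ Z, x ≠ v → R v x → x ∈ t := by
    intro x hx hxv hR
    by_contra hxt
    have hg : good (Nat.findGreatest good Z.card + 1) := by
      refine ⟨x :: v :: t, by simpa using hl, ?_, ?_, ?_⟩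
      · rw [List.nodup_cons]
        exact ⟨by simp [hxv, hxt], hn⟩
      · exact List.isChain_cons_cons.2 ⟨hsymm _ _ hR, hc⟩
      · intro y hy
        rcases List.mem_cons.1 hy with rfl | hy
        · exact hx
        · exact hm y hy
    have := Nat.le_findGreatest (hbd _ hg) hg
    omega
  rcases exists_last_split (fun x => R v x) t with h | ⟨p, w, q, rfl, hw, hq⟩
  · refine ⟨v, [v], by simp, isCyc_of_length_le (by simp), ?_, ?_⟩
    · intro x hx; exact hm x (by simp at hx; simp [hx])
    · intro x hx hxv hR
      exact absurd hR (h x (hnb x hx hxv hR))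
  · have e : v :: (p ++ w :: q) = (v :: p ++ [w]) ++ q := by simp
    rw [e] at hn hc hm
    refine ⟨v, v :: p ++ [w], by simp, ⟨(List.nodup_append.1 hn).1, Or.inr ?_⟩, ?_, ?_⟩
    · intro a ha
      obtain rfl : v = a := by simpa using ha
      rw [List.isChain_append]
      refine ⟨(List.isChain_append.1 hc).1, by simp, ?_⟩
      intro x hx y hy
      rw [List.getLast?_concat] at hx
      simp at hx hy
      subst hx hy
      exact hsymm _ _ hw
    · intro x hx; exact hm x (List.mem_append_left _ hx)
    · intro x hx hxv hR
      have := hnb x hx hxv hR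
      simp only [List.mem_append, List.mem_cons] at this
      rcases this with h | rfl | h
      · simp [h]
      · simp
      · exact absurd hR (hq x h)

/-- A graph with independence number at most `α` is partitioned by `α` cycles. -/
lemma exists_cyc_partition [DecidableEq V] {R : V → V → Prop}
    (hsymm : ∀ u v, R u v → R v u) (α : ℕ) : ∀ Z : Finset V,
    (∀ I ⊆ Z, (∀ a ∈ I, ∀ b ∈ I, a ≠ b → ¬ R a b) → I.card ≤ α) →
    ∃ f : Fin α → List V, (∀ k, IsCyc R (f k)) ∧
      (∀ k k', k ≠ k' → List.Disjoint (f k) (f k')) ∧ ∀ v, v ∈ Z ↔ ∃ k, v ∈ f k := by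
  induction α with
  | zero =>
    intro Z hI
    have : Z = ∅ := by
      by_contra hne
      obtain ⟨z, hz⟩ := Finset.nonempty_iff_ne_empty.2 hne
      have := hI {z} (by simpa using hz) (by simp)
      simp at this
    subst this
    exact ⟨fun _ => [], fun k => k.elim0, fun k => k.elim0, by simp⟩
  | succ α ih =>
    intro Z hI
    rcases Z.eq_empty_or_nonempty with rfl | hZ
    · exact ⟨fun _ => [], fun k => isCyc_of_length_le (by simp), by simp, by simp⟩
    obtain ⟨v, l, hvl, hcyc, hlZ, hnb⟩ := exists_cyc_containing_neighbours hsymm Z hZ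
    obtain ⟨f, hf, hd, hcov⟩ := ih (Z \ l.toFinset) (by
      intro I hIZ hind
      have hv : v ∉ I := fun h => by
        have := hIZ h; simp at this; exact this.2 hvl
      have := hI (insert v I) (by
        intro x hx
        rcases Finset.mem_insert.1 hx with rfl | hx
        · exact hlZ _ hvl
        · exact (Finset.mem_sdiff.1 (hIZ hx)).1) (by
        have key : ∀ b ∈ I, ¬ R v b := by
          intro b hb hR
          have hb' := Finset.mem_sdiff.1 (hIZ hb)
          exact hb'.2 (by simpa using hnb b hb'.1 (by rintro rfl; exact hv hb) hR)
        intro a ha b hb hab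
        rcases Finset.mem_insert.1 ha with rfl | ha' <;>
          rcases Finset.mem_insert.1 hb with rfl | hb'
        · exact absurd rfl hab
        · exact key b hb'
        · exact fun h => key a ha' (hsymm _ _ h)
        · exact hind a ha' b hb' hab)
      rw [Finset.card_insert_of_notMem hv] at this
      omega)
    have hdl : ∀ k, List.Disjoint l (f k) := by
      intro k x hx hx'
      have := (hcov x).2 ⟨k, hx'⟩
      simp at this
      exact this.2 hx
    refine ⟨Fin.cons l f, ?_, ?_, ?_⟩
    · intro k
      refine Fin.cases ?_ (fun k => ?_) k
      · simpa using hcyc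
      · simpa using hf k
    · intro k k'
      refine Fin.cases ?_ (fun k => ?_) k <;> refine Fin.cases ?_ (fun k' => ?_) k'
      · simp
      · intro _; simpa using hdl k'
      · intro _; simpa using (hdl k).symm
      · intro h; simpa using hd k k' (fun h' => h (by rw [h']))
    · intro x
      rw [Fin.exists_fin_succ]
      simp only [Fin.cons_zero, Fin.cons_succ, ← hcov x, Finset.mem_sdiff, List.mem_toFinset]
      have := hlZ x
      tauto

/-- Depth first search: a digraph without large empty ordered pairs of sets has a path
missing few vertices. -/
lemma exists_long_path {W : Type*} [DecidableEq W] (T : W → W → Prop) (S : Finset W) (s : ℕ)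
    (hexp : ∀ A ⊆ S, ∀ B ⊆ S, Disjoint A B → s ≤ A.card → s ≤ B.card → ∃ a ∈ A, ∃ b ∈ B, T a b) :
    ∃ l : List W, l.Nodup ∧ List.IsChain T l ∧ (∀ x ∈ l, x ∈ S) ∧ S.card ≤ l.length + 2 * s := by
  suffices H : ∀ j ≤ S.card, ∃ (l : List W) (D U : Finset W), l.Nodup ∧ List.IsChain T l ∧
      (∀ x ∈ l, x ∈ S) ∧ D ⊆ S ∧ U ⊆ S ∧ Disjoint D U ∧ Disjoint l.toFinset D ∧
      Disjoint l.toFinset U ∧ S = l.toFinset ∪ D ∪ U ∧ (∀ d ∈ D, ∀ u ∈ U, ¬ T d u) ∧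
      U.card + j = S.card + D.card by
    obtain ⟨l, D, U, hn, hc, hl, hD, hU, hDU, h1, h2, hS, hno, hj⟩ := H S.card le_rfl
    refine ⟨l, hn, hc, hl, ?_⟩
    have hcard : S.card = l.length + D.card + U.card := by
      conv_lhs => rw [hS]
      rw [Finset.card_union_of_disjoint, Finset.card_union_of_disjoint h1,
        List.toFinset_card_of_nodup hn]
      exact Finset.disjoint_union_left.2 ⟨h2, hDU⟩
    by_contra hlt
    obtain ⟨a, ha, b, hb, hab⟩ := hexp D hD U hU hDU (by omega) (by omega)
    exact hno a ha b hb hab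
  intro j
  induction j with
  | zero =>
    intro _
    exact ⟨[], ∅, S, by simp⟩
  | succ j ih =>
    intro hj
    obtain ⟨l, D, U, hn, hc, hl, hD, hU, hDU, h1, h2, hS, hno, hcard⟩ := ih (by omega)
    have hUne : U.Nonempty := by
      rw [← Finset.card_pos]; omega
    rcases l.eq_nil_or_concat with rfl | ⟨p, x, rfl⟩
    · obtain ⟨u, hu⟩ := hUne
      refine ⟨[u], D, U.erase u, by simp, by simp, by simpa using hU hu, hD,
        (Finset.erase_subset _ _).trans hU, hDU.mono_right (Finset.erase_subset _ _), ?_, ?_, ?_,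
        fun d hd v hv => hno d hd v (Finset.mem_of_mem_erase hv), ?_⟩
      · simpa using fun h => Finset.disjoint_left.1 hDU h hu
      · simp
      · rw [hS]; ext y; simp only [List.toFinset_nil, Finset.mem_union, List.mem_toFinset,
          Finset.mem_erase, List.mem_singleton, Finset.notMem_empty]
        by_cases hy : y = u
        · subst hy; simp [hu]
        · simp [hy]
      · rw [Finset.card_erase_of_mem hu]
        have := Finset.card_pos.2 ⟨u, hu⟩
        omega
    · rw [List.concat_eq_append] at *
      by_cases hx : ∃ u ∈ U, T x u
      · obtain ⟨u, hu, hxu⟩ := hx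
        have hul : u ∉ p ++ [x] := fun h =>
          Finset.disjoint_left.1 h2 (List.mem_toFinset.2 h) hu
        refine ⟨p ++ [x] ++ [u], D, U.erase u, ?_, ?_, ?_, hD,
          (Finset.erase_subset _ _).trans hU, hDU.mono_right (Finset.erase_subset _ _), ?_, ?_, ?_,
          fun d hd v hv => hno d hd v (Finset.mem_of_mem_erase hv), ?_⟩
        · rw [List.nodup_append]
          refine ⟨hn, by simp, ?_⟩
          rintro a ha b hb rfl
          simp at hb; subst hb; exact hul ha
        · rw [List.isChain_append]
          refine ⟨hc, by simp, ?_⟩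
          intro a ha b hb
          rw [List.getLast?_concat] at ha
          simp at ha hb; subst ha hb; exact hxu
        · intro y hy
          rcases List.mem_append.1 hy with hy | hy
          · exact hl y hy
          · simp at hy; subst hy; exact hU hu
        · rw [List.toFinset_append, Finset.disjoint_union_left]
          refine ⟨h1, ?_⟩
          simpa using fun h => Finset.disjoint_left.1 hDU h hu
        · rw [List.toFinset_append, Finset.disjoint_union_left]
          exact ⟨h2.mono_right (Finset.erase_subset _ _), by simp⟩
        · rw [hS]; ext y
          simp only [Finset.mem_union, List.mem_toFinset, Finset.mem_erase, List.mem_append,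
            List.mem_singleton]
          by_cases hy : y = u
          · subst hy; simp [hu]
          · simp [hy]
        · rw [Finset.card_erase_of_mem hu]
          have := Finset.card_pos.2 ⟨u, hu⟩
          omega
      · push Not at hx
        have hxD : x ∉ D := fun h => Finset.disjoint_left.1 h1 (by simp) h
        have hn' := List.nodup_append.1 hn
        refine ⟨p, insert x D, U, hn'.1, (List.isChain_append.1 hc).1,
          fun y hy => hl y (List.mem_append_left _ hy), ?_, hU, ?_, ?_, ?_, ?_, ?_, ?_⟩
        · intro y hy
          rcases Finset.mem_insert.1 hy with rfl | hy
          · exact hl _ (by simp)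
          · exact hD hy
        · rw [Finset.disjoint_insert_left]
          exact ⟨fun h => Finset.disjoint_left.1 h2 (by simp) h, hDU⟩
        · rw [Finset.disjoint_insert_right]
          refine ⟨?_, h1.mono_left (by simp)⟩
          intro h
          exact hn'.2.2 x (by simpa using h) x (by simp) rfl
        · exact h2.mono_left (by simp)
        · rw [hS]; ext y; simp
        · intro d hd u hu
          rcases Finset.mem_insert.1 hd with rfl | hd
          · exact hx u hu
          · exact hno d hd u hu
        · rw [Finset.card_insert_of_notMem hxD]; omega

/-- Closed walk condition for a list read cyclically. -/
def CycChain {W : Type*} (T : W → W → Prop) (l : List W) : Prop :=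
  ∀ a ∈ l.head?, List.IsChain T (l ++ [a])

lemma CycChain.reroute {W : Type*} {T : W → W → Prop} {S0 S1 S2 S3 : List W} {z : W}
    (h0 : S0 ≠ []) (h1 : S1 ≠ []) (h2 : S2 ≠ []) (h3 : S3 ≠ [])
    (h : CycChain T (S0 ++ (S1 ++ (S2 ++ S3))))
    (hz : ((∀ x ∈ S0.getLast?, ∀ y ∈ S2.head?, T x y) ∧ (∀ x ∈ S2.getLast?, T x z) ∧
      (∀ y ∈ S1.head?, T z y) ∧ (∀ x ∈ S1.getLast?, ∀ y ∈ S3.head?, T x y)) ∨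
      ((∀ x ∈ S0.getLast?, ∀ y ∈ S2.head?, T x y) ∧ (∀ x ∈ S1.getLast?, T x z) ∧
      (∀ y ∈ S3.head?, T z y) ∧ (∀ x ∈ S2.getLast?, ∀ y ∈ S1.head?, T x y))) :
    ∃ l', CycChain T l' ∧ l'.Perm (z :: (S0 ++ (S1 ++ (S2 ++ S3)))) := by
  classical
  obtain ⟨a, t0, rfl⟩ := List.exists_cons_of_ne_nil h0
  obtain ⟨b, t1, rfl⟩ := List.exists_cons_of_ne_nil h1
  obtain ⟨c, t2, rfl⟩ := List.exists_cons_of_ne_nil h2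
  obtain ⟨d, t3, rfl⟩ := List.exists_cons_of_ne_nil h3
  have hc := h a (by simp)
  simp only [List.append_assoc] at hc
  obtain ⟨c0, hc, -⟩ := List.isChain_append.1 hc
  obtain ⟨c1, hc, -⟩ := List.isChain_append.1 hc
  obtain ⟨c2, c3, -⟩ := List.isChain_append.1 hc
  rcases hz with ⟨e1, e2, e3, e4⟩ | ⟨e1, e2, e3, e4⟩
  · refine ⟨(a :: t0) ++ ((c :: t2) ++ ([z] ++ ((b :: t1) ++ (d :: t3)))), ?_, ?_⟩
    · intro a' ha'
      obtain rfl : a = a' := by simpa using ha'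
      simp only [List.append_assoc]
      refine List.isChain_append.2 ⟨c0, List.isChain_append.2 ⟨c2, List.isChain_append.2
        ⟨by simp, List.isChain_append.2 ⟨c1, c3, ?_⟩, ?_⟩, ?_⟩, ?_⟩
      · intro x hx y hy; exact e4 x hx y (by simpa using hy)
      · intro x hx y hy
        obtain rfl : z = x := by simpa using hx
        exact e3 y (by simpa using hy)
      · intro x hx y hy
        obtain rfl : z = y := by simpa using hy
        exact e2 x hx
      · intro x hx y hy; exact e1 x hx y (by simpa using hy)
    · rw [List.perm_iff_count]
      intro x
      simp only [List.count_append, List.count_cons, List.count_nil]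
      omega
  · refine ⟨(a :: t0) ++ ((c :: t2) ++ ((b :: t1) ++ ([z] ++ (d :: t3)))), ?_, ?_⟩
    · intro a' ha'
      obtain rfl : a = a' := by simpa using ha'
      simp only [List.append_assoc]
      refine List.isChain_append.2 ⟨c0, List.isChain_append.2 ⟨c2, List.isChain_append.2
        ⟨c1, List.isChain_append.2 ⟨by simp, c3, ?_⟩, ?_⟩, ?_⟩, ?_⟩
      · intro x hx y hy
        obtain rfl : z = x := by simpa using hx
        exact e3 y (by simpa using hy)
      · intro x hx y hy
        obtain rfl : z = y := by simpa using hy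
        exact e2 x hx
      · intro x hx y hy; exact e4 x hx y (by simpa using hy)
      · intro x hx y hy; exact e1 x hx y (by simpa using hy)
    · rw [List.perm_iff_count]
      intro x
      simp only [List.count_append, List.count_cons, List.count_nil]
      omega

lemma split_list {W : Type*} (l : List W) (a b c : ℕ) (ha : 0 < a) (hab : a < b) (hbc : b < c)
    (hc : c < l.length) : ∃ S0 S1 S2 S3 : List W, l = S0 ++ (S1 ++ (S2 ++ S3)) ∧
      S0 ≠ [] ∧ S1 ≠ [] ∧ S2 ≠ [] ∧ S3 ≠ [] ∧ S0.getLast? = l[a - 1]? ∧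
      S1.head? = l[a]? ∧ S1.getLast? = l[b - 1]? ∧ S2.head? = l[b]? ∧ S2.getLast? = l[c - 1]? ∧
      S3.head? = l[c]? := by
  refine ⟨l.take a, (l.drop a).take (b - a), (l.drop b).take (c - b), l.drop c, ?_, ?_, ?_, ?_, ?_,
    ?_, ?_, ?_, ?_, ?_, ?_⟩
  · have e1 : l.drop b = (l.drop b).take (c - b) ++ l.drop c := by
      conv_lhs => rw [← List.take_append_drop (c - b) (l.drop b)]
      rw [List.drop_drop]; congr 3; omega
    have e2 : l.drop a = (l.drop a).take (b - a) ++ l.drop b := by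
      conv_lhs => rw [← List.take_append_drop (b - a) (l.drop a)]
      rw [List.drop_drop]; congr 3; omega
    rw [← e1, ← e2, List.take_append_drop]
  iterate 4
    · intro h
      have := congrArg List.length h
      simp only [List.length_take, List.length_drop, List.length_nil] at this
      omega
  all_goals simp only [List.getLast?_eq_getElem?, List.head?_eq_getElem?, List.getElem?_take,
    List.getElem?_drop, List.length_take, List.length_drop]
  · rw [if_pos (by omega)]; congr 1; omega
  · rw [if_pos (by omega)]; rfl
  · rw [if_pos (by omega)]; congr 1; omega
  · rw [if_pos (by omega)]; rfl
  · rw [if_pos (by omega)]; congr 1; omega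
  · rfl

/-- Choice of the three cutting positions used to reroute a cycle through a new vertex. -/
lemma exists_cut_positions {W : Type*} [DecidableEq W] (T : W → W → Prop) (S : Finset W) (s : ℕ)
    (hexp : ∀ A ⊆ S, ∀ B ⊆ S, Disjoint A B → s ≤ A.card → s ≤ B.card → ∃ a ∈ A, ∃ b ∈ B, T a b)
    (L : ℕ) (g : ℕ → W) (hgS : ∀ i < L, g i ∈ S) (hginj : ∀ i < L, ∀ j < L, g i = g j → i = j)
    (O I Tt : Finset ℕ) (hO : s ≤ O.card) (hI : s ≤ I.card) (hT : 2 * s ≤ Tt.card)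
    (hO' : ∀ o ∈ O, 0 < o ∧ o < L) (hI' : ∀ i ∈ I, i + 1 < L) (hT' : ∀ t ∈ Tt, 0 < t ∧ t < L)
    (hOT : ∀ o ∈ O, ∀ t ∈ Tt, o - 1 ≠ t) (hIT : ∀ i ∈ I, ∀ t ∈ Tt, t - 1 ≠ i + 1) :
    ∃ o ∈ O, ∃ i ∈ I, ∃ t ∈ Tt, T (g (o - 1)) (g t) ∧ T (g (t - 1)) (g (i + 1)) := by
  classical
  let B1 := Tt.filter (fun t => ∀ o ∈ O, ¬ T (g (o - 1)) (g t))
  let B2 := Tt.filter (fun t => ∀ i ∈ I, ¬ T (g (t - 1)) (g (i + 1)))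
  have hB1 : B1.card < s := by
    by_contra hlt
    obtain ⟨a, ha, b, hb, hab⟩ := hexp (O.image fun o => g (o - 1)) (by
        intro x hx
        obtain ⟨o, ho, rfl⟩ := Finset.mem_image.1 hx
        have := hO' o ho
        exact hgS _ (by omega)) (B1.image g) (by
        intro x hx
        obtain ⟨t, ht, rfl⟩ := Finset.mem_image.1 hx
        exact hgS _ (hT' t (Finset.mem_filter.1 ht).1).2) (by
        rw [Finset.disjoint_left]
        intro x hx hx'
        obtain ⟨o, ho, rfl⟩ := Finset.mem_image.1 hx
        obtain ⟨t, ht, he⟩ := Finset.mem_image.1 hx'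
        have h1 := hO' o ho
        have h2 := (Finset.mem_filter.1 ht).1
        have := hginj _ (hT' t h2).2 _ (by omega) he
        exact hOT o ho t h2 this.symm) (by
        rw [Finset.card_image_of_injOn]
        · exact hO
        · intro x hx y hy hxy
          have h1 := hO' x hx
          have h2 := hO' y hy
          have := hginj _ (by omega) _ (by omega) hxy
          omega) (by
        rw [Finset.card_image_of_injOn]
        · omega
        · intro x hx y hy hxy
          exact hginj _ (hT' x (Finset.mem_filter.1 hx).1).2 _
            (hT' y (Finset.mem_filter.1 hy).1).2 hxy)
    obtain ⟨o, ho, rfl⟩ := Finset.mem_image.1 ha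
    obtain ⟨t, ht, rfl⟩ := Finset.mem_image.1 hb
    exact (Finset.mem_filter.1 ht).2 o ho hab
  have hB2 : B2.card < s := by
    by_contra hlt
    obtain ⟨a, ha, b, hb, hab⟩ := hexp (B2.image fun t => g (t - 1)) (by
        intro x hx
        obtain ⟨o, ho, rfl⟩ := Finset.mem_image.1 hx
        have := hT' o (Finset.mem_filter.1 ho).1
        exact hgS _ (by omega)) (I.image fun i => g (i + 1)) (by
        intro x hx
        obtain ⟨t, ht, rfl⟩ := Finset.mem_image.1 hx
        exact hgS _ (hI' t ht)) (by
        rw [Finset.disjoint_left]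
        intro x hx hx'
        obtain ⟨t, ht, rfl⟩ := Finset.mem_image.1 hx
        obtain ⟨i, hi, he⟩ := Finset.mem_image.1 hx'
        have h1 := hT' t (Finset.mem_filter.1 ht).1
        have := hginj _ (hI' i hi) _ (by omega) he
        exact hIT i hi t (Finset.mem_filter.1 ht).1 this.symm) (by
        rw [Finset.card_image_of_injOn]
        · omega
        · intro x hx y hy hxy
          have h1 := hT' x (Finset.mem_filter.1 hx).1
          have h2 := hT' y (Finset.mem_filter.1 hy).1
          have := hginj _ (by omega) _ (by omega) hxy
          omega) (by
        rw [Finset.card_image_of_injOn]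
        · exact hI
        · intro x hx y hy hxy
          have := hginj _ (hI' x hx) _ (hI' y hy) hxy
          omega)
    obtain ⟨o, ho, rfl⟩ := Finset.mem_image.1 ha
    obtain ⟨t, ht, rfl⟩ := Finset.mem_image.1 hb
    exact (Finset.mem_filter.1 ho).2 t ht hab
  have : ¬ Tt ⊆ B1 ∪ B2 := by
    intro h
    have h1 := Finset.card_le_card h
    have h2 := Finset.card_union_le B1 B2
    omega
  rw [Finset.not_subset] at this
  obtain ⟨t, ht, hn⟩ := this
  simp only [B1, B2, Finset.mem_union, Finset.mem_filter, ht, true_and, not_or, not_forall,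
    not_not] at hn
  obtain ⟨⟨o, ho, h1⟩, ⟨i, hi, h2⟩⟩ := hn
  exact ⟨o, ho, i, hi, t, ht, h1, h2⟩

/-- Extending an almost spanning cycle by one vertex. -/
lemma CycChain.extend {W : Type*} [DecidableEq W] (T : W → W → Prop) (S : Finset W) (s : ℕ)
    (hs : 0 < s)
    (hexp : ∀ A ⊆ S, ∀ B ⊆ S, Disjoint A B → s ≤ A.card → s ≤ B.card → ∃ a ∈ A, ∃ b ∈ B, T a b)
    (l : List W) (hn : l.Nodup) (hl : ∀ x ∈ l, x ∈ S) (hc : CycChain T l) (z : W)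
    (O I : Finset W) (hO : 12 * s ≤ O.card) (hI : 12 * s ≤ I.card)
    (hOl : ∀ x ∈ O, x ∈ l ∧ T z x) (hIl : ∀ x ∈ I, x ∈ l ∧ T x z) :
    ∃ l', CycChain T l' ∧ l'.Perm (z :: l) := by
  classical
  set L := l.length with hL
  let g : ℕ → W := fun i => l.getD i z
  have hg : ∀ i < L, l[i]? = some (g i) := by
    intro i hi
    simp only [g, List.getD_eq_getElem?_getD]
    rw [List.getElem?_eq_getElem hi]; rfl
  have hg' : ∀ i (hi : i < L), g i = l[i] := by
    intro i hi
    have := hg i hi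
    rw [List.getElem?_eq_getElem hi] at this
    exact (Option.some.inj this).symm
  have hgS : ∀ i < L, g i ∈ S := fun i hi => by
    rw [hg' i hi]; exact hl _ (List.getElem_mem hi)
  have hginj : ∀ i < L, ∀ j < L, g i = g j → i = j := by
    intro i hi j hj h
    rw [hg' i hi, hg' j hj] at h
    exact (List.Nodup.getElem_inj_iff hn).1 h
  have idx : ∀ X : Finset W, 12 * s ≤ X.card → (∀ x ∈ X, x ∈ l) →
      10 * s ≤ ((Finset.Ico 1 (L - 1)).filter (fun i => g i ∈ X)).card := by
    intro X hX hXl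
    have h1 : X ⊆ ((Finset.range L).filter (fun i => g i ∈ X)).image g := by
      intro x hx
      obtain ⟨i, hi, rfl⟩ := List.mem_iff_getElem.1 (hXl x hx)
      exact Finset.mem_image.2 ⟨i, by simp [hg' i hi, hx]; exact hi, hg' i hi⟩
    have h2 := (Finset.card_le_card h1).trans Finset.card_image_le
    have h3 : (Finset.range L).filter (fun i => g i ∈ X) ⊆
        (Finset.Ico 1 (L - 1)).filter (fun i => g i ∈ X) ∪ {0, L - 1} := by
      intro i hi
      simp only [Finset.mem_filter, Finset.mem_range, Finset.mem_union, Finset.mem_Ico,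
        Finset.mem_insert, Finset.mem_singleton] at hi ⊢
      by_cases h : i = 0 ∨ i = L - 1
      · exact Or.inr h
      · exact Or.inl ⟨by omega, hi.2⟩
    have h4 := (Finset.card_le_card h3).trans (Finset.card_union_le _ _)
    have h5 : ({0, L - 1} : Finset ℕ).card ≤ 2 := Finset.card_le_two
    omega
  have hO10 := idx O hO (fun x hx => (hOl x hx).1)
  have hI10 := idx I hI (fun x hx => (hIl x hx).1)
  set Oi := (Finset.Ico 1 (L - 1)).filter (fun i => g i ∈ O) with hOi
  set Ii := (Finset.Ico 1 (L - 1)).filter (fun i => g i ∈ I) with hIi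
  have mO : ∀ o ∈ Oi, 0 < o ∧ o + 1 < L ∧ T z (g o) := by
    intro o ho
    simp only [hOi, Finset.mem_filter, Finset.mem_Ico] at ho
    exact ⟨by omega, by omega, (hOl _ ho.2).2⟩
  have mI : ∀ o ∈ Ii, 0 < o ∧ o + 1 < L ∧ T (g o) z := by
    intro o ho
    simp only [hIi, Finset.mem_filter, Finset.mem_Ico] at ho
    exact ⟨by omega, by omega, (hIl _ ho.2).2⟩
  -- the first `s` out-neighbours lie before `τ`
  have hex : ∃ τ, s ≤ (Oi.filter (· < τ)).card := by
    refine ⟨L, ?_⟩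
    rw [Finset.filter_true_of_mem]
    · omega
    · intro o ho; have := mO o ho; omega
  obtain ⟨τ, hτ1, hτ2⟩ : ∃ τ, s ≤ (Oi.filter (· < τ)).card ∧ (Oi.filter (· < τ)).card ≤ s := by
    refine ⟨Nat.find hex, Nat.find_spec hex, ?_⟩
    rcases Nat.eq_zero_or_pos (Nat.find hex) with h0 | h0
    · simp [h0]
    · have h1 := Nat.find_min hex (m := Nat.find hex - 1) (by omega)
      have h2 : Oi.filter (· < Nat.find hex) ⊆
          insert (Nat.find hex - 1) (Oi.filter (· < Nat.find hex - 1)) := by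
        intro x hx
        simp only [Finset.mem_filter, Finset.mem_insert] at hx ⊢
        by_cases h : x = Nat.find hex - 1
        · exact Or.inl h
        · exact Or.inr ⟨hx.1, by omega⟩
      have h3 := (Finset.card_le_card h2).trans (Finset.card_insert_le _ _)
      omega
  by_cases hcase : s ≤ (Ii.filter (τ + 2 * s ≤ ·)).card
  · obtain ⟨o, ho, i, hi, t, ht, h1, h2⟩ := exists_cut_positions T S s hexp L g hgS hginj
      (Oi.filter (· < τ)) (Ii.filter (τ + 2 * s ≤ ·)) (Finset.Ico τ (τ + 2 * s)) hτ1 hcase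
      (by simp)
      (by intro o ho; have := mO o (Finset.mem_filter.1 ho).1; omega)
      (by intro o ho; have := mI o (Finset.mem_filter.1 ho).1; omega)
      (by
        intro t ht
        have h1 : (Ii.filter (τ + 2 * s ≤ ·)).Nonempty := by rw [← Finset.card_pos]; omega
        obtain ⟨i, hi⟩ := h1
        have h2 : (Oi.filter (· < τ)).Nonempty := by rw [← Finset.card_pos]; omega
        obtain ⟨o, ho⟩ := h2
        rw [Finset.mem_filter] at hi ho
        have := mI i hi.1
        rw [Finset.mem_Ico] at ht
        omega)
      (by
        intro o ho t ht
        rw [Finset.mem_filter] at ho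
        have := mO o ho.1
        rw [Finset.mem_Ico] at ht
        omega)
      (by
        intro o ho t ht
        rw [Finset.mem_filter] at ho
        rw [Finset.mem_Ico] at ht
        omega)
    rw [Finset.mem_filter] at ho hi
    rw [Finset.mem_Ico] at ht
    have mo := mO o ho.1
    have mi := mI i hi.1
    obtain ⟨S0, S1, S2, S3, he, n0, n1, n2, n3, l0, f1, l1, f2, l2, f3⟩ :=
      split_list l o t (i + 1) (by omega) (by omega) (by omega) (by omega)
    rw [hg _ (by omega)] at l0 f1 l1 f2 l2 f3
    rw [he] at hc ⊢
    refine hc.reroute n0 n1 n2 n3 (Or.inl ?_)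
    rw [l0, f1, l1, f2, l2, f3]
    simp only [Option.mem_def, Option.some.injEq, forall_eq', Nat.add_sub_cancel]
    exact ⟨h1, mi.2.2, mo.2.2, h2⟩
  · have hsplit : Ii ⊆ Ii.filter (τ + 2 * s ≤ ·) ∪ (Ii.filter (fun i => 2 * s < i ∧ i < τ)) ∪
        (Finset.Ico τ (τ + 2 * s)) ∪ Finset.range (2 * s + 1) := by
      intro i hi
      simp only [Finset.mem_union, Finset.mem_filter, hi, true_and, Finset.mem_Ico,
        Finset.mem_range]
      omega
    have c1 := (Finset.card_le_card hsplit).trans (Finset.card_union_le _ _)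
    have c2 := Finset.card_union_le (Ii.filter (τ + 2 * s ≤ ·) ∪
      (Ii.filter (fun i => 2 * s < i ∧ i < τ))) (Finset.Ico τ (τ + 2 * s))
    have c3 := Finset.card_union_le (Ii.filter (τ + 2 * s ≤ ·))
      (Ii.filter (fun i => 2 * s < i ∧ i < τ))
    rw [Nat.card_Ico] at c2
    rw [Finset.card_range] at c1
    have hsplit' : Oi ⊆ Oi.filter (· < τ) ∪ Oi.filter (τ < ·) ∪ {τ} := by
      intro i hi
      simp only [Finset.mem_union, Finset.mem_filter, hi, true_and, Finset.mem_singleton]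
      omega
    have d1 := (Finset.card_le_card hsplit').trans (Finset.card_union_le _ _)
    have d2 := Finset.card_union_le (Oi.filter (· < τ)) (Oi.filter (τ < ·))
    rw [Finset.card_singleton] at d1
    have hIc : s ≤ (Ii.filter (fun i => 2 * s < i ∧ i < τ)).card := by omega
    have hOc : s ≤ (Oi.filter (τ < ·)).card := by omega
    obtain ⟨o, ho, i, hi, t, ht, h1, h2⟩ := exists_cut_positions T S s hexp L g hgS hginj
      (Oi.filter (τ < ·)) (Ii.filter (fun i => 2 * s < i ∧ i < τ)) (Finset.Ico 1 (2 * s + 1))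
      hOc hIc (by simp)
      (by intro o ho; have := mO o (Finset.mem_filter.1 ho).1; omega)
      (by intro o ho; have := mI o (Finset.mem_filter.1 ho).1; omega)
      (by
        intro t ht
        have h1 : (Ii.filter (fun i => 2 * s < i ∧ i < τ)).Nonempty := by
          rw [← Finset.card_pos]; omega
        obtain ⟨i, hi⟩ := h1
        rw [Finset.mem_filter] at hi
        have := mI i hi.1
        rw [Finset.mem_Ico] at ht
        omega)
      (by
        intro o ho t ht
        have h1 : (Ii.filter (fun i => 2 * s < i ∧ i < τ)).Nonempty := by
          rw [← Finset.card_pos]; omega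
        obtain ⟨i, hi⟩ := h1
        rw [Finset.mem_filter] at ho hi
        rw [Finset.mem_Ico] at ht
        omega)
      (by
        intro o ho t ht
        rw [Finset.mem_filter] at ho
        rw [Finset.mem_Ico] at ht
        omega)
    rw [Finset.mem_filter] at ho hi
    rw [Finset.mem_Ico] at ht
    have mo := mO o ho.1
    have mi := mI i hi.1
    obtain ⟨S0, S1, S2, S3, he, n0, n1, n2, n3, l0, f1, l1, f2, l2, f3⟩ :=
      split_list l t (i + 1) o (by omega) (by omega) (by omega) (by omega)
    rw [hg _ (by omega)] at l0 f1 l1 f2 l2 f3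
    rw [he] at hc ⊢
    refine hc.reroute n0 n1 n2 n3 (Or.inr ?_)
    rw [l0, f1, l1, f2, l2, f3]
    simp only [Option.mem_def, Option.some.injEq, forall_eq', Nat.add_sub_cancel]
    exact ⟨h2, mi.2.2, mo.2.2, h1⟩

/-- Hamilton cycles in digraphs of large semidegree without large empty ordered pairs of sets. -/
lemma exists_hamilton_cycChain {W : Type*} [DecidableEq W] (T : W → W → Prop)
    [DecidableRel T] (S : Finset W) (s : ℕ) (hs : 0 < s)
    (hexp : ∀ A ⊆ S, ∀ B ⊆ S, Disjoint A B → s ≤ A.card → s ≤ B.card → ∃ a ∈ A, ∃ b ∈ B, T a b)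
    (hne : S.Nonempty)
    (hout : ∀ z ∈ S, 20 * s ≤ (S.filter (fun y => T z y)).card)
    (hin : ∀ z ∈ S, 20 * s ≤ (S.filter (fun y => T y z)).card) :
    ∃ l : List W, l.Nodup ∧ CycChain T l ∧ ∀ x, x ∈ l ↔ x ∈ S := by
  classical
  let good : ℕ → Prop := fun k => ∃ l : List W, l.Nodup ∧ CycChain T l ∧ (∀ x ∈ l, x ∈ S) ∧
    l.length = k
  have hlen : ∀ l : List W, l.Nodup → (∀ x ∈ l, x ∈ S) → l.length ≤ S.card := by
    intro l hn hm
    rw [← List.toFinset_card_of_nodup hn]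
    exact Finset.card_le_card (by intro x; simpa using hm x)
  have hS20 : 20 * s ≤ S.card := by
    obtain ⟨z, hz⟩ := hne
    exact (hout z hz).trans (Finset.card_filter_le _ _)
  -- an initial long cycle
  obtain ⟨k₀, hk₀, hgood₀⟩ : ∃ k, S.card ≤ k + 4 * s ∧ good k := by
    obtain ⟨l, hn, hc, hl, hcard⟩ := exists_long_path T S s hexp
    have hlS := hlen l hn hl
    have e1 := List.take_append_drop s l
    have e2 := List.take_append_drop (l.length - 2 * s) (l.drop s)
    rw [← e2] at e1
    have e3 := e1
    rw [← e1] at hn hc hl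
    set A := l.take s
    set M := (l.drop s).take (l.length - 2 * s)
    set B := (l.drop s).drop (l.length - 2 * s)
    have lA : A.length = s := by simp [A]; omega
    have lM : M.length = l.length - 2 * s := by simp [M]; omega
    have lB : B.length = s := by simp [B]; omega
    obtain ⟨nA, nMB, dAMB⟩ := List.nodup_append.1 hn
    obtain ⟨nM, nB, dMB⟩ := List.nodup_append.1 nMB
    obtain ⟨b, hb, a, ha, hab⟩ := hexp B.toFinset (by intro x hx; exact hl x (by simp at hx; simp [hx]))
      A.toFinset (by intro x hx; exact hl x (by simp at hx; simp [hx]))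
      (by
        rw [Finset.disjoint_left]
        intro x hx hx'
        exact dAMB x (by simpa using hx') x (by simp at hx; simp [hx]) rfl)
      (by rw [List.toFinset_card_of_nodup nB, lB]) (by rw [List.toFinset_card_of_nodup nA, lA])
    rw [List.mem_toFinset] at hb ha
    obtain ⟨A1, A2, hA⟩ := List.append_of_mem ha
    obtain ⟨B1, B2, hB⟩ := List.append_of_mem hb
    have hfull : A ++ (M ++ B) = A1 ++ ((a :: A2 ++ M ++ B1 ++ [b]) ++ B2) := by
      rw [hA, hB]; simp
    rw [hfull] at hn hc hl
    refine ⟨(a :: A2 ++ M ++ B1 ++ [b]).length, ?_, _, ?_, ?_, ?_, rfl⟩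
    · simp only [List.length_append, List.length_cons]; omega
    · exact (List.nodup_append.1 (List.nodup_append.1 hn).2.1).1
    · intro x hx
      obtain rfl : a = x := by simpa using hx
      rw [List.isChain_append]
      refine ⟨(List.isChain_append.1 (List.isChain_append.1 hc).2.1).1, by simp, ?_⟩
      intro x hx y hy
      rw [List.getLast?_concat] at hx
      simp at hx hy
      subst hx hy
      exact hab
    · intro x hx
      exact hl x (List.mem_append_right _ (List.mem_append_left _ hx))
  have hk₀' : k₀ ≤ S.card := by
    obtain ⟨l, h1, -, h3, h4⟩ := hgood₀
    rw [← h4]; exact hlen l h1 h3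
  obtain ⟨l, hn, hc, hl, hlk⟩ := Nat.findGreatest_spec hk₀' hgood₀
  have hge := Nat.le_findGreatest hk₀' hgood₀
  refine ⟨l, hn, hc, fun z => ⟨hl z, fun hz => ?_⟩⟩
  by_contra hzl
  have hrest : (S \ l.toFinset).card ≤ 4 * s := by
    rw [Finset.card_sdiff_of_subset (by intro x; simpa using hl x),
      List.toFinset_card_of_nodup hn]
    omega
  have key : ∀ X ⊆ S, 20 * s ≤ X.card → 12 * s ≤ (X.filter (· ∈ l)).card := by
    intro X hX h20
    have h1 : X ⊆ X.filter (· ∈ l) ∪ (S \ l.toFinset) := by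
      intro x hx
      by_cases h : x ∈ l
      · simp [hx, h]
      · simp [hX hx, h]
    have := (Finset.card_le_card h1).trans (Finset.card_union_le _ _)
    omega
  obtain ⟨l', hc', hp⟩ := hc.extend T S s hs hexp l hn hl z _ _
    (key _ (Finset.filter_subset _ _) (hout z hz)) (key _ (Finset.filter_subset _ _) (hin z hz))
    (by intro x hx; simp only [Finset.mem_filter] at hx; exact ⟨hx.2, hx.1.2⟩)
    (by intro x hx; simp only [Finset.mem_filter] at hx; exact ⟨hx.2, hx.1.2⟩)
  have hn' : l'.Nodup := hp.nodup_iff.2 (List.nodup_cons.2 ⟨hzl, hn⟩)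
  have hl' : ∀ x ∈ l', x ∈ S := by
    intro x hx
    rcases List.mem_cons.1 (hp.mem_iff.1 hx) with rfl | hx
    · exact hz
    · exact hl x hx
  have hg' : good (l.length + 1) := ⟨l', hn', hc', hl', by rw [hp.length_eq]; simp⟩
  have hle : l.length + 1 ≤ S.card := by
    rw [← List.length_cons (a := z), ← hp.length_eq]; exact hlen l' hn' hl'
  have := Nat.le_findGreatest hle hg'
  omega

/-- Large subsets of `X` and of `Y` are joined by an edge. -/
def NoHole (R : V → V → Prop) (X Y : Finset V) (s : ℕ) : Prop :=
  ∀ A ⊆ X, ∀ B ⊆ Y, s ≤ A.card → s ≤ B.card → ∃ a ∈ A, ∃ b ∈ B, R a b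

lemma exists_matching_of_noHole [DecidableEq V] {R : V → V → Prop} [DecidableRel R]
    (X Y : Finset V) (s : ℕ) (hXY : X.card = Y.card)
    (hNH : NoHole R X Y s) (hX : ∀ x ∈ X, s ≤ (Y.filter (R x ·)).card)
    (hY : ∀ y ∈ Y, s ≤ (X.filter (R · y)).card) :
    ∃ φ : V → V, (∀ x ∈ X, φ x ∈ Y ∧ R x (φ x)) ∧ Set.InjOn φ X := by
  classical
  have hall : ∀ A : Finset X, A.card ≤ (A.biUnion fun x => Y.filter (R x.1 ·)).card := by
    intro A
    rcases A.eq_empty_or_nonempty with rfl | hA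
    · simp
    set N := A.biUnion fun x => Y.filter (R x.1 ·) with hN
    have hAX : A.card ≤ X.card := by
      have := Finset.card_le_univ A; simpa using this
    obtain ⟨x, hx⟩ := hA
    have hsN : s ≤ N.card := (hX x x.2).trans (Finset.card_le_card
      (Finset.subset_biUnion_of_mem (fun x : X => Y.filter (R x.1 ·)) hx))
    have hNY : N ⊆ Y := by
      intro y hy
      obtain ⟨x, -, hy⟩ := Finset.mem_biUnion.1 hy
      exact (Finset.mem_filter.1 hy).1
    have hcAi : (A.image Subtype.val).card = A.card :=
      Finset.card_image_of_injective _ Subtype.val_injective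
    have hAiX : A.image Subtype.val ⊆ X := by
      intro y hy
      obtain ⟨x, -, rfl⟩ := Finset.mem_image.1 hy
      exact x.2
    have hno : ∀ x ∈ A.image Subtype.val, ∀ y ∈ Y \ N, ¬ R x y := by
      intro x hx y hy hR
      obtain ⟨x', hx', rfl⟩ := Finset.mem_image.1 hx
      rw [Finset.mem_sdiff] at hy
      exact hy.2 (Finset.mem_biUnion.2 ⟨x', hx', Finset.mem_filter.2 ⟨hy.1, hR⟩⟩)
    have hcN := Finset.card_sdiff_of_subset hNY
    by_contra hlt
    have hsm : (Y \ N).card < s := by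
      by_contra h
      obtain ⟨a, ha, b, hb, hab⟩ := hNH _ hAiX (Y \ N) Finset.sdiff_subset (by omega) (by omega)
      exact hno a ha b hb hab
    have hne : (Y \ N).Nonempty := by rw [← Finset.card_pos]; omega
    obtain ⟨y, hy⟩ := hne
    have h1 := hY y (Finset.mem_sdiff.1 hy).1
    have h2 : X.filter (R · y) ⊆ X \ A.image Subtype.val := by
      intro x hx
      rw [Finset.mem_filter] at hx
      rw [Finset.mem_sdiff]
      exact ⟨hx.1, fun h => hno x h y hy hx.2⟩
    have h3 := Finset.card_le_card h2
    rw [Finset.card_sdiff_of_subset hAiX] at h3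
    omega
  obtain ⟨f, hf, hf'⟩ := (Finset.all_card_le_biUnion_card_iff_exists_injective _).1 hall
  refine ⟨fun x => if h : x ∈ X then f ⟨x, h⟩ else x, ?_, ?_⟩
  · intro x hx
    simp only [hx, dite_true]
    exact Finset.mem_filter.1 (hf' ⟨x, hx⟩)
  · intro x hx y hy h
    rw [Finset.mem_coe] at hx hy
    simp only [hx, hy, dite_true] at h
    simpa using hf h

/-- A spanning path between prescribed ends in a dense balanced bipartite graph. -/
lemma exists_ham_fill [DecidableEq V] {R : V → V → Prop} [DecidableRel R]
    (hsymm : ∀ u v, R u v → R v u) (X Y : Finset V) (s : ℕ) (hdis : Disjoint X Y)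
    (hXY : X.card = Y.card)
    (hNH : NoHole R X Y s) (hX : ∀ x ∈ X, 20 * s + 20 ≤ (Y.filter (R x ·)).card)
    (hY : ∀ y ∈ Y, 20 * s + 20 ≤ (X.filter (R · y)).card) (u v : V) (huv : R u v)
    (hu : 20 * s + 20 ≤ (Y.filter (R u ·)).card) (hv : 20 * s + 20 ≤ (X.filter (R · v)).card) :
    ∃ l : List V, l.Nodup ∧ (∀ x, x ∈ l ↔ x ∈ X ∪ Y) ∧ List.IsChain R (u :: l ++ [v]) := by
  classical
  obtain ⟨φ, hφ, hinj⟩ := exists_matching_of_noHole X Y s hXY hNH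
    (fun x hx => le_trans (by omega) (hX x hx)) (fun y hy => le_trans (by omega) (hY y hy))
  have himg : X.image φ = Y := by
    apply Finset.eq_of_subset_of_card_le
    · intro y hy
      obtain ⟨x, hx, rfl⟩ := Finset.mem_image.1 hy
      exact (hφ x hx).1
    · rw [Finset.card_image_of_injOn hinj, hXY]
  let la : Option V → V := fun o => o.elim u id
  let he : Option V → V := fun o => o.elim v φ
  let T : Option V → Option V → Prop := fun a b => R (la a) (he b)
  let S : Finset (Option V) := insert none (X.image some)
  let B : Option V → List V := fun o => [he o, la o]
  have hSsome : ∀ x, some x ∈ S ↔ x ∈ X := by intro x; simp [S]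
  have strip : ∀ A ⊆ S, s + 1 ≤ A.card → s ≤ (X.filter (some · ∈ A)).card := by
    intro A hA hAc
    have h1 : A ⊆ insert none ((X.filter (some · ∈ A)).image some) := by
      intro o ho
      cases o with
      | none => simp
      | some x => simp [ho, (hSsome x).1 (hA ho)]
    have h2 := (Finset.card_le_card h1).trans (Finset.card_insert_le _ _)
    have h3 : ((X.filter (some · ∈ A)).image some).card ≤ (X.filter (some · ∈ A)).card :=
      Finset.card_image_le
    omega
  have hla : ∀ o ∈ S, 20 * s + 20 ≤ (Y.filter (R (la o) ·)).card := by
    intro o ho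
    cases o with
    | none => exact hu
    | some x => exact hX x ((hSsome x).1 ho)
  have hhe : ∀ o ∈ S, 20 * s + 20 ≤ (X.filter (R · (he o))).card := by
    intro o ho
    cases o with
    | none => exact hv
    | some x => exact hY _ (hφ x ((hSsome x).1 ho)).1
  obtain ⟨l, hn, hc, hmem⟩ := exists_hamilton_cycChain T S (s + 1) (by omega) (by
      intro A hA C hC _ hAc hCc
      have hsub : (X.filter (some · ∈ C)).image φ ⊆ Y := by
        rw [← himg]; exact Finset.image_subset_image (Finset.filter_subset _ _)
      obtain ⟨a, ha, b, hb, hab⟩ := hNH _ (Finset.filter_subset (some · ∈ A) X) _ hsub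
        (strip A hA hAc) (by
          rw [Finset.card_image_of_injOn (hinj.mono (Finset.coe_subset.2 (Finset.filter_subset _ _)))]
          exact strip C hC hCc)
      obtain ⟨c, hc, rfl⟩ := Finset.mem_image.1 hb
      rw [Finset.mem_filter] at ha hc
      exact ⟨some a, ha.2, some c, hc.2, hab⟩) ⟨none, by simp [S]⟩ (by
      intro z hz
      refine le_trans (by have := hla z hz; omega) (Finset.card_le_card_of_surjOn he
        (s := S.filter (fun y => T z y)) (t := Y.filter (R (la z) ·)) ?_)
      intro y hy
      rw [Finset.mem_coe, Finset.mem_filter, ← himg, Finset.mem_image] at hy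
      obtain ⟨⟨x, hx, rfl⟩, hR⟩ := hy
      refine ⟨some x, ?_, rfl⟩
      simp only [Finset.coe_filter, Set.mem_ofPred_eq, hSsome]
      exact ⟨hx, hR⟩) (by
      intro z hz
      refine le_trans (by have := hhe z hz; omega) (Finset.card_le_card_of_surjOn la
        (s := S.filter (fun y => T y z)) (t := X.filter (R · (he z))) ?_)
      intro x hx
      rw [Finset.mem_coe, Finset.mem_filter] at hx
      refine ⟨some x, ?_, rfl⟩
      simp only [Finset.coe_filter, Set.mem_ofPred_eq, hSsome]
      exact ⟨hx.1, hx.2⟩)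
  -- rotate the cycle to start at `none`
  obtain ⟨p, q, rfl⟩ := List.append_of_mem ((hmem none).2 (by simp [S]))
  have hchain : List.IsChain T (none :: (q ++ p) ++ [none]) := by
    cases p with
    | nil => simpa using hc none (by simp)
    | cons a p =>
      have h1 := hc a (by simp)
      rw [show (a :: p ++ none :: q ++ [a]) = (a :: p) ++ ((none :: q) ++ [a]) by simp,
        List.isChain_append] at h1
      rw [show (none :: (q ++ a :: p) ++ [none]) = (none :: q) ++ ((a :: p) ++ [none]) by simp,
        List.isChain_append]
      obtain ⟨c1, c2, c3⟩ := h1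
      rw [List.isChain_append] at c2
      refine ⟨c2.1, List.isChain_append.2 ⟨c1, by simp, ?_⟩, ?_⟩
      · intro x hx y hy; exact c3 x hx y (by simpa using hy)
      · intro x hx y hy; exact c2.2.2 x hx y (by simpa using hy)
  have hn' : (none :: (q ++ p)).Nodup := by
    have : (p ++ none :: q).Perm (none :: (q ++ p)) :=
      List.perm_append_comm.trans (by simp)
    exact this.nodup_iff.1 hn
  have hmem' : ∀ o, o ∈ q ++ p ↔ ∃ x ∈ X, o = some x := by
    intro o
    have h1 := hmem o
    have h2 := (List.nodup_cons.1 hn').1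
    cases o with
    | none => simpa using h2
    | some x => simp [hSsome] at h1 ⊢; rw [← h1]; tauto
  have hfull : List.IsChain R ((none :: (q ++ p) ++ [none]).flatMap B) := by
    refine isChain_flatMap (Q := T) B _ hchain (by simp [B]) ?_ ?_
    · intro o ho
      simp only [B, List.isChain_pair]
      cases o with
      | none => exact hsymm _ _ huv
      | some x =>
        have : some x ∈ q ++ p := by simpa using ho
        obtain ⟨x', hx', h⟩ := (hmem' _).1 this
        obtain rfl := Option.some.inj h
        exact hsymm _ _ (hφ x hx').2
    · intro a _ b _ hab x hx y hy
      simp [B] at hx hy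
      subst hx hy
      exact hab
  refine ⟨(q ++ p).flatMap B, ?_, ?_, ?_⟩
  · rw [List.nodup_flatMap]
    constructor
    · intro o ho
      obtain ⟨x, hx, rfl⟩ := (hmem' o).1 ho
      have : φ x ≠ x := fun h => Finset.disjoint_left.1 hdis hx (h ▸ (hφ x hx).1)
      simpa [B, he, la] using this
    · refine List.Pairwise.imp_of_mem ?_ (List.nodup_cons.1 hn').2
      intro o o' ho ho' hne
      obtain ⟨x, hx, rfl⟩ := (hmem' o).1 ho
      obtain ⟨x', hx', rfl⟩ := (hmem' o').1 ho'
      have hxx : x ≠ x' := fun h => hne (by rw [h])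
      have h1 : φ x ≠ x' := fun h => Finset.disjoint_left.1 hdis hx' (h ▸ (hφ x hx).1)
      have h2 : x ≠ φ x' := fun h => Finset.disjoint_left.1 hdis hx (h ▸ (hφ x' hx').1)
      have h3 : φ x ≠ φ x' := fun h => hxx (hinj hx hx' h)
      simp [Function.onFun, B, he, la, hxx.symm, h1.symm, h2.symm, h3.symm]
  · intro y
    rw [List.mem_flatMap]
    constructor
    · rintro ⟨o, ho, hy⟩
      obtain ⟨x, hx, rfl⟩ := (hmem' o).1 ho
      simp [B, he, la] at hy
      rcases hy with rfl | rfl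
      · exact Finset.mem_union_right _ (hφ x hx).1
      · exact Finset.mem_union_left _ hx
    · intro hy
      rcases Finset.mem_union.1 hy with hy | hy
      · exact ⟨some y, (hmem' _).2 ⟨y, hy, rfl⟩, by simp [B, la]⟩
      · rw [← himg] at hy
        obtain ⟨x, hx, rfl⟩ := Finset.mem_image.1 hy
        exact ⟨some x, (hmem' _).2 ⟨x, hx, rfl⟩, by simp [B, he]⟩
  · have e : (none :: (q ++ p) ++ [none]).flatMap B =
        [v] ++ ((u :: (q ++ p).flatMap B ++ [v]) ++ [u]) := by
      simp [B, he, la]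
    rw [e] at hfull
    exact (List.isChain_append.1 (List.isChain_append.1 hfull).2.1).1

/-- Among any `s` vertices of `X`, one sees at least a `1/P` fraction of any given
large subset of `Y`. -/
def HalfGood (R : V → V → Prop) [DecidableRel R] (X Y : Finset V) (s P : ℕ) : Prop :=
  ∀ A ⊆ X, ∀ B ⊆ Y, s ≤ A.card → s ≤ B.card → ∃ a ∈ A, B.card ≤ P * (B.filter (R a ·)).card

lemma HalfGood.mono {R : V → V → Prop} [DecidableRel R] {X Y X' Y' : Finset V} {s P : ℕ}
    (h : HalfGood R X Y s P) (hX : X' ⊆ X) (hY : Y' ⊆ Y) : HalfGood R X' Y' s P :=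
  fun A hA B hB => h A (hA.trans hX) B (hB.trans hY)

lemma HalfGood.noHole {R : V → V → Prop} [DecidableRel R] {X Y : Finset V} {s P : ℕ}
    (h : HalfGood R X Y s P) (hs : 0 < s) : NoHole R X Y s := by
  intro A hA B hB hAs hBs
  obtain ⟨a, ha, hc⟩ := h A hA B hB hAs hBs
  have : 0 < (B.filter (R a ·)).card := by
    rcases Nat.eq_zero_or_pos (B.filter (R a ·)).card with h0 | h0
    · rw [h0] at hc; omega
    · exact h0
  obtain ⟨b, hb⟩ := Finset.card_pos.1 this
  rw [Finset.mem_filter] at hb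
  exact ⟨a, ha, b, hb.1, hb.2⟩

lemma HalfGood.card_low_lt {R : V → V → Prop} [DecidableRel R] {X Y : Finset V} {s P : ℕ}
    (h : HalfGood R X Y s P) (B : Finset V) (hB : B ⊆ Y) (hBs : s ≤ B.card) :
    (X.filter (fun x => P * (B.filter (R x ·)).card < B.card)).card < s := by
  by_contra hlt
  obtain ⟨a, ha, hc⟩ := h _ (Finset.filter_subset _ _) B hB (not_lt.1 hlt) hBs
  have := (Finset.mem_filter.1 ha).2
  omega

/-- The vertices of a set which see many vertices of `B`. -/
lemma HalfGood.card_high {R : V → V → Prop} [DecidableRel R] {X Y : Finset V} {s P : ℕ}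
    (h : HalfGood R X Y s P) (B : Finset V) (hB : B ⊆ Y) (hBs : s ≤ B.card) (X' : Finset V)
    (hX' : X' ⊆ X) :
    X'.card ≤ (X'.filter (fun x => B.card ≤ P * (B.filter (R x ·)).card)).card + s := by
  have h1 := (h.mono hX' le_rfl).card_low_lt B hB hBs
  have h2 := Finset.card_filter_add_card_filter_not (s := X')
    (fun x => B.card ≤ P * (B.filter (R x ·)).card)
  simp only [not_le] at h2
  omega

/-- A path with prescribed ends and exactly `k` inner vertices in each of `X`, `Y`. -/
lemma exists_fill [DecidableEq V] {R : V → V → Prop} [DecidableRel R]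
    (hsymm : ∀ u v, R u v → R v u) (s P : ℕ) (hs : 0 < s) (hP : 0 < P) (v : V) (k : ℕ) :
    ∀ (X Y : Finset V) (u : V), Disjoint X Y → HalfGood R X Y s P → k + 2 * s ≤ X.card →
      k + P * (s + 1) ≤ Y.card → s ≤ (Y.filter (R u ·)).card → k + s ≤ (X.filter (R v ·)).card →
      (k = 0 → R u v) →
      ∃ l : List V, l.Nodup ∧ List.IsChain R (u :: l ++ [v]) ∧ (∀ x ∈ l, x ∈ X ∪ Y) ∧
        (l.toFinset ∩ X).card = k ∧ (l.toFinset ∩ Y).card = k := by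
  induction k with
  | zero =>
    intro X Y u _ _ _ _ _ _ huv
    exact ⟨[], by simp, by simpa using huv rfl, by simp, by simp, by simp⟩
  | succ k ih =>
    intro X Y u hdis hG hX hY hu hv _
    rcases Nat.eq_zero_or_pos k with rfl | hk
    · obtain ⟨x, hx, y, hy, hxy⟩ := hG.noHole hs (X.filter (R v ·)) (Finset.filter_subset _ _)
        (Y.filter (R u ·)) (Finset.filter_subset _ _) (by omega) hu
      rw [Finset.mem_filter] at hx hy
      have hne : y ≠ x := fun h => Finset.disjoint_left.1 hdis hx.1 (h ▸ hy.1)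
      have hyX : y ∉ X := fun h => Finset.disjoint_left.1 hdis h hy.1
      have hxY : x ∉ Y := fun h => Finset.disjoint_left.1 hdis hx.1 h
      refine ⟨[y, x], by simpa using hne, ?_, ?_, ?_, ?_⟩
      · simp [hy.2, hsymm _ _ hxy, hsymm _ _ hx.2]
      · simp [hx.1, hy.1]
      · rw [show [y, x].toFinset ∩ X = {x} by
          ext z; simp only [List.toFinset_cons, List.toFinset_nil, insert_empty_eq,
            Finset.mem_inter, Finset.mem_insert, Finset.mem_singleton]
          constructor
          · rintro ⟨rfl | rfl, h⟩
            · exact absurd h hyX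
            · rfl
          · rintro rfl; exact ⟨Or.inr rfl, hx.1⟩]
        simp
      · rw [show [y, x].toFinset ∩ Y = {y} by
          ext z; simp only [List.toFinset_cons, List.toFinset_nil, insert_empty_eq,
            Finset.mem_inter, Finset.mem_insert, Finset.mem_singleton]
          constructor
          · rintro ⟨rfl | rfl, h⟩
            · rfl
            · exact absurd h hxY
          · rintro rfl; exact ⟨Or.inl rfl, hy.1⟩]
        simp
    · have hPs : s ≤ P * (s + 1) := by nlinarith
      have hhigh := hG.card_high Y le_rfl (by omega) X le_rfl
      obtain ⟨x, hx, y, hy, hxy⟩ := hG.noHole hs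
        (X.filter (fun x => Y.card ≤ P * (Y.filter (R x ·)).card)) (Finset.filter_subset _ _)
        (Y.filter (R u ·)) (Finset.filter_subset _ _) (by omega) hu
      rw [Finset.mem_filter] at hx hy
      have hne : y ≠ x := fun h => Finset.disjoint_left.1 hdis hx.1 (h ▸ hy.1)
      have hyX : y ∉ X := fun h => Finset.disjoint_left.1 hdis h hy.1
      have hxY : x ∉ Y := fun h => Finset.disjoint_left.1 hdis hx.1 h
      obtain ⟨l, hn, hc, hm, h1, h2⟩ := ih (X.erase x) (Y.erase y) x
        (hdis.mono (Finset.erase_subset _ _) (Finset.erase_subset _ _))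
        (hG.mono (Finset.erase_subset _ _) (Finset.erase_subset _ _))
        (by rw [Finset.card_erase_of_mem hx.1]; omega)
        (by rw [Finset.card_erase_of_mem hy.1]; omega)
        (by
          rw [Finset.filter_erase]
          have := Finset.pred_card_le_card_erase (s := Y.filter (R x ·)) (a := y)
          have : s + 1 ≤ (Y.filter (R x ·)).card := by
            by_contra hlt
            have : P * (Y.filter (R x ·)).card ≤ P * s := Nat.mul_le_mul_left _ (by omega)
            rw [Nat.mul_add] at hY
            omega
          omega)
        (by
          rw [Finset.filter_erase]
          have := Finset.pred_card_le_card_erase (s := X.filter (R v ·)) (a := x)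
          omega) (by omega)
      have hyl : y ∉ l := fun h => by
        have := hm y h; simp [hyX] at this
      have hxl : x ∉ l := fun h => by
        have := hm x h; simp [hxY] at this
      refine ⟨y :: x :: l, ?_, ?_, ?_, ?_, ?_⟩
      · simp [hne, hyl, hxl, hn]
      · exact List.isChain_cons_cons.2 ⟨hy.2, List.isChain_cons_cons.2 ⟨hsymm _ _ hxy, hc⟩⟩
      · intro z hz
        rcases List.mem_cons.1 hz with rfl | hz
        · simp [hy.1]
        rcases List.mem_cons.1 hz with rfl | hz
        · simp [hx.1]
        have := hm z hz
        simp only [Finset.mem_union, Finset.mem_erase] at this ⊢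
        tauto
      · rw [show (y :: x :: l).toFinset ∩ X = insert x (l.toFinset ∩ X.erase x) by
          ext z
          simp only [List.toFinset_cons, Finset.mem_inter, Finset.mem_insert, List.mem_toFinset,
            Finset.mem_erase]
          by_cases hz : z = x
          · subst hz; simp [hx.1]
          · by_cases hz' : z = y
            · subst hz'; simp [hyX, hz]
            · simp [hz, hz'], Finset.card_insert_of_notMem (by simp), h1]
      · rw [show (y :: x :: l).toFinset ∩ Y = insert y (l.toFinset ∩ Y.erase y) by
          ext z
          simp only [List.toFinset_cons, Finset.mem_inter, Finset.mem_insert, List.mem_toFinset,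
            Finset.mem_erase]
          by_cases hz : z = y
          · subst hz; simp [hy.1]
          · by_cases hz' : z = x
            · subst hz'; simp [hxY, hz]
            · simp [hz, hz'], Finset.card_insert_of_notMem (by simp), h2]

/-- Linking two large sets by a short path along a walk of clusters. -/
lemma exists_link [DecidableEq V] {ι : Type*} {R : V → V → Prop} [DecidableRel R]
    (hsymm : ∀ u v, R u v → R v u) (hirr : ∀ v, ¬ R v v) (F : ι → Finset V) (Γ : SimpleGraph ι)
    (s P ℓ : ℕ) (hs : 0 < s) (hP : 0 < P)
    (hG : ∀ i j, Γ.Adj i j → HalfGood R (F i) (F j) s P) (T : Finset V)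
    (hF : ∀ k, T.card + 2 * s + P * ℓ ≤ (F k).card) {i' j : ι} (w : Γ.Walk i' j) :
    ∀ i, Γ.Adj i i' → w.length + 3 ≤ ℓ → ∀ A ⊆ F i, ∀ B ⊆ F j, Disjoint A T → Disjoint B T →
      P * ℓ ≤ A.card → s ≤ A.card → s ≤ B.card →
      ∃ l : List V, l.length = w.length + 2 ∧ l.Nodup ∧ List.IsChain R l ∧
        (∃ a ∈ A, l.head? = some a) ∧ (∃ b ∈ B, l.getLast? = some b) ∧
        ∀ x ∈ l, (∃ k, x ∈ F k) ∧ x ∉ T := by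
  induction w with
  | @nil i' =>
    intro i hadj hℓ A hA B hB hAT hBT hAℓ hAs hBs
    obtain ⟨a, ha, b, hb, hab⟩ := (hG _ _ hadj).noHole hs A hA B hB hAs hBs
    have hne : a ≠ b := by rintro rfl; exact hirr _ hab
    refine ⟨[a, b], by simp, by simpa using hne, by simpa using hab, ⟨a, ha, by simp⟩,
      ⟨b, hb, by simp⟩, ?_⟩
    intro x hx
    simp at hx
    rcases hx with rfl | rfl
    · exact ⟨⟨_, hA ha⟩, Finset.disjoint_left.1 hAT ha⟩
    · exact ⟨⟨_, hB hb⟩, Finset.disjoint_left.1 hBT hb⟩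
  | @cons i' i'' j hadj' w ih =>
    intro i hadj hℓ A hA B hB hAT hBT hAℓ hAs hBs
    rw [SimpleGraph.Walk.length_cons] at hℓ
    have hhigh := (hG _ _ hadj.symm).card_high A hA hAs (F i' \ T) Finset.sdiff_subset
    have hsd := Finset.le_card_sdiff T (F i')
    have hFi := hF i'
    obtain ⟨l, hlen, hn, hc, ⟨y, hy, hhead⟩, hlast, hm⟩ := ih i' hadj' (by omega)
      ((F i' \ T).filter (fun x => A.card ≤ P * (A.filter (R x ·)).card))
      ((Finset.filter_subset _ _).trans Finset.sdiff_subset) B hB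
      (Finset.disjoint_of_subset_left (Finset.filter_subset _ _) Finset.sdiff_disjoint) hBT
      (by omega) (by omega) hBs
    rw [Finset.mem_filter] at hy
    have hcard : ℓ ≤ (A.filter (R y ·)).card :=
      Nat.le_of_mul_le_mul_left (hAℓ.trans hy.2) hP
    obtain ⟨a, ha, hal⟩ : ∃ a ∈ A.filter (R y ·), a ∉ l.toFinset := by
      by_contra hcon
      push Not at hcon
      have h1 := Finset.card_le_card (show A.filter (R y ·) ⊆ l.toFinset from hcon)
      have h2 := List.toFinset_card_le l
      omega
    rw [Finset.mem_filter] at ha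
    rw [List.mem_toFinset] at hal
    obtain ⟨y', l', rfl⟩ := List.exists_cons_of_length_pos (l := l) (by omega)
    obtain rfl : y' = y := by simpa using hhead
    refine ⟨a :: y' :: l', by simp at hlen ⊢; omega, List.nodup_cons.2 ⟨hal, hn⟩,
      List.isChain_cons_cons.2 ⟨hsymm _ _ ha.2, hc⟩, ⟨a, ha.1, by simp⟩, ?_, ?_⟩
    · obtain ⟨b, hb, hb'⟩ := hlast
      exact ⟨b, hb, by rw [List.getLast?_cons_cons]; exact hb'⟩
    · intro x hx
      rcases List.mem_cons.1 hx with rfl | hx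
      · exact ⟨⟨_, hA ha.1⟩, Finset.disjoint_left.1 hAT ha.1⟩
      · exact hm x hx

/-- Hall's theorem with capacities. -/
theorem exists_transport {ι : Type*} [Fintype ι] [DecidableEq ι] (H : ι → ι → Prop)
    [DecidableRel H] (a a' : ι → ℕ) (hsum : ∑ i, a i = ∑ i, a' i)
    (hall : ∀ X : Finset ι,
      ∑ i ∈ X, a i ≤ ∑ j ∈ Finset.univ.filter (fun j => ∃ i ∈ X, H i j), a' j) :
    ∃ x : ι → ι → ℕ, (∀ i j, x i j ≠ 0 → H i j) ∧ (∀ i, ∑ j, x i j = a i) ∧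
      ∀ j, ∑ i, x i j = a' j := by
  classical
  let t : (Σ i, Fin (a i)) → Finset (Σ i, Fin (a' i)) := fun p => Finset.univ.filter (fun q => H p.1 q.1)
  have key : ∃ f : (Σ i, Fin (a i)) → (Σ i, Fin (a' i)), Function.Injective f ∧ ∀ p, f p ∈ t p := by
    rw [← Finset.all_card_le_biUnion_card_iff_exists_injective]
    intro S
    have h1 : S.card ≤ ∑ i ∈ S.image Sigma.fst, a i := by
      have : S ⊆ (S.image Sigma.fst).sigma (fun _ => Finset.univ) := by
        intro p hp
        simp only [Finset.mem_sigma, Finset.mem_univ, and_true]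
        exact Finset.mem_image_of_mem _ hp
      refine (Finset.card_le_card this).trans ?_
      simp [Finset.card_sigma]
    have h2 : S.biUnion t = (Finset.univ.filter
        (fun j => ∃ i ∈ S.image Sigma.fst, H i j)).sigma (fun _ => Finset.univ) := by
      ext q
      simp [t]
    rw [h2, Finset.card_sigma]
    refine h1.trans ((hall _).trans ?_)
    simp
  obtain ⟨f, hf, hft⟩ := key
  have hbij : Function.Bijective f := by
    rw [Fintype.bijective_iff_injective_and_card]
    refine ⟨hf, ?_⟩
    simp [hsum]
  refine ⟨fun i j => (Finset.univ.filter (fun k : Fin (a i) => (f ⟨i, k⟩).1 = j)).card,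
    ?_, ?_, ?_⟩
  · intro i j h
    obtain ⟨k, hk⟩ := Finset.card_ne_zero.1 h
    rw [Finset.mem_filter] at hk
    have := hft ⟨i, k⟩
    simp only [t, Finset.mem_filter] at this
    rw [← hk.2]; exact this.2
  · intro i
    rw [← Finset.card_eq_sum_card_fiberwise (f := fun k : Fin (a i) => (f ⟨i, k⟩).1)
      (s := Finset.univ) (t := Finset.univ) (by intro _ _; simp)]
    simp
  · intro j
    have h1 : ∑ i, (Finset.univ.filter (fun k : Fin (a i) => (f ⟨i, k⟩).1 = j)).card
        = (Finset.univ.filter (fun p : (Σ i, Fin (a i)) => (f p).1 = j)).card := by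
      rw [← Finset.card_sigma]
      congr 1
      ext p
      simp
    have h2 : (Finset.univ.filter (fun p : (Σ i, Fin (a i)) => (f p).1 = j)).card
        = (Finset.univ.filter (fun q : (Σ i, Fin (a' i)) => q.1 = j)).card := by
      refine Finset.card_bij (fun p _ => f p) ?_ ?_ ?_
      · intro p hp; simpa using hp
      · intro p _ q _ h; exact hf h
      · intro q hq
        obtain ⟨p, rfl⟩ := hbij.2 q
        exact ⟨p, by simpa using hq, rfl⟩
    have h3 : Finset.univ.filter (fun q : (Σ i, Fin (a' i)) => q.1 = j)
        = ({j} : Finset ι).sigma (fun _ => Finset.univ) := by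
      ext q; simp
    rw [h1, h2, h3, Finset.card_sigma]; simp

/-- The neighbourhood of a finite set under a relation. -/
def nbr {ι : Type*} [Fintype ι] (H : ι → ι → Prop) [DecidableRel H] (X : Finset ι) : Finset ι :=
  Finset.univ.filter (fun j => ∃ i ∈ X, H i j)

theorem mem_nbr {ι : Type*} [Fintype ι] {H : ι → ι → Prop} [DecidableRel H] {X : Finset ι}
    {j : ι} : j ∈ nbr H X ↔ ∃ i ∈ X, H i j := by simp [nbr]

theorem nbr_mono {ι : Type*} [Fintype ι] {H : ι → ι → Prop} [DecidableRel H] {X Y : Finset ι}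
    (h : X ⊆ Y) : nbr H X ⊆ nbr H Y := by
  intro j hj
  rw [mem_nbr] at *
  obtain ⟨i, hi, h'⟩ := hj
  exact ⟨i, h hi, h'⟩

theorem exists_perm_of_card_le_nbr {ι : Type*} [Fintype ι] [DecidableEq ι] (H : ι → ι → Prop)
    [DecidableRel H] (h : ∀ X : Finset ι, X.card ≤ (nbr H X).card) :
    ∃ σ : Equiv.Perm ι, ∀ i, H i (σ i) := by
  have : ∃ f : ι → ι, Function.Injective f ∧ ∀ p, f p ∈ Finset.univ.filter (H p ·) := by
    rw [← Finset.all_card_le_biUnion_card_iff_exists_injective]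
    intro S
    refine (h S).trans (Finset.card_le_card ?_)
    intro j hj
    rw [mem_nbr] at hj
    simpa using hj
  obtain ⟨f, hf, hft⟩ := this
  refine ⟨Equiv.ofBijective f (Finite.injective_iff_bijective.1 hf), fun i => ?_⟩
  simpa using hft i

/-- Every demand vector whose entries are close to `U` can, up to at most `q` units of slack, be
distributed over the edges of `H`. -/
def Distributes {ι : Type*} [Fintype ι] (H : ι → ι → Prop) (sd : ι → ℤ) (U K q : ℕ) : Prop :=
  ∀ b : ι → ℕ, (∀ i, b i ≤ U) → (∀ i, U ≤ b i + K) → |∑ i, sd i * (b i : ℤ)| ≤ q →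
    ∃ (t : ι → ℕ) (x : ι → ι → ℕ), ∑ i, t i ≤ q + 2 ∧ (∀ i j, x i j ≠ 0 → H i j) ∧
      ∀ i, ∑ j, (x i j + x j i) + t i = b i

theorem distributes_of_bipartite {ι : Type*} [Fintype ι] [DecidableEq ι] (H : ι → ι → Prop)
    [DecidableRel H] (sd : ι → ℤ) (U K q D : ℕ) (hsd : ∀ i, sd i = 1 ∨ sd i = -1)
    (hpos : ∃ i, sd i = 1) (hneg : ∃ i, sd i = -1)
    (hH : ∀ X : Finset ι, X.Nonempty → (∀ i ∈ X, sd i = 1) →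
      (∀ j, sd j = -1 → j ∈ nbr H X) ∨
        X.card + D ≤ ((nbr H X).filter (fun j => sd j = -1)).card)
    (hD : Fintype.card ι * (K + q) ≤ D * (U - (K + q))) :
    Distributes H sd U K q := by
  intro b hbU hbK hbq
  set S := ∑ i, sd i * (b i : ℤ) with hS
  obtain ⟨i₀, ε, hε, hi₀⟩ : ∃ i₀, ∃ ε : ℕ, (ε : ℤ) = |S| ∧ sd i₀ * (ε : ℤ) = S := by
    rcases le_total 0 S with h | h
    · obtain ⟨i, hi⟩ := hpos
      exact ⟨i, S.natAbs, by simp, by rw [hi, Int.natCast_natAbs, abs_of_nonneg h, one_mul]⟩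
    · obtain ⟨i, hi⟩ := hneg
      exact ⟨i, S.natAbs, by simp, by rw [hi, Int.natCast_natAbs, abs_of_nonpos h]; ring⟩
  have hεq : ε ≤ q := by
    have : (ε : ℤ) ≤ q := hε ▸ hbq
    exact_mod_cast this
  by_cases hUK : U ≤ K + q
  · -- degenerate: no vertices
    have : Fintype.card ι * (K + q) = 0 := by
      have : U - (K + q) = 0 := by omega
      rw [this] at hD; omega
    have hK : K + q = 0 := by
      rcases Nat.mul_eq_zero.1 this with h | h
      · rw [Fintype.card_eq_zero_iff] at h; exact (h.false i₀).elim
      · exact h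
    refine ⟨fun _ => 0, fun _ _ => 0, by simp, by simp, fun i => ?_⟩
    have := hbU i
    simp; omega
  push Not at hUK
  set t : ι → ℕ := Pi.single i₀ ε with ht
  have htb : ∀ i, t i ≤ b i := by
    intro i
    by_cases h : i = i₀
    · subst h; simp [ht]; have := hbK i; omega
    · simp [ht, h]
  have htq : ∀ i, t i ≤ q := by
    intro i
    by_cases h : i = i₀
    · subst h; simpa [ht]
    · simp [ht, h]
  set b' : ι → ℕ := fun i => b i - t i with hb'
  have hb'1 : ∀ i, b' i ≤ U := fun i => by have := hbU i; simp only [hb']; omega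
  have hb'2 : ∀ i, U - (K + q) ≤ b' i := fun i => by
    have := hbK i; have := htq i; simp only [hb']; omega
  have hsum0 : ∑ i, sd i * (b' i : ℤ) = 0 := by
    have h1 : ∀ i, sd i * (b' i : ℤ) = sd i * (b i : ℤ) - sd i * (t i : ℤ) := by
      intro i
      simp only [hb']; rw [Nat.cast_sub (htb i)]; ring
    simp_rw [h1]
    rw [Finset.sum_sub_distrib, ← hS]
    have : ∑ i, sd i * (t i : ℤ) = sd i₀ * ε := by
      rw [Finset.sum_eq_single i₀]
      · simp [ht]
      · intro i _ hi; simp [ht, hi]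
      · simp
    rw [this, hi₀]; ring
  let a : ι → ℕ := fun i => if sd i = 1 then b' i else 0
  let a' : ι → ℕ := fun i => if sd i = -1 then b' i else 0
  have haa : ∑ i, a i = ∑ i, a' i := by
    have : (∑ i, (a i : ℤ)) - ∑ i, (a' i : ℤ) = 0 := by
      rw [← Finset.sum_sub_distrib, ← hsum0]
      refine Finset.sum_congr rfl fun i _ => ?_
      rcases hsd i with h | h <;> simp [a, a', h]
    have h2 : ∑ i, (a i : ℤ) = ∑ i, (a' i : ℤ) := by linarith
    exact_mod_cast h2
  obtain ⟨x, hx1, hx2, hx3⟩ := exists_transport H a a' haa (by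
    intro X
    set X' := X.filter (fun i => sd i = 1) with hX'
    have e1 : ∑ i ∈ X, a i = ∑ i ∈ X', b' i := by
      rw [hX', Finset.sum_filter]
    rw [e1]
    by_cases hne : X'.Nonempty
    swap
    · rw [Finset.not_nonempty_iff_eq_empty] at hne; simp [hne]
    have hsub : nbr H X' ⊆ nbr H X := nbr_mono (Finset.filter_subset _ _)
    rcases hH X' hne (by intro i hi; exact (Finset.mem_filter.1 hi).2) with h | h
    · calc ∑ i ∈ X', b' i = ∑ i ∈ X', a i := by
            refine Finset.sum_congr rfl fun i hi => ?_
            simp [a, (Finset.mem_filter.1 hi).2]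
        _ ≤ ∑ i, a i := Finset.sum_le_sum_of_subset (Finset.subset_univ _)
        _ = ∑ i, a' i := haa
        _ = ∑ i ∈ nbr H X, a' i := by
            symm
            refine Finset.sum_subset (Finset.subset_univ _) ?_
            intro i _ hi
            by_contra hne
            have : sd i = -1 := by
              by_contra h'; simp [a', h'] at hne
            exact hi (hsub (h i this))
    · calc ∑ i ∈ X', b' i ≤ X'.card * U := by
            rw [← smul_eq_mul]; exact Finset.sum_le_card_nsmul _ _ _ (fun i _ => hb'1 i)
        _ ≤ (X'.card + D) * (U - (K + q)) := by
            have : X'.card * (K + q) ≤ D * (U - (K + q)) :=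
              (Nat.mul_le_mul_right _ (Finset.card_le_univ _)).trans hD
            obtain ⟨w, hw⟩ := Nat.exists_eq_add_of_lt hUK
            have hw' : U - (K + q) = w + 1 := by omega
            rw [hw'] at this ⊢
            subst hw
            nlinarith
        _ ≤ ((nbr H X').filter (fun j => sd j = -1)).card * (U - (K + q)) :=
            Nat.mul_le_mul_right _ h
        _ ≤ ∑ i ∈ (nbr H X').filter (fun j => sd j = -1), b' i := by
            rw [← smul_eq_mul]; exact Finset.card_nsmul_le_sum _ _ _ (fun i _ => hb'2 i)
        _ = ∑ i ∈ nbr H X', a' i := by rw [Finset.sum_filter]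
        _ ≤ ∑ i ∈ nbr H X, a' i := Finset.sum_le_sum_of_subset hsub)
  refine ⟨t, x, ?_, hx1, fun i => ?_⟩
  · rw [ht, Finset.sum_pi_single']; simp; omega
  · rw [Finset.sum_add_distrib, hx2, hx3]
    have := htb i
    rcases hsd i with h | h <;> simp [a, a', h, hb'] <;> omega

theorem exists_half_split {ι : Type*} [DecidableEq ι] (b : ι → ℕ) (C : Finset ι) :
    ∃ a : ι → ℕ, (∀ i, b i ≤ 2 * a i + 1 ∧ 2 * a i ≤ b i + 1) ∧
      2 * ∑ i ∈ C, a i = ∑ i ∈ C, b i + (∑ i ∈ C, b i) % 2 := by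
  induction C using Finset.induction_on with
  | empty => exact ⟨fun i => b i / 2, fun i => by dsimp only; omega, by simp⟩
  | insert j C hj ih =>
    obtain ⟨a, ha, hs⟩ := ih
    set e := (∑ i ∈ C, b i) % 2 with he
    refine ⟨Function.update a j ((b j + (1 - e)) / 2), ?_, ?_⟩
    · intro i
      by_cases h : i = j
      · subst h; simp; omega
      · simp [h]; exact ha i
    · rw [Finset.sum_insert hj, Finset.sum_insert hj, Function.update_self]
      have : ∑ i ∈ C, Function.update a j ((b j + (1 - e)) / 2) i = ∑ i ∈ C, a i := by
        refine Finset.sum_congr rfl fun i hi => ?_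
        rw [Function.update_of_ne]
        rintro rfl; exact hj hi
      rw [this]
      omega

theorem exists_parity_fix {ι : Type*} [DecidableEq ι] (b : ι → ℕ) (hb : ∀ i, 1 ≤ b i)
    (C : Finset ι) :
    ∃ t : ι → ℕ, (∀ i, t i ≤ 1) ∧ (∀ i ∉ C, t i = 0) ∧ ∑ i ∈ C, t i ≤ 1 ∧
      (∑ i ∈ C, (b i - t i)) % 2 = 0 := by
  by_cases h : (∑ i ∈ C, b i) % 2 = 0
  · exact ⟨fun _ => 0, by simp, by simp, by simp, by simpa using h⟩
  · have hne : C.Nonempty := by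
      by_contra h'; rw [Finset.not_nonempty_iff_eq_empty] at h'; simp [h'] at h
    obtain ⟨j, hj⟩ := hne
    refine ⟨Pi.single j 1, ?_, ?_, ?_, ?_⟩
    · intro i
      by_cases h : i = j
      · subst h; simp
      · simp [h]
    · intro i hi
      have : i ≠ j := by rintro rfl; exact hi hj
      simp [this]
    · rw [Finset.sum_pi_single']; simp [hj]
    · have : ∑ i ∈ C, (b i - (Pi.single j 1 : ι → ℕ) i) + 1 = ∑ i ∈ C, b i := by
        rw [← Finset.add_sum_erase _ _ hj, ← Finset.add_sum_erase _ b hj]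
        have : ∑ i ∈ C.erase j, (b i - (Pi.single j 1 : ι → ℕ) i) = ∑ i ∈ C.erase j, b i := by
          refine Finset.sum_congr rfl fun i hi => ?_
          simp [(Finset.mem_erase.1 hi).1]
        rw [this]
        have := hb j
        simp; omega
      omega

theorem exists_closed_pair {ι : Type*} [Fintype ι] [DecidableEq ι] (H : ι → ι → Prop)
    [DecidableRel H] (hsymm : ∀ i j, H i j → H j i)
    (hcl : ∀ X : Finset ι, X.Nonempty → nbr H X ⊆ X → Fintype.card ι < 3 * X.card) :
    ∃ C₁ : Finset ι, ∀ C, nbr H C ⊆ C → C = ∅ ∨ C = Finset.univ ∨ C = C₁ ∨ C = C₁ᶜ := by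
  by_cases h : ∃ C, nbr H C ⊆ C ∧ C ≠ ∅ ∧ C ≠ Finset.univ
  swap
  · push Not at h
    refine ⟨∅, fun C hC => ?_⟩
    by_cases h' : C = ∅
    · exact Or.inl h'
    · exact Or.inr (Or.inl (h C hC (Finset.nonempty_iff_ne_empty.2 h')))
  obtain ⟨C₁, hC₁, hne, hnu⟩ := h
  have hcompl : ∀ C, nbr H C ⊆ C → nbr H Cᶜ ⊆ Cᶜ := by
    intro C hC j hj
    rw [mem_nbr] at hj
    obtain ⟨i, hi, hij⟩ := hj
    rw [Finset.mem_compl] at *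
    intro hjC
    exact hi (hC (mem_nbr.2 ⟨j, hjC, hsymm _ _ hij⟩))
  have hinter : ∀ C D, nbr H C ⊆ C → nbr H D ⊆ D → nbr H (C ∩ D) ⊆ C ∩ D := by
    intro C D hC hD j hj
    rw [Finset.mem_inter]
    exact ⟨hC (nbr_mono Finset.inter_subset_left hj), hD (nbr_mono Finset.inter_subset_right hj)⟩
  -- two disjoint nonempty closed sets inside a closed set with nonempty complement is impossible
  have h3 : ∀ C D, nbr H C ⊆ C → nbr H D ⊆ D → Cᶜ.Nonempty → (C ∩ D).Nonempty → C ⊆ D := by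
    intro C D hC hD hCc hCD
    by_contra hnot
    have hne2 : (C ∩ Dᶜ).Nonempty := by
      rw [Finset.not_subset] at hnot
      obtain ⟨x, hx, hx'⟩ := hnot
      exact ⟨x, by simp [hx, hx']⟩
    have a1 := hcl _ hCc (hcompl C hC)
    have a2 := hcl _ hCD (hinter C D hC hD)
    have a3 := hcl _ hne2 (hinter C _ hC (hcompl D hD))
    have e1 : (C ∩ D).card + (C ∩ Dᶜ).card = C.card := by
      rw [← Finset.sdiff_eq_inter_compl]; exact Finset.card_inter_add_card_sdiff C D
    have e2 := Finset.card_add_card_compl C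
    omega
  have hC₁c : C₁ᶜ.Nonempty := by
    rw [Finset.nonempty_iff_ne_empty, Ne, Finset.compl_eq_empty_iff]; exact hnu
  have hC₁n : C₁.Nonempty := Finset.nonempty_iff_ne_empty.2 hne
  refine ⟨C₁, fun C hC => ?_⟩
  by_cases h1 : (C₁ ∩ C).Nonempty <;> by_cases h2 : (C₁ᶜ ∩ C).Nonempty
  · right; left
    have s1 := h3 _ _ hC₁ hC hC₁c h1
    have s2 := h3 _ _ (hcompl _ hC₁) hC (by simpa using hC₁n) h2
    ext x
    by_cases hx : x ∈ C₁
    · simp [s1 hx]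
    · simp [s2 (Finset.mem_compl.2 hx)]
  · right; right; left
    have s1 := h3 _ _ hC₁ hC hC₁c h1
    rw [Finset.not_nonempty_iff_eq_empty] at h2
    refine Finset.Subset.antisymm (fun x hx => ?_) s1
    by_contra hx'
    have : x ∈ C₁ᶜ ∩ C := by simp [hx, hx']
    rw [h2] at this; simp at this
  · right; right; right
    have s2 := h3 _ _ (hcompl _ hC₁) hC (by simpa using hC₁n) h2
    rw [Finset.not_nonempty_iff_eq_empty] at h1
    refine Finset.Subset.antisymm (fun x hx => ?_) s2
    rw [Finset.mem_compl]
    intro hx'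
    have : x ∈ C₁ ∩ C := by simp [hx, hx']
    rw [h1] at this; simp at this
  · left
    rw [Finset.not_nonempty_iff_eq_empty] at h1 h2
    by_contra h'
    obtain ⟨x, hx⟩ := Finset.nonempty_iff_ne_empty.2 h'
    by_cases hx' : x ∈ C₁
    · have : x ∈ C₁ ∩ C := by simp [hx, hx']
      rw [h1] at this; simp at this
    · have : x ∈ C₁ᶜ ∩ C := by simp [hx, hx']
      rw [h2] at this; simp at this

theorem distributes_of_expansion {ι : Type*} [Fintype ι] [DecidableEq ι] (H : ι → ι → Prop)
    [DecidableRel H] (hsymm : ∀ i j, H i j → H j i) (sd : ι → ℤ) (U K q D : ℕ)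
    (hexp : ∀ X : Finset ι, ¬ X ⊆ nbr H X → X.card + D ≤ (nbr H X).card)
    (hcl : ∀ X : Finset ι, X.Nonempty → nbr H X ⊆ X → Fintype.card ι < 3 * X.card)
    (hU : K + 2 * Fintype.card ι + 4 ≤ U)
    (hD : Fintype.card ι * (K + 5) ≤ D * (U - (K + 4))) :
    Distributes H sd U K q := by
  intro b hbU hbK _
  obtain ⟨C₁, hC₁⟩ := exists_closed_pair H hsymm hcl
  have hb1 : ∀ i, 1 ≤ b i := fun i => by have := hbK i; omega
  obtain ⟨t₁, ht1, ht1', ht1s, ht1e⟩ := exists_parity_fix b hb1 C₁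
  obtain ⟨t₂, ht2, ht2', ht2s, ht2e⟩ := exists_parity_fix b hb1 C₁ᶜ
  have htz : ∀ i, t₁ i = 0 ∨ t₂ i = 0 := by
    intro i
    by_cases h : i ∈ C₁
    · right; exact ht2' i (by simpa using h)
    · left; exact ht1' i h
  set b' : ι → ℕ := fun i => b i - (t₁ i + t₂ i) with hb'
  have htb : ∀ i, t₁ i + t₂ i ≤ 1 := fun i => by
    have := ht1 i; have := ht2 i; rcases htz i with h | h <;> omega
  have s1 : (∑ i ∈ C₁, b' i) % 2 = 0 := by
    rw [← ht1e]; congr 1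
    refine Finset.sum_congr rfl fun i hi => ?_
    simp [hb', ht2' i (by simpa using hi)]
  have s2 : (∑ i ∈ C₁ᶜ, b' i) % 2 = 0 := by
    rw [← ht2e]; congr 1
    refine Finset.sum_congr rfl fun i hi => ?_
    simp [hb', ht1' i (by simpa using hi)]
  obtain ⟨a₁, ha1, ha1s⟩ := exists_half_split b' C₁
  obtain ⟨a₂, ha2, ha2s⟩ := exists_half_split b' C₁ᶜ
  rw [s1] at ha1s
  rw [s2] at ha2s
  let a : ι → ℕ := fun i => if i ∈ C₁ then a₁ i else a₂ i
  let a' : ι → ℕ := fun i => b' i - a i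
  have hab : ∀ i, b' i ≤ 2 * a i + 1 ∧ 2 * a i ≤ b' i + 1 := by
    intro i; by_cases h : i ∈ C₁ <;> simp only [a, h, if_true, if_false]
    · exact ha1 i
    · exact ha2 i
  have hb'1 : ∀ i, 1 ≤ b' i := fun i => by have := hbK i; have := htb i; simp only [hb']; omega
  have haa' : ∀ i, a i + a' i = b' i := fun i => by
    have := hab i; have := hb'1 i; simp only [a']; omega
  have e1 : ∑ i ∈ C₁, a i = ∑ i ∈ C₁, a' i := by
    have h1 : ∑ i ∈ C₁, a i = ∑ i ∈ C₁, a₁ i :=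
      Finset.sum_congr rfl fun i hi => by simp [a, hi]
    have h2 : ∑ i ∈ C₁, a i + ∑ i ∈ C₁, a' i = ∑ i ∈ C₁, b' i := by
      rw [← Finset.sum_add_distrib]; exact Finset.sum_congr rfl fun i _ => haa' i
    omega
  have e2 : ∑ i ∈ C₁ᶜ, a i = ∑ i ∈ C₁ᶜ, a' i := by
    have h1 : ∑ i ∈ C₁ᶜ, a i = ∑ i ∈ C₁ᶜ, a₂ i :=
      Finset.sum_congr rfl fun i hi => by simp [a, Finset.mem_compl.1 hi]
    have h2 : ∑ i ∈ C₁ᶜ, a i + ∑ i ∈ C₁ᶜ, a' i = ∑ i ∈ C₁ᶜ, b' i := by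
      rw [← Finset.sum_add_distrib]; exact Finset.sum_congr rfl fun i _ => haa' i
    omega
  have eu : ∑ i, a i = ∑ i, a' i := by
    rw [← Finset.sum_add_sum_compl C₁, ← Finset.sum_add_sum_compl C₁ a', e1, e2]
  have hau : ∀ i, 2 * a i ≤ U + 1 := fun i => by
    have := hab i; have := hbU i; simp only [hb'] at *; omega
  have hal : ∀ i, U - (K + 3) ≤ 2 * a' i + 1 := fun i => by
    have := hab i; have := hbK i; have := htb i; have := haa' i
    simp only [hb'] at *; omega
  obtain ⟨x, hx1, hx2, hx3⟩ := exists_transport H a a' eu (by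
    intro X
    change _ ≤ ∑ j ∈ nbr H X, a' j
    by_cases hX : X ⊆ nbr H X
    · by_cases hX2 : nbr H X ⊆ X
      · have hXe : nbr H X = X := Finset.Subset.antisymm hX2 hX
        rw [hXe]
        rcases hC₁ X hX2 with h | h | h | h
        · simp [h]
        · rw [h]; exact eu.le
        · rw [h]; exact e1.le
        · rw [h]; exact e2.le
      · rw [Finset.not_subset] at hX2
        obtain ⟨j, hj, hjX⟩ := hX2
        have h1 : ∑ i ∈ X, a i ≤ ∑ i ∈ X, a' i + X.card := by
          rw [Finset.card_eq_sum_ones, ← Finset.sum_add_distrib]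
          refine Finset.sum_le_sum fun i _ => ?_
          have := hab i; have := haa' i; omega
        have h2 : ∑ i ∈ X, a' i + a' j ≤ ∑ i ∈ nbr H X, a' i := by
          rw [add_comm, ← Finset.sum_insert hjX]
          exact Finset.sum_le_sum_of_subset (Finset.insert_subset hj hX)
        have h3 := hal j
        have h4 := Finset.card_le_univ X
        omega
    · have h1 := hexp X hX
      have h2 : 2 * ∑ i ∈ X, a i ≤ X.card * (U + 1) := by
        rw [Finset.mul_sum, ← smul_eq_mul]
        exact Finset.sum_le_card_nsmul _ _ _ (fun i _ => hau i)
      have h3 : (nbr H X).card * (U - (K + 4)) ≤ 2 * ∑ i ∈ nbr H X, a' i := by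
        rw [Finset.mul_sum, ← smul_eq_mul]
        refine Finset.card_nsmul_le_sum _ _ _ (fun i _ => ?_)
        have := hal i; omega
      have h4 : (X.card + D) * (U - (K + 4)) ≤ (nbr H X).card * (U - (K + 4)) :=
        Nat.mul_le_mul_right _ h1
      have h5 : X.card * (K + 5) ≤ D * (U - (K + 4)) :=
        (Nat.mul_le_mul_right _ (Finset.card_le_univ _)).trans hD
      have h6 : X.card * (U + 1) ≤ (X.card + D) * (U - (K + 4)) := by
        obtain ⟨w, hw⟩ : ∃ w, U = K + 4 + w := ⟨U - (K + 4), by omega⟩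
        have hw' : U - (K + 4) = w := by omega
        rw [hw'] at h5 ⊢
        subst hw
        nlinarith
      omega)
  refine ⟨fun i => t₁ i + t₂ i, x, ?_, hx1, fun i => ?_⟩
  · rw [Finset.sum_add_distrib]
    have h1 : ∑ i, t₁ i = ∑ i ∈ C₁, t₁ i := by
      symm; exact Finset.sum_subset (Finset.subset_univ _) fun i _ hi => ht1' i hi
    have h2 : ∑ i, t₂ i = ∑ i ∈ C₁ᶜ, t₂ i := by
      symm; exact Finset.sum_subset (Finset.subset_univ _) fun i _ hi => ht2' i hi
    omega
  · rw [Finset.sum_add_distrib, hx2, hx3, haa']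
    have := htb i; have := hb1 i
    simp only [hb']; omega

theorem card_mul_le_of_pairwise_inter {S : Type*} [DecidableEq S] [DecidableEq V]
    (N : S → Finset V) (g γ : ℕ) (I : Finset S) (hg : ∀ z ∈ I, g ≤ (N z).card)
    (hγ : ∀ z ∈ I, ∀ w ∈ I, z ≠ w → (N z ∩ N w).card ≤ γ) :
    I.card * g ≤ (I.biUnion N).card + I.card ^ 2 * γ := by
  induction I using Finset.induction_on with
  | empty => simp
  | insert z I hz ih =>
    have ih' := ih (fun w hw => hg w (Finset.mem_insert_of_mem hw))
      (fun w hw w' hw' => hγ w (Finset.mem_insert_of_mem hw) w' (Finset.mem_insert_of_mem hw'))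
    rw [Finset.card_insert_of_notMem hz, Finset.biUnion_insert]
    have h1 : (N z ∩ I.biUnion N).card ≤ I.card * γ := by
      rw [Finset.inter_biUnion]
      refine Finset.card_biUnion_le_card_mul _ _ _ (fun w hw => ?_)
      exact hγ z (Finset.mem_insert_self _ _) w (Finset.mem_insert_of_mem hw)
        (by rintro rfl; exact hz hw)
    have h2 := Finset.card_union_add_card_inter (N z) (I.biUnion N)
    have h3 := hg z (Finset.mem_insert_self _ _)
    nlinarith

/-- Distinct representatives that do not overload any member of a disjoint family. -/
theorem exists_spread_sdr {S ι : Type*} [DecidableEq S] [DecidableEq V] [DecidableEq ι]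
    [Fintype ι] [Nonempty V]
    (F : ι → Finset V) (hF : ∀ i j, i ≠ j → Disjoint (F i) (F j)) (m L γ : ℕ)
    (hm : ∀ i, (F i).card ≤ m) (hL : 0 < L) (dem : S → Finset V) (Z : Finset S)
    (hdem : ∀ z ∈ Z, γ < (dem z).card) 
    (hγ : Z.card * (L + m) ≤ L * γ) :
    ∃ x : S → V, (∀ z ∈ Z, x z ∈ dem z) ∧ Set.InjOn x Z ∧
      ∀ i, (Z.filter (fun z => x z ∈ F i)).card ≤ L := by
  induction Z using Finset.induction_on with
  | empty => exact ⟨fun _ => Classical.arbitrary V, by simp, by simp, by simp⟩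
  | insert z Z hz ih =>
    rw [Finset.card_insert_of_notMem hz] at hγ
    obtain ⟨x, hx1, hx2, hx3⟩ := ih (fun w hw => hdem w (Finset.mem_insert_of_mem hw))
      (by nlinarith)
    let full := Finset.univ.filter (fun i => L ≤ (Z.filter (fun w => x w ∈ F i)).card)
    have hfull : L * full.card ≤ Z.card := by
      have h1 : ∑ i ∈ full, (Z.filter (fun w => x w ∈ F i)).card ≤ Z.card := by
        rw [← Finset.card_biUnion]
        · exact Finset.card_le_card (by
            intro w hw; simp only [Finset.mem_biUnion, Finset.mem_filter] at hw
            obtain ⟨_, _, h, _⟩ := hw; exact h)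
        · intro i _ j _ hij
          rw [Function.onFun, Finset.disjoint_left]
          intro w hw hw'
          exact Finset.disjoint_left.1 (hF i j hij) (Finset.mem_filter.1 hw).2
            (Finset.mem_filter.1 hw').2
      have h2 := Finset.card_nsmul_le_sum full
        (fun i => (Z.filter (fun w => x w ∈ F i)).card) L
        (fun i hi => (Finset.mem_filter.1 hi).2)
      rw [smul_eq_mul] at h2
      nlinarith
    let bad := Z.image x ∪ full.biUnion F
    have hbad : bad.card ≤ γ := by
      have h1 : (full.biUnion F).card ≤ full.card * m :=
        Finset.card_biUnion_le_card_mul _ _ _ (fun i _ => hm i)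
      have h2 : bad.card ≤ Z.card + full.card * m :=
        (Finset.card_union_le _ _).trans (Nat.add_le_add Finset.card_image_le h1)
      have h3 : L * (full.card * m) ≤ Z.card * m := by
        rw [← mul_assoc]; exact Nat.mul_le_mul_right _ hfull
      by_contra hcon
      push Not at hcon
      have h4 : L * (γ + 1) ≤ L * (Z.card + full.card * m) :=
        Nat.mul_le_mul_left _ (by omega)
      nlinarith
    obtain ⟨y, hy, hyb⟩ : ∃ y ∈ dem z, y ∉ bad := by
      by_contra hcon
      push Not at hcon
      have := Finset.card_le_card (show dem z ⊆ bad from hcon)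
      have := hdem z (Finset.mem_insert_self _ _)
      omega
    simp only [bad, Finset.mem_union, not_or, Finset.mem_image, not_exists, not_and,
      Finset.mem_biUnion] at hyb
    have hup : ∀ w ∈ Z, Function.update x z y w = x w := by
      intro w hw
      rw [Function.update_of_ne]
      rintro rfl; exact hz hw
    refine ⟨Function.update x z y, ?_, ?_, ?_⟩
    · intro w hw
      rcases Finset.mem_insert.1 hw with rfl | hw
      · simpa using hy
      · rw [hup w hw]; exact hx1 w hw
    · intro w hw w' hw' hww
      rw [Finset.mem_coe, Finset.mem_insert] at hw hw'
      rcases hw with rfl | hw <;> rcases hw' with rfl | hw'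
      · rfl
      · rw [Function.update_self, hup w' hw'] at hww
        exact (hyb.1 w' hw' hww.symm).elim
      · rw [Function.update_self, hup w hw] at hww
        exact (hyb.1 w hw hww).elim
      · rw [hup w hw, hup w' hw'] at hww
        exact hx2 hw hw' hww
    · intro i
      rw [Finset.filter_insert]
      have e : Z.filter (fun w => Function.update x z y w ∈ F i)
          = Z.filter (fun w => x w ∈ F i) :=
        Finset.filter_congr fun w hw => by rw [hup w hw]
      rw [e, Function.update_self]
      split_ifs with h
      · refine (Finset.card_insert_le _ _).trans ?_
        by_contra hcon
        exact hyb.2 i (Finset.mem_filter.2 ⟨Finset.mem_univ _, by omega⟩) h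
      · exact hx3 i

theorem exists_rel_of_isChain_append {P Q : V → V → Prop} {a : V} : ∀ {l : List V},
    List.IsChain P (l ++ [a]) → List.IsChain Q (l ++ [a]) → ∀ z ∈ l, ∃ y, P z y ∧ Q z y
  | [], _, _, z, hz => by simp at hz
  | b :: l, hP, hQ, z, hz => by
    rw [List.cons_append, List.isChain_cons] at hP hQ
    rcases List.mem_cons.1 hz with rfl | hz
    · obtain ⟨y, hy⟩ : ∃ y, y ∈ (l ++ [a]).head? := by
        cases l with
        | nil => exact ⟨a, by simp⟩
        | cons d _ => exact ⟨d, by simp⟩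
      exact ⟨y, hP.1 y hy, hQ.1 y hy⟩
    · exact exists_rel_of_isChain_append hP.2 hQ.2 z hz

theorem exists_cover {r : ℕ} {ι : Type*} [DecidableEq V] [DecidableEq ι] [Fintype ι]
    (R : Fin r → V → V → Prop) [∀ c, DecidableRel (R c)] (hsymm : ∀ c u v, R c u v → R c v u)
    (F : ι → Finset V) (hF : ∀ i j, i ≠ j → Disjoint (F i) (F j)) (m L γ g n α : ℕ)
    (hm : ∀ i, (F i).card ≤ m) (hL : 0 < L) (Z : Finset V) (hZF : ∀ i, Disjoint Z (F i))
    (hn : (Finset.univ.biUnion F).card ≤ n)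
    (hg : ∀ z ∈ Z, ∃ c, g ≤ ((Finset.univ.biUnion F).filter (R c z ·)).card)
    (hα : n + (α + 1) ^ 2 * γ < (α + 1) * g) (hγ : Z.card * (L + m) ≤ L * γ) :
    ∃ f : Fin r × Fin α → List V, (∀ p, IsCyc (R p.1) (f p)) ∧
      (∀ p q, p ≠ q → List.Disjoint (f p) (f q)) ∧ (∀ z ∈ Z, ∃ p, z ∈ f p) ∧
      (∀ p, ∀ x ∈ f p, x ∈ Z ∨ ∃ i, x ∈ F i) ∧
      ∀ i, ((F i).filter (fun x => ∃ p, x ∈ f p)).card ≤ L := by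
  classical
  rcases Z.eq_empty_or_nonempty with rfl | hZne
  · refine ⟨fun _ => [], fun _ => isCyc_of_length_le (by simp), by simp, by simp, by simp, by simp⟩
  have hgs : ∀ z, ∃ c, z ∈ Z → g ≤ ((Finset.univ.biUnion F).filter (R c z ·)).card := by
    intro z
    by_cases hz : z ∈ Z
    · obtain ⟨c, hc⟩ := hg z hz; exact ⟨c, fun _ => hc⟩
    · obtain ⟨z', hz'⟩ := hZne
      obtain ⟨c, _⟩ := hg z' hz'
      exact ⟨c, fun h => (hz h).elim⟩
  choose cz hcz using hgs
  have : Nonempty V := ⟨hZne.choose⟩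
  let N : Fin r → V → Finset V := fun c z => (Finset.univ.biUnion F).filter (R c z ·)
  let R' : Fin r → V → V → Prop := fun c z w => γ < (N c z ∩ N c w).card
  have hR' : ∀ c z w, R' c z w → R' c w z := by
    intro c z w h; simp only [R'] at *; rwa [Finset.inter_comm]
  have hpart : ∀ c, ∃ f : Fin α → List V, (∀ k, IsCyc (R' c) (f k)) ∧
      (∀ k k', k ≠ k' → List.Disjoint (f k) (f k')) ∧
      ∀ v, v ∈ Z.filter (fun z => cz z = c) ↔ ∃ k, v ∈ f k := by
    intro c
    refine exists_cyc_partition (hR' c) α _ (fun I hI hind => ?_)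
    by_contra hcon
    push Not at hcon
    obtain ⟨J, hJI, hJc⟩ := Finset.exists_subset_card_eq (show α + 1 ≤ I.card from hcon)
    have h1 := card_mul_le_of_pairwise_inter (N c) g γ J
      (fun z hz => by
        have := Finset.mem_filter.1 (hI (hJI hz))
        have h := hcz z this.1
        rw [this.2] at h; exact h)
      (fun z hz w hw hzw => not_lt.1 (hind z (hJI hz) w (hJI hw) hzw))
    have h2 : (J.biUnion (N c)).card ≤ n := by
      refine (Finset.card_le_card ?_).trans hn
      intro x hx
      obtain ⟨z, _, hxz⟩ := Finset.mem_biUnion.1 hx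
      exact (Finset.mem_filter.1 hxz).1
    rw [hJc] at h1
    omega
  choose f₀ hcyc hdis hmem using hpart
  have hnx : ∀ c k, ∃ nx : V → V, (∀ s ∈ f₀ c k, nx s ∈ f₀ c k) ∧
      ∀ a ∈ (f₀ c k).head?, List.IsChain (fun x y => y = nx x) (f₀ c k ++ [a]) :=
    fun c k => exists_next _ (hcyc c k).1
  choose nx hnx1 hnx2 using hnx
  have hzmem : ∀ c k z, z ∈ f₀ c k → z ∈ Z ∧ cz z = c := fun c k z h =>
    Finset.mem_filter.1 ((hmem c z).2 ⟨k, h⟩)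
  have hlong : ∀ c k, 2 ≤ (f₀ c k).length → ∀ z ∈ f₀ c k, R' c z (nx c k z) := by
    intro c k hl z hz
    rcases (hcyc c k).2 with h | h
    · omega
    · obtain ⟨a, ha⟩ : ∃ a, a ∈ (f₀ c k).head? := by
        cases hh : f₀ c k with
        | nil => rw [hh] at hz; simp at hz
        | cons d _ => exact ⟨d, by simp⟩
      obtain ⟨y, hy, rfl⟩ := exists_rel_of_isChain_append (h a ha) (hnx2 c k a ha) z hz
      exact hy
  -- demand sets for the connecting vertices
  have hdem : ∀ z, ∃ D : Finset V, ∀ c k, 2 ≤ (f₀ c k).length → z ∈ f₀ c k →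
      D = N c z ∩ N c (nx c k z) := by
    intro z
    by_cases h : ∃ c k, z ∈ f₀ c k
    · obtain ⟨c, k, hz⟩ := h
      refine ⟨N c z ∩ N c (nx c k z), fun c' k' _ hz' => ?_⟩
      obtain rfl : c = c' := (hzmem _ _ _ hz).2.symm.trans (hzmem _ _ _ hz').2
      by_cases hk : k = k'
      · rw [hk]
      · exact (hdis c k k' hk hz hz').elim
    · exact ⟨∅, fun c k _ hz => (h ⟨c, k, hz⟩).elim⟩
  choose dem hdem using hdem
  let ZL := Z.filter (fun z => ∃ c k, 2 ≤ (f₀ c k).length ∧ z ∈ f₀ c k)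
  obtain ⟨x, hx1, hx2, hx3⟩ := exists_spread_sdr F hF m L γ hm hL dem ZL
    (by
      intro z hz
      obtain ⟨_, c, k, hl, hzk⟩ := Finset.mem_filter.1 hz
      rw [hdem z c k hl hzk]
      exact hlong c k hl z hzk)
    ((Nat.mul_le_mul_right _ (Finset.card_le_card (Finset.filter_subset _ _))).trans hγ)
  have hxp : ∀ c k, 2 ≤ (f₀ c k).length → ∀ z ∈ f₀ c k,
      z ∈ ZL ∧ (∃ i, x z ∈ F i) ∧ R c z (x z) ∧ R c (nx c k z) (x z) := by
    intro c k hl z hz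
    have hzL : z ∈ ZL := Finset.mem_filter.2 ⟨(hzmem _ _ _ hz).1, c, k, hl, hz⟩
    have := hx1 z hzL
    rw [hdem z c k hl hz, Finset.mem_inter, Finset.mem_filter, Finset.mem_filter] at this
    obtain ⟨i, _, hi⟩ := Finset.mem_biUnion.1 this.1.1
    exact ⟨hzL, ⟨i, hi⟩, this.1.2, this.2.2⟩
  have hZx : ∀ z ∈ Z, ∀ y, (∃ i, y ∈ F i) → z ≠ y := by
    rintro z hz _ ⟨i, hi⟩ rfl
    exact Finset.disjoint_left.1 (hZF i) hz hi
  let f : Fin r × Fin α → List V := fun p =>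
    if 2 ≤ (f₀ p.1 p.2).length then (f₀ p.1 p.2).flatMap (fun z => [z, x z]) else f₀ p.1 p.2
  have hfm : ∀ p y, y ∈ f p → y ∈ f₀ p.1 p.2 ∨
      ∃ z ∈ f₀ p.1 p.2, 2 ≤ (f₀ p.1 p.2).length ∧ y = x z := by
    intro p y hy
    simp only [f] at hy
    split_ifs at hy with h
    · rw [List.mem_flatMap] at hy
      obtain ⟨z, hz, hy⟩ := hy
      simp only [List.mem_cons, List.not_mem_nil, or_false] at hy
      rcases hy with rfl | rfl
      · exact Or.inl hz
      · exact Or.inr ⟨z, hz, h, rfl⟩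
    · exact Or.inl hy
  have hf0 : ∀ (p q : Fin r × Fin α) (z : V), z ∈ f₀ p.1 p.2 → z ∈ f₀ q.1 q.2 → p = q := by
    rintro ⟨c, k⟩ ⟨c', k'⟩ z hz hz'
    obtain rfl : c = c' := (hzmem _ _ _ hz).2.symm.trans (hzmem _ _ _ hz').2
    by_contra hk
    exact hdis c k k' (by rintro rfl; exact hk rfl) hz hz'
  refine ⟨f, ?_, ?_, ?_, ?_, ?_⟩
  · rintro ⟨c, k⟩
    simp only [f]
    split_ifs with h
    · refine isCyc_flatMap (Q := fun x y => y = nx c k x) _ _ (hnx2 c k) (hcyc c k).1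
        (by simp) ?_ ?_ ?_ ?_
      · intro z hz
        simp only [List.isChain_cons_cons, List.IsChain.singleton, and_true]
        exact (hxp c k h z hz).2.2.1
      · intro z hz
        have := hZx z (hzmem _ _ _ hz).1 _ (hxp c k h z hz).2.1
        simpa using this
      · intro z hz w hw hzw y hy hy'
        simp only [List.mem_cons, List.not_mem_nil, or_false] at hy hy'
        have pz := hxp c k h z hz
        have pw := hxp c k h w hw
        rcases hy with rfl | rfl <;> rcases hy' with h' | h'
        · exact hzw h'
        · exact hZx y (hzmem _ _ _ hz).1 _ pw.2.1 h'
        · exact hZx w (hzmem _ _ _ hw).1 _ pz.2.1 h'.symm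
        · exact hzw (hx2 pz.1 pw.1 h')
      · rintro z hz w hw rfl y hy y' hy'
        simp only [List.getLast?_cons_cons, List.getLast?_singleton, Option.mem_some_iff,
          List.head?_cons] at hy hy'
        subst hy hy'
        exact hsymm _ _ _ (hxp c k h z hz).2.2.2
    · exact isCyc_of_length_le (by omega)
  · intro p q hpq y hy hy'
    rcases hfm p y hy with h | ⟨z, hz, hl, rfl⟩ <;> rcases hfm q _ hy' with h' | ⟨w, hw, hl', e⟩
    · exact hpq (hf0 p q y h h')
    · subst e
      exact hZx _ (hzmem _ _ _ h).1 _ (hxp _ _ hl' w hw).2.1 rfl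
    · exact hZx _ (hzmem _ _ _ h').1 _ (hxp _ _ hl z hz).2.1 rfl
    · have := hx2 (hxp _ _ hl z hz).1 (hxp _ _ hl' w hw).1 e
      subst this
      exact hpq (hf0 p q z hz hw)
  · intro z hz
    obtain ⟨k, hk⟩ := (hmem (cz z) z).1 (Finset.mem_filter.2 ⟨hz, rfl⟩)
    refine ⟨(cz z, k), ?_⟩
    simp only [f]
    split_ifs with h
    · rw [List.mem_flatMap]; exact ⟨z, hk, by simp⟩
    · exact hk
  · intro p y hy
    rcases hfm p y hy with h | ⟨z, hz, hl, rfl⟩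
    · exact Or.inl (hzmem _ _ _ h).1
    · exact Or.inr (hxp _ _ hl z hz).2.1
  · intro i
    refine le_trans ?_ (hx3 i)
    refine (Finset.card_le_card ?_).trans (Finset.card_image_le (f := x))
    intro y hy
    obtain ⟨hyF, p, hyp⟩ := Finset.mem_filter.1 hy
    rcases hfm p y hyp with h | ⟨z, hz, hl, rfl⟩
    · exact (hZx _ (hzmem _ _ _ h).1 _ ⟨i, hyF⟩ rfl).elim
    · exact Finset.mem_image.2 ⟨z, Finset.mem_filter.2 ⟨(hxp _ _ hl z hz).1, hyF⟩, rfl⟩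

/-- Short monochromatic pieces: every `e : S` has an edge `u e, v e` inside its pair of clusters,
and a path `p e` from a neighbour of `v e` to a neighbour of `u (nx e)`. -/
structure Skeleton {r : ℕ} {ι S : Type*} (R : Fin r → V → V → Prop) [∀ c, DecidableRel (R c)]
    (F : ι → Finset V) (src tgt : S → ι) (col : S → Fin r) (nx : S → S) (P ℓ : ℕ) where
  u : S → V
  v : S → V
  p : S → List V
  u_mem : ∀ e, u e ∈ F (src e)
  v_mem : ∀ e, v e ∈ F (tgt e)
  rel : ∀ e, R (col e) (u e) (v e)
  u_deg : ∀ e, (F (tgt e)).card ≤ P * ((F (tgt e)).filter (R (col e) (u e) ·)).card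
  v_deg : ∀ e, (F (src e)).card ≤ P * ((F (src e)).filter (R (col e) (v e) ·)).card
  p_ne : ∀ e, p e ≠ []
  p_chain : ∀ e, List.IsChain (R (col e)) (p e)
  p_head : ∀ e, ∀ a ∈ (p e).head?, R (col e) (v e) a
  p_last : ∀ e, ∀ b ∈ (p e).getLast?, R (col e) b (u (nx e))
  p_mem : ∀ e, ∀ x ∈ p e, ∃ k, x ∈ F k
  nodup : ∀ e, (u e :: v e :: p e).Nodup
  dis : ∀ e e', e ≠ e' → List.Disjoint (u e :: v e :: p e) (u e' :: v e' :: p e')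
  len : ∀ e, (p e).length ≤ ℓ

theorem exists_skeleton {r : ℕ} {ι S : Type*} [DecidableEq V] [Nonempty V] [Fintype ι]
    [DecidableEq ι] [Fintype S] [DecidableEq S] (R : Fin r → V → V → Prop)
    [∀ c, DecidableRel (R c)] (hsymm : ∀ c u v, R c u v → R c v u) (hirr : ∀ c v, ¬ R c v v)
    (F : ι → Finset V) (Γ : Fin r → SimpleGraph ι)
    (s P : ℕ) (hs : 0 < s) (hP : 0 < P)
    (hG : ∀ c i j, (Γ c).Adj i j → HalfGood (R c) (F i) (F j) s P)
    (src tgt : S → ι) (col : S → Fin r) (hadj : ∀ e, (Γ (col e)).Adj (src e) (tgt e))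
    (nx : S → S) (hnxc : ∀ e, col (nx e) = col e)
    (hnxr : ∀ e, (Γ (col e)).Reachable (tgt e) (tgt (nx e))) (τ : ℕ)
    (hτ : Fintype.card S * (Fintype.card ι + 3) ≤ τ)
    (hsz : ∀ i, P * (τ + 2 * s + P * (Fintype.card ι + 3)) ≤ (F i).card) :
    Nonempty (Skeleton R F src tgt col nx P (Fintype.card ι + 1)) := by
  classical
  set N := Fintype.card ι with hN
  have hsz' : ∀ i, τ + 2 * s + P * (N + 3) ≤ (F i).card := fun i =>
    (Nat.le_mul_of_pos_left _ hP).trans (hsz i)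
  obtain ⟨uv, huv, huvd⟩ := exists_greedy (S := S) (α := V × V)
    (fun e a => a.1 ∈ F (src e) ∧ a.2 ∈ F (tgt e) ∧ R (col e) a.1 a.2 ∧
      (F (tgt e)).card ≤ P * ((F (tgt e)).filter (R (col e) a.1 ·)).card ∧
      (F (src e)).card ≤ P * ((F (src e)).filter (R (col e) a.2 ·)).card)
    (fun a b => List.Disjoint [a.1, a.2] [b.1, b.2]) (fun a b h => h.symm) Finset.univ
    (by
      intro S' _ e _ _ f _ _
      let T := S'.biUnion (fun t => {(f t).1, (f t).2})
      have hT : T.card ≤ τ := by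
        have h1 : T.card ≤ S'.card * 2 :=
          Finset.card_biUnion_le_card_mul _ _ _ (fun t _ => Finset.card_le_two)
        have h2 : S'.card ≤ Fintype.card S := Finset.card_le_univ _
        nlinarith
      have h1 := (hG _ _ _ (hadj e)).card_high (F (tgt e)) subset_rfl
        (by have := hsz' (tgt e); omega) (F (src e) \ T) Finset.sdiff_subset
      have h2 := (hG _ _ _ (hadj e).symm).card_high (F (src e)) subset_rfl
        (by have := hsz' (src e); omega) (F (tgt e) \ T) Finset.sdiff_subset
      have h3 := Finset.le_card_sdiff T (F (src e))
      have h4 := Finset.le_card_sdiff T (F (tgt e))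
      have h5 := hsz' (src e)
      have h6 := hsz' (tgt e)
      obtain ⟨a, ha, b, hb, hab⟩ := (hG _ _ _ (hadj e)).noHole hs
        ((F (src e) \ T).filter fun x =>
          (F (tgt e)).card ≤ P * ((F (tgt e)).filter (R (col e) x ·)).card)
        ((Finset.filter_subset _ _).trans Finset.sdiff_subset)
        ((F (tgt e) \ T).filter fun x =>
          (F (src e)).card ≤ P * ((F (src e)).filter (R (col e) x ·)).card)
        ((Finset.filter_subset _ _).trans Finset.sdiff_subset)
        (by omega) (by omega)
      rw [Finset.mem_filter, Finset.mem_sdiff] at ha hb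
      refine ⟨(a, b), ⟨ha.1.1, hb.1.1, hab, ha.2, hb.2⟩, fun t ht => ?_⟩
      have hTt : ∀ x ∈ [(f t).1, (f t).2], x ∈ T := by
        intro x hx
        refine Finset.mem_biUnion.2 ⟨t, ht, ?_⟩
        simpa using hx
      intro x hx hx'
      have hxT := hTt x hx'
      simp only [List.mem_cons, List.not_mem_nil, or_false] at hx
      rcases hx with rfl | rfl
      · exact ha.1.2 hxT
      · exact hb.1.2 hxT)
  simp only [Finset.mem_univ, true_imp_iff] at huv huvd
  let T₀ : Finset V := Finset.univ.biUnion (fun t => {(uv t).1, (uv t).2})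
  have hT₀ : T₀.card ≤ Fintype.card S * 2 :=
    Finset.card_biUnion_le_card_mul _ _ _ (fun t _ => Finset.card_le_two)
  have hT₀m : ∀ t, (uv t).1 ∈ T₀ ∧ (uv t).2 ∈ T₀ := fun t =>
    ⟨Finset.mem_biUnion.2 ⟨t, Finset.mem_univ _, by simp⟩,
     Finset.mem_biUnion.2 ⟨t, Finset.mem_univ _, by simp⟩⟩
  obtain ⟨p, hp, hpd⟩ := exists_greedy (S := S) (α := List V)
    (fun e l => l ≠ [] ∧ l.length ≤ N + 1 ∧ l.Nodup ∧ List.IsChain (R (col e)) l ∧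
      (∀ a ∈ l.head?, R (col e) (uv e).2 a) ∧ (∀ b ∈ l.getLast?, R (col e) b (uv (nx e)).1) ∧
      ∀ x ∈ l, (∃ k, x ∈ F k) ∧ x ∉ T₀)
    List.Disjoint (fun a b h => h.symm) Finset.univ
    (by
      intro S' _ e _ heS f hf _
      let T := T₀ ∪ S'.biUnion (fun t => (f t).toFinset)
      have hT : T.card ≤ τ := by
        have h1 : (S'.biUnion (fun t => (f t).toFinset)).card ≤ S'.card * (N + 1) :=
          Finset.card_biUnion_le_card_mul _ _ _ (fun t ht =>
            (List.toFinset_card_le _).trans (hf t ht).2.1)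
        have h2 : S'.card ≤ Fintype.card S := Finset.card_le_univ _
        have h3 : T.card ≤ _ := Finset.card_union_le _ _
        have h4 : S'.card * (N + 1) ≤ Fintype.card S * (N + 1) := Nat.mul_le_mul_right _ h2
        nlinarith
      obtain ⟨w, hw⟩ : ∃ w : (Γ (col e)).Walk (tgt e) (tgt (nx e)), w.length < N := by
        obtain ⟨w⟩ := hnxr e
        exact ⟨w.toPath, w.toPath.2.length_lt⟩
      have hbig : ∀ X B : Finset V, P * (τ + 2 * s + P * (N + 3)) ≤ X.card →
          X.card ≤ P * B.card → 2 * s + P * (N + 3) ≤ (B \ T).card := by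
        intro X B h1 h2
        have h3 : τ + 2 * s + P * (N + 3) ≤ B.card :=
          Nat.le_of_mul_le_mul_left (h1.trans h2) hP
        have h4 := Finset.le_card_sdiff T B
        omega
      have hA := hbig _ _ (hsz (src e)) (huv e).2.2.2.2
      have hB := hbig _ _ (hsz (tgt (nx e))) (huv (nx e)).2.2.2.1
      obtain ⟨l, hl1, hl2, hl3, ⟨a, ha, hla⟩, ⟨b, hb, hlb⟩, hl4⟩ :=
        exists_link (hsymm (col e)) (hirr (col e)) F (Γ (col e)) s P (N + 3) hs hP
          (hG (col e)) T (fun k => by have := hsz' k; omega) w (src e) (hadj e) (by omega)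
          ((F (src e)).filter (R (col e) (uv e).2 ·) \ T)
          (Finset.sdiff_subset.trans (Finset.filter_subset _ _))
          ((F (tgt (nx e))).filter (R (col (nx e)) (uv (nx e)).1 ·) \ T)
          (Finset.sdiff_subset.trans (Finset.filter_subset _ _))
          Finset.sdiff_disjoint Finset.sdiff_disjoint (by omega) (by omega) (by omega)
      refine ⟨l, ⟨?_, by omega, hl2, hl3, ?_, ?_, ?_⟩, ?_⟩
      · rintro rfl; simp at hla
      · intro x hx
        rw [hla, Option.mem_some_iff] at hx
        subst hx
        exact (Finset.mem_filter.1 (Finset.mem_sdiff.1 ha).1).2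
      · intro x hx
        rw [hlb, Option.mem_some_iff] at hx
        subst hx
        have := (Finset.mem_filter.1 (Finset.mem_sdiff.1 hb).1).2
        rw [hnxc] at this
        exact hsymm _ _ _ this
      · intro x hx
        exact ⟨(hl4 x hx).1, fun h => (hl4 x hx).2 (Finset.mem_union_left _ h)⟩
      · intro t ht x hx hx'
        exact (hl4 x hx).2 (Finset.mem_union_right _
          (Finset.mem_biUnion.2 ⟨t, ht, List.mem_toFinset.2 hx'⟩)))
  simp only [Finset.mem_univ, true_imp_iff] at hp hpd
  refine ⟨⟨fun e => (uv e).1, fun e => (uv e).2, p, fun e => (huv e).1, fun e => (huv e).2.1,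
    fun e => (huv e).2.2.1, fun e => (huv e).2.2.2.1, fun e => (huv e).2.2.2.2,
    fun e => (hp e).1, fun e => (hp e).2.2.2.1, fun e => (hp e).2.2.2.2.1,
    fun e => (hp e).2.2.2.2.2.1, fun e x hx => ((hp e).2.2.2.2.2.2 x hx).1, ?_, ?_,
    fun e => (hp e).2.1⟩⟩
  · intro e
    have hne : (uv e).1 ≠ (uv e).2 := by
      intro h
      have := (huv e).2.2.1
      rw [h] at this
      exact hirr _ _ this
    have h1 : (uv e).1 ∉ p e := fun h => ((hp e).2.2.2.2.2.2 _ h).2 (hT₀m e).1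
    have h2 : (uv e).2 ∉ p e := fun h => ((hp e).2.2.2.2.2.2 _ h).2 (hT₀m e).2
    simp [hne, h1, h2, (hp e).2.2.1]
  · intro e e' hee x hx hx'
    have split : ∀ t, x ∈ (uv t).1 :: (uv t).2 :: p t → x ∈ [(uv t).1, (uv t).2] ∨ x ∈ p t := by
      intro t h
      simp only [List.mem_cons] at h
      rcases h with h | h | h
      · left; simp [h]
      · left; simp [h]
      · exact Or.inr h
    have hmT : ∀ t, x ∈ [(uv t).1, (uv t).2] → x ∈ T₀ := by
      intro t h
      simp only [List.mem_cons, List.not_mem_nil, or_false] at h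
      rcases h with rfl | rfl
      · exact (hT₀m t).1
      · exact (hT₀m t).2
    rcases split e hx with h | h <;> rcases split e' hx' with h' | h'
    · exact huvd e e' hee h h'
    · exact ((hp e').2.2.2.2.2.2 _ h').2 (hmT e h)
    · exact ((hp e).2.2.2.2.2.2 _ h).2 (hmT e' h')
    · exact hpd e e' hee h h'

section
variable {r : ℕ} {ι S : Type*} {R : Fin r → V → V → Prop} [∀ c, DecidableRel (R c)]
  {F : ι → Finset V} {src tgt : S → ι} {col : S → Fin r} {nx : S → S} {P ℓ : ℕ}

/-- The skeleton piece of `e` with a path inserted between the two ends. -/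
def Skeleton.block (sk : Skeleton R F src tgt col nx P ℓ) (fill : S → List V) (e : S) : List V :=
  sk.u e :: (fill e ++ sk.v e :: sk.p e)

/-- The vertices of the skeleton piece of `e`. -/
def Skeleton.base (sk : Skeleton R F src tgt col nx P ℓ) (e : S) : List V :=
  sk.u e :: sk.v e :: sk.p e

theorem Skeleton.mem_block (sk : Skeleton R F src tgt col nx P ℓ) (fill : S → List V) (e : S)
    (x : V) : x ∈ sk.block fill e ↔ x ∈ fill e ∨ x ∈ sk.base e := by
  simp only [Skeleton.block, Skeleton.base, List.mem_cons, List.mem_append]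
  tauto

/-- Insertions that can be performed simultaneously. -/
structure Skeleton.Fill (sk : Skeleton R F src tgt col nx P ℓ) (fill : S → List V) : Prop where
  chain : ∀ e, List.IsChain (R (col e)) (sk.u e :: fill e ++ [sk.v e])
  nodup : ∀ e, (fill e).Nodup
  base : ∀ e e', List.Disjoint (fill e) (sk.base e')
  dis : ∀ e e', e ≠ e' → List.Disjoint (fill e) (fill e')

theorem Skeleton.fill_nil (sk : Skeleton R F src tgt col nx P ℓ) : sk.Fill (fun _ => []) :=
  ⟨fun e => by simpa using sk.rel e, by simp, by simp, by simp⟩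

theorem Skeleton.Fill.block_disjoint {sk : Skeleton R F src tgt col nx P ℓ} {fill : S → List V}
    (h : sk.Fill fill) {e e' : S} (hee : e ≠ e') :
    List.Disjoint (sk.block fill e) (sk.block fill e') := by
  intro x hx hx'
  rw [sk.mem_block] at hx hx'
  rcases hx with hx | hx <;> rcases hx' with hx' | hx'
  · exact h.dis e e' hee hx hx'
  · exact h.base e e' hx hx'
  · exact h.base e' e hx' hx
  · exact sk.dis e e' hee hx hx'

theorem Skeleton.Fill.isCyc {sk : Skeleton R F src tgt col nx P ℓ} {fill : S → List V}
    (h : sk.Fill fill) (c : Fin r) (g : List S) (hg : g.Nodup) (hgc : ∀ e ∈ g, col e = c)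
    (hgn : ∀ a ∈ g.head?, List.IsChain (fun x y => y = nx x) (g ++ [a])) :
    IsCyc (R c) (g.flatMap (sk.block fill)) := by
  refine isCyc_flatMap (Q := fun x y => y = nx x) _ _ hgn hg ?_ ?_ ?_ ?_ ?_
  · intro e _; simp [Skeleton.block]
  · intro e he
    have h1 := h.chain e
    have h2 := sk.p_chain e
    have h3 := sk.p_head e
    rw [hgc e he] at h1 h2 h3
    have : sk.block fill e = (sk.u e :: fill e ++ [sk.v e]) ++ sk.p e := by
      simp [Skeleton.block]
    rw [this, List.isChain_append]
    refine ⟨h1, h2, fun x hx y hy => ?_⟩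
    rw [List.getLast?_concat, Option.mem_some_iff] at hx
    subst hx
    exact h3 y hy
  · intro e _
    have h1 := sk.nodup e
    have h2 := h.nodup e
    have h3 := h.base e e
    simp only [Skeleton.block, Skeleton.base] at *
    rw [List.nodup_cons] at h1 ⊢
    have h4 : sk.u e ∉ fill e := fun hu => h3 hu (by simp)
    refine ⟨?_, List.Nodup.append h2 h1.2 ?_⟩
    · rw [List.mem_append]; rintro (h | h)
      · exact h4 h
      · exact h1.1 h
    · intro x hx hx'
      exact h3 hx (List.mem_cons_of_mem _ hx')
  · intro e _ e' _ hee
    exact h.block_disjoint hee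
  · rintro e he e' _ rfl x hx y hy
    simp only [Skeleton.block, List.head?_cons, Option.mem_some_iff] at hy
    subst hy
    have hne := sk.p_ne e
    have h1 := sk.p_last e
    rw [hgc e he] at h1
    refine h1 x ?_
    have : sk.block fill e = (sk.u e :: fill e ++ [sk.v e]) ++ sk.p e := by
      simp [Skeleton.block]
    rw [this, List.getLast?_append_of_ne_nil _ hne] at hx
    exact hx

theorem Skeleton.length_flatMap_ne_one (sk : Skeleton R F src tgt col nx P ℓ)
    (fill : S → List V) (g : List S) : (g.flatMap (sk.block fill)).length ≠ 1 := by
  cases g with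
  | nil => simp
  | cons e g => simp [Skeleton.block]

end

/-- A successor function that runs cyclically through every class of a labelling. -/
theorem exists_cyclic_next {S κ : Type*} [Fintype S] [DecidableEq S] [DecidableEq κ]
    (key : S → κ) :
    ∃ (nx : S → S) (g : κ → List S), (∀ e, key (nx e) = key e) ∧
      (∀ k e, e ∈ g k ↔ key e = k) ∧ (∀ k, (g k).Nodup) ∧
      ∀ k, ∀ a ∈ (g k).head?, List.IsChain (fun x y => y = nx x) (g k ++ [a]) := by
  let g : κ → List S := fun k => (Finset.univ.filter (fun e => key e = k)).toList
  have hm : ∀ k e, e ∈ g k ↔ key e = k := by intro k e; simp [g]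
  have hn : ∀ k, (g k).Nodup := fun k => Finset.nodup_toList _
  choose nx h1 h2 using fun k => exists_next (g k) (hn k)
  refine ⟨fun e => nx (key e) e, g, fun e => ?_, hm, hn, fun k a ha => ?_⟩
  · exact (hm _ _).1 (h1 (key e) e ((hm _ _).2 rfl))
  · refine (h2 k a ha).imp_of_mem_imp (fun x y hx _ hxy => ?_)
    have hx' : x ∈ g k := by
      rcases List.mem_append.1 hx with h | h
      · exact h
      · rw [List.mem_singleton] at h; subst h; exact List.mem_of_mem_head? ha
    change y = nx (key x) x
    rw [(hm k x).1 hx']; exact hxy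

theorem exists_demand_fill {r : ℕ} {ι S : Type*} [DecidableEq V] [DecidableEq ι] [DecidableEq S]
    {R : Fin r → V → V → Prop} [∀ c, DecidableRel (R c)]
    (hsymm : ∀ c u v, R c u v → R c v u)
    {F : ι → Finset V} {src tgt : S → ι} {col : S → Fin r} {nx : S → S} {P ℓ : ℕ}
    (sk : Skeleton R F src tgt col nx P ℓ) (s : ℕ) (hs : 0 < s) (hP : 0 < P)
    (hG : ∀ e, HalfGood (R (col e)) (F (src e)) (F (tgt e)) s P)
    (hne : ∀ e, src e ≠ tgt e) (rem : ι → Finset V)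
    (hrd : ∀ i j, i ≠ j → Disjoint (rem i) (rem j))
    (hrF : ∀ i, rem i ⊆ F i) (W U : ℕ) (hW : ∀ i, (F i).card ≤ (rem i).card + W)
    (E : Finset S) (x : S → ℕ)
    (hload : ∀ i, ∑ e ∈ E, ((if src e = i then x e else 0) + if tgt e = i then x e else 0) ≤ U)
    (hsz : ∀ i, P * (2 * U + W + 2 * s + P * (s + 1)) ≤ (F i).card) :
    ∃ fill : S → List V, (∀ e ∈ E, (fill e).Nodup ∧
      List.IsChain (R (col e)) (sk.u e :: fill e ++ [sk.v e]) ∧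
      ∀ y ∈ fill e, y ∈ rem (src e) ∪ rem (tgt e)) ∧
      (∀ e ∈ E, ∀ e' ∈ E, e ≠ e' → List.Disjoint (fill e) (fill e')) ∧
      ∀ i, (E.biUnion (fun e => (fill e).toFinset) ∩ rem i).card =
        ∑ e ∈ E, ((if src e = i then x e else 0) + if tgt e = i then x e else 0) := by
  classical
  let Pd : S → List V → Prop := fun e l => (l.Nodup ∧
      List.IsChain (R (col e)) (sk.u e :: l ++ [sk.v e]) ∧
      ∀ y ∈ l, y ∈ rem (src e) ∪ rem (tgt e)) ∧
      (l.toFinset ∩ rem (src e)).card = x e ∧ (l.toFinset ∩ rem (tgt e)).card = x e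
  have hcount : ∀ e l i, Pd e l → (l.toFinset ∩ rem i).card =
      (if src e = i then x e else 0) + if tgt e = i then x e else 0 := by
    intro e l i h
    by_cases h1 : src e = i
    · subst h1
      rw [if_pos rfl, if_neg (hne e).symm, h.2.1]; rfl
    · by_cases h2 : tgt e = i
      · subst h2
        rw [if_pos rfl, if_neg h1, h.2.2, zero_add]
      · rw [if_neg h1, if_neg h2, add_zero, Finset.card_eq_zero]
        ext y
        simp only [Finset.mem_inter, List.mem_toFinset, Finset.notMem_empty, iff_false, not_and]
        intro hy hyi
        rcases Finset.mem_union.1 (h.1.2.2 y hy) with h' | h'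
        · exact Finset.disjoint_left.1 (hrd _ _ h1) h' hyi
        · exact Finset.disjoint_left.1 (hrd _ _ h2) h' hyi
  obtain ⟨fill, hf, hfd⟩ := exists_greedy (S := S) (α := List V) Pd List.Disjoint
    (fun a b h => h.symm) E (by
      intro S' hS' e he heS f hf hfd
      let T := S'.biUnion (fun t => (f t).toFinset)
      have hxe : x e ≤ U := by
        have := Finset.single_le_sum (f := fun e' =>
          ((if src e' = src e then x e' else 0) + if tgt e' = src e then x e' else 0))
          (fun _ _ => Nat.zero_le _) he
        have h2 := hload (src e)
        simp only [if_true] at this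
        omega
      have hT : ∀ i, (T ∩ rem i).card ≤ U := by
        intro i
        have h1 : (T ∩ rem i).card ≤ ∑ t ∈ S', ((f t).toFinset ∩ rem i).card := by
          simp only [T]
          rw [Finset.biUnion_inter]
          exact Finset.card_biUnion_le
        refine h1.trans (le_trans ?_ (hload i))
        rw [Finset.sum_congr rfl (fun t ht => hcount t (f t) i (hf t ht))]
        exact Finset.sum_le_sum_of_subset hS'
      have hcut : ∀ i, ∀ B ⊆ F i, B.card ≤ (B ∩ (rem i \ T)).card + (W + U) := by
        intro i B hB
        have h1 : B.card ≤ (B ∩ (rem i \ T)).card + (F i \ (rem i \ T)).card := by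
          rw [← Finset.card_inter_add_card_sdiff B (rem i \ T)]
          have := Finset.card_le_card (Finset.sdiff_subset_sdiff hB (subset_refl (rem i \ T)))
          omega
        have h2 : (F i \ (rem i \ T)).card ≤ W + U := by
          have h3 : F i \ (rem i \ T) ⊆ (F i \ rem i) ∪ (T ∩ rem i) := by
            intro y hy
            simp only [Finset.mem_sdiff, Finset.mem_union, Finset.mem_inter] at hy ⊢
            tauto
          have h4 := (Finset.card_le_card h3).trans (Finset.card_union_le _ _)
          have h5 := Finset.card_sdiff_of_subset (hrF i)
          have h6 := hW i
          have h7 := hT i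
          omega
        omega
      have hbig : ∀ i, 2 * U + W + 2 * s + P * (s + 1) ≤ (F i).card := fun i =>
        (Nat.le_mul_of_pos_left _ hP).trans (hsz i)
      have hdeg : ∀ i (B : Finset V), (F i).card ≤ P * B.card → 2 * U + W + 2 * s + P * (s + 1) ≤ B.card :=
        fun i B h => Nat.le_of_mul_le_mul_left ((hsz i).trans h) hP
      have hfull : ∀ i, U + 2 * s + P * (s + 1) ≤ (rem i \ T).card := by
        intro i
        have h1 := hcut i (F i) subset_rfl
        have h2 : (F i ∩ (rem i \ T)).card ≤ (rem i \ T).card :=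
          Finset.card_le_card Finset.inter_subset_right
        have h3 := hbig i
        omega
      have hfilt : ∀ i (Q : V → Prop) [DecidablePred Q],
          (F i).filter Q ∩ (rem i \ T) ⊆ (rem i \ T).filter Q := by
        intro i Q _ y hy
        simp only [Finset.mem_inter, Finset.mem_filter] at hy ⊢
        exact ⟨hy.2, hy.1.2⟩
      have hu : s ≤ ((rem (tgt e) \ T).filter (R (col e) (sk.u e) ·)).card := by
        have h1 := hcut (tgt e) _ (Finset.filter_subset (R (col e) (sk.u e) ·) _)
        have h2 := hdeg _ _ (sk.u_deg e)
        have h3 := Finset.card_le_card (hfilt (tgt e) (R (col e) (sk.u e) ·))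
        omega
      have hv : x e + s ≤ ((rem (src e) \ T).filter (R (col e) (sk.v e) ·)).card := by
        have h1 := hcut (src e) _ (Finset.filter_subset (R (col e) (sk.v e) ·) _)
        have h2 := hdeg _ _ (sk.v_deg e)
        have h3 := Finset.card_le_card (hfilt (src e) (R (col e) (sk.v e) ·))
        omega
      obtain ⟨l, hl1, hl2, hl3, hl4, hl5⟩ := exists_fill (hsymm (col e)) s P hs hP (sk.v e) (x e)
        (rem (src e) \ T) (rem (tgt e) \ T) (sk.u e)
        ((hrd _ _ (hne e)).mono Finset.sdiff_subset Finset.sdiff_subset)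
        ((hG e).mono (Finset.sdiff_subset.trans (hrF _)) (Finset.sdiff_subset.trans (hrF _)))
        (by have := hfull (src e); omega) (by have := hfull (tgt e); omega) hu hv
        (fun _ => sk.rel e)
      have hlT : ∀ y ∈ l, y ∉ T := by
        intro y hy
        rcases Finset.mem_union.1 (hl3 y hy) with h | h <;> exact (Finset.mem_sdiff.1 h).2
      have hin : ∀ i, l.toFinset ∩ (rem i \ T) = l.toFinset ∩ rem i := by
        intro i
        ext y
        simp only [Finset.mem_inter, List.mem_toFinset, Finset.mem_sdiff]
        exact ⟨fun h => ⟨h.1, h.2.1⟩, fun h => ⟨h.1, h.2, hlT y h.1⟩⟩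
      rw [hin] at hl4 hl5
      refine ⟨l, ⟨⟨hl1, hl2, fun y hy => ?_⟩, hl4, hl5⟩, fun t ht y hy hy' => ?_⟩
      · exact Finset.union_subset_union Finset.sdiff_subset Finset.sdiff_subset (hl3 y hy)
      · exact hlT y hy (Finset.mem_biUnion.2 ⟨t, ht, List.mem_toFinset.2 hy'⟩))
  refine ⟨fill, fun e he => (hf e he).1, hfd, fun i => ?_⟩
  rw [Finset.biUnion_inter, Finset.card_biUnion]
  · exact Finset.sum_congr rfl fun e he => hcount e _ i (hf e he)
  · intro e he e' he' hee
    rw [Function.onFun, Finset.disjoint_left]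
    intro y hy hy'
    simp only [Finset.mem_inter, List.mem_toFinset] at hy hy'
    exact hfd e he e' he' hee hy.1 hy'.1

theorem exists_base_fill {r : ℕ} {ι : Type*} [DecidableEq V]
    {R : Fin r → V → V → Prop} [∀ c, DecidableRel (R c)]
    (hsymm : ∀ c u v, R c u v → R c v u) (σ : Equiv.Perm ι) (cσ : ι → Fin r)
    (rem p q : ι → Finset V) (hσ : ∀ i, i ≠ σ i)
    (hrd : ∀ i j, i ≠ j → Disjoint (rem i) (rem j)) (s h w : ℕ)
    (hp : ∀ i, p i ⊆ rem i) (hq : ∀ i, q i ⊆ rem i) (hpq : ∀ i, Disjoint (p i) (q i))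
    (hpw : ∀ i, (p i).card = w) (hqw : ∀ i, (q i).card = w) (hrem : ∀ i, (rem i).card = 2 * h)
    (hNH : ∀ i, NoHole (R (cσ i)) (rem i) (rem (σ i)) s) (u v : ι → V)
    (huv : ∀ i, R (cσ i) (u i) (v i))
    (hx : ∀ i, ∀ x, x ∈ rem i ∨ x = u i → 20 * s + 20 ≤ ((q (σ i)).filter (R (cσ i) x ·)).card)
    (hy : ∀ i, ∀ y, y ∈ rem (σ i) ∨ y = v i → 20 * s + 20 ≤ ((p i).filter (R (cσ i) y ·)).card) :
    ∃ fill : ι → List V, (∀ i, (fill i).Nodup ∧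
      List.IsChain (R (cσ i)) (u i :: fill i ++ [v i])) ∧
      (∀ i j, i ≠ j → List.Disjoint (fill i) (fill j)) ∧
      ∀ x, (∃ i, x ∈ fill i) ↔ ∃ i, x ∈ rem i := by
  have hwh : ∀ _ : ι, w ≤ h := by
    intro i
    have h1 := Finset.card_le_card (Finset.union_subset (hp i) (hq i))
    rw [Finset.card_union_of_disjoint (hpq i), hpw, hqw, hrem] at h1
    omega
  have hX : ∀ i, ∃ X : Finset V, p i ⊆ X ∧ X ⊆ rem i \ q i ∧ X.card = h := by
    intro i
    refine Finset.exists_subsuperset_card_eq ?_ ?_ ?_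
    · intro x hx'
      exact Finset.mem_sdiff.2 ⟨hp i hx', Finset.disjoint_left.1 (hpq i) hx'⟩
    · rw [hpw]; exact hwh i
    · rw [Finset.card_sdiff_of_subset (hq i), hrem, hqw]; have := hwh i; omega
  choose X hpX hXr hXc using hX
  let Y : ι → Finset V := fun i => rem i \ X i
  have hXr' : ∀ i, X i ⊆ rem i := fun i => (hXr i).trans Finset.sdiff_subset
  have hYc : ∀ i, (Y i).card = h := by
    intro i
    simp only [Y]
    rw [Finset.card_sdiff_of_subset (hXr' i), hrem, hXc]; omega
  have hqY : ∀ i, q i ⊆ Y i := by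
    intro i x hx'
    exact Finset.mem_sdiff.2 ⟨hq i hx', fun hx'' => (Finset.mem_sdiff.1 (hXr i hx'')).2 hx'⟩
  have hYr : ∀ i, Y i ⊆ rem i := fun i => Finset.sdiff_subset
  have hcardmono : ∀ (A B : Finset V) (Q : V → Prop) [DecidablePred Q], A ⊆ B →
      (A.filter Q).card ≤ (B.filter Q).card := fun A B Q _ hAB =>
    Finset.card_le_card (Finset.filter_subset_filter _ hAB)
  have hrev : ∀ i y, (X i).filter (R (cσ i) · y) = (X i).filter (R (cσ i) y ·) := by
    intro i y
    exact Finset.filter_congr fun x _ => ⟨hsymm _ _ _, hsymm _ _ _⟩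
  have hfill : ∀ i, ∃ l : List V, l.Nodup ∧ (∀ x, x ∈ l ↔ x ∈ X i ∪ Y (σ i)) ∧
      List.IsChain (R (cσ i)) (u i :: l ++ [v i]) := by
    intro i
    refine exists_ham_fill (hsymm _) (X i) (Y (σ i)) s
      ((hrd _ _ (hσ i)).mono (hXr' i) (hYr _)) ((hXc i).trans (hYc _).symm)
      (fun A hA B hB => hNH i A (hA.trans (hXr' i)) B (hB.trans (hYr _))) ?_ ?_ (u i) (v i)
      (huv i) ?_ ?_
    · intro x hx'
      exact (hx i x (Or.inl (hXr' i hx'))).trans (hcardmono _ _ _ (hqY _))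
    · intro y hy'
      rw [hrev]
      exact (hy i y (Or.inl (hYr _ hy'))).trans (hcardmono _ _ _ (hpX _))
    · exact (hx i _ (Or.inr rfl)).trans (hcardmono _ _ _ (hqY _))
    · rw [hrev]
      exact (hy i _ (Or.inr rfl)).trans (hcardmono _ _ _ (hpX _))
  choose fill hf1 hf2 hf3 using hfill
  refine ⟨fill, fun i => ⟨hf1 i, hf3 i⟩, ?_, ?_⟩
  · intro i j hij x hxi hxj
    rw [hf2, Finset.mem_union] at hxi hxj
    have hr : ∀ a b, x ∈ rem a → x ∈ rem b → a = b := by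
      intro a b ha hb
      by_contra hab
      exact Finset.disjoint_left.1 (hrd a b hab) ha hb
    rcases hxi with h1 | h1 <;> rcases hxj with h2 | h2
    · exact hij (hr _ _ (hXr' _ h1) (hXr' _ h2))
    · have := hr _ _ (hXr' _ h1) (hYr _ h2)
      rw [this] at h1
      exact (Finset.mem_sdiff.1 h2).2 h1
    · have := hr _ _ (hYr _ h1) (hXr' _ h2)
      rw [← this] at h2
      exact (Finset.mem_sdiff.1 h1).2 h2
    · exact hij (σ.injective (hr _ _ (hYr _ h1) (hYr _ h2)))
  · intro x
    constructor
    · rintro ⟨i, hi⟩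
      rw [hf2, Finset.mem_union] at hi
      rcases hi with h1 | h1
      · exact ⟨i, hXr' i h1⟩
      · exact ⟨_, hYr _ h1⟩
    · rintro ⟨i, hi⟩
      by_cases h1 : x ∈ X i
      · exact ⟨i, (hf2 _ _).2 (Finset.mem_union_left _ h1)⟩
      · refine ⟨σ.symm i, (hf2 _ _).2 (Finset.mem_union_right _ ?_)⟩
        rw [Equiv.apply_symm_apply]
        exact Finset.mem_sdiff.2 ⟨hi, h1⟩

/-- Two disjoint sets in every cluster, such that outside a small exceptional set every vertex
has many neighbours in the sets of the two clusters matched to its own. -/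
theorem exists_cores {r : ℕ} {ι : Type*} [DecidableEq V]
    (R : Fin r → V → V → Prop) [∀ c, DecidableRel (R c)] (σ : Equiv.Perm ι) (cσ : ι → Fin r)
    (cl : ι → Finset V) (s P w : ℕ) (hP : 0 < P)
    (hG : ∀ i, HalfGood (R (cσ i)) (cl i) (cl (σ i)) s P)
    (hG' : ∀ i, HalfGood (R (cσ i)) (cl (σ i)) (cl i) s P)
    (hw : P * (22 * s + 20) ≤ w) (hcl : ∀ i, 2 * w + 4 * s ≤ (cl i).card) :
    ∃ T p q : ι → Finset V, (∀ i, T i ⊆ cl i) ∧ (∀ i, (T i).card ≤ 2 * s) ∧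
      (∀ i, p i ⊆ cl i \ T i) ∧ (∀ i, q i ⊆ cl i \ T i) ∧ (∀ i, Disjoint (p i) (q i)) ∧
      (∀ i, (p i).card = w) ∧ (∀ i, (q i).card = w) ∧
      (∀ i, ∀ x ∈ cl i \ T i, 20 * s + 20 ≤ ((q (σ i)).filter (R (cσ i) x ·)).card) ∧
      ∀ i, ∀ y ∈ cl (σ i) \ T (σ i), 20 * s + 20 ≤ ((p i).filter (R (cσ i) y ·)).card := by
  have hp0 : ∀ i, ∃ p0 ⊆ cl i, p0.card = w + 2 * s := fun i =>
    Finset.exists_subset_card_eq (by have := hcl i; omega)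
  choose p0 hp0 hp0c using hp0
  have hq0 : ∀ i, ∃ q0 ⊆ cl i \ p0 i, q0.card = w + 2 * s := fun i =>
    Finset.exists_subset_card_eq (by
      rw [Finset.card_sdiff_of_subset (hp0 i), hp0c]; have := hcl i; omega)
  choose q0 hq0 hq0c using hq0
  have hq0' : ∀ i, q0 i ⊆ cl i := fun i => (hq0 i).trans Finset.sdiff_subset
  let T : ι → Finset V := fun i =>
    (cl i).filter (fun x => P * ((q0 (σ i)).filter (R (cσ i) x ·)).card < (q0 (σ i)).card) ∪
    (cl i).filter (fun x => P * ((p0 (σ.symm i)).filter (R (cσ (σ.symm i)) x ·)).card <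
      (p0 (σ.symm i)).card)
  have hT : ∀ i, (T i).card ≤ 2 * s := by
    intro i
    have h1 := (hG i).card_low_lt (q0 (σ i)) (hq0' _) (by rw [hq0c]; nlinarith)
    have h2 := hG' (σ.symm i)
    rw [Equiv.apply_symm_apply] at h2
    have h2 := h2.card_low_lt (p0 (σ.symm i)) (hp0 _) (by rw [hp0c]; nlinarith)
    have h3 := Finset.card_union_le ((cl i).filter (fun x =>
        P * ((q0 (σ i)).filter (R (cσ i) x ·)).card < (q0 (σ i)).card))
      ((cl i).filter (fun x => P * ((p0 (σ.symm i)).filter (R (cσ (σ.symm i)) x ·)).card <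
      (p0 (σ.symm i)).card))
    simp only [T]
    omega
  have hp1 : ∀ i, ∃ p1 ⊆ p0 i \ T i, p1.card = w := fun i =>
    Finset.exists_subset_card_eq (by
      have h1 := Finset.le_card_sdiff (T i) (p0 i); rw [hp0c] at h1; have := hT i; omega)
  choose p hp hpc using hp1
  have hq1 : ∀ i, ∃ q1 ⊆ q0 i \ T i, q1.card = w := fun i =>
    Finset.exists_subset_card_eq (by
      have h1 := Finset.le_card_sdiff (T i) (q0 i); rw [hq0c] at h1; have := hT i; omega)
  choose q hq hqc using hq1
  -- passing to the smaller cores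
  have key : ∀ (A B : Finset V) (c : Fin r) (x : V), A ⊆ B → A.card = w → B.card = w + 2 * s →
      ¬ (P * (B.filter (R c x ·)).card < B.card) → 20 * s + 20 ≤ (A.filter (R c x ·)).card := by
    intro A B c x hAB hA hB hlow
    rw [hB, not_lt] at hlow
    have h1 : (B.filter (R c x ·)).card ≤ (A.filter (R c x ·)).card + (B \ A).card := by
      refine (Finset.card_le_card (t := A.filter (R c x ·) ∪ B \ A) ?_).trans
        (Finset.card_union_le _ _)
      intro y hy
      rw [Finset.mem_filter] at hy
      by_cases hyA : y ∈ A
      · exact Finset.mem_union_left _ (Finset.mem_filter.2 ⟨hyA, hy.2⟩)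
      · exact Finset.mem_union_right _ (Finset.mem_sdiff.2 ⟨hy.1, hyA⟩)
    rw [Finset.card_sdiff_of_subset hAB, hA, hB] at h1
    have h2 : 22 * s + 20 ≤ (B.filter (R c x ·)).card := by
      by_contra hlt
      have h3 : P * ((B.filter (R c x ·)).card + 1) ≤ P * (22 * s + 20) :=
        Nat.mul_le_mul_left _ (by omega)
      nlinarith
    omega
  refine ⟨T, p, q, fun i => Finset.union_subset (Finset.filter_subset _ _)
    (Finset.filter_subset _ _), hT, fun i => (hp i).trans (Finset.sdiff_subset_sdiff (hp0 i) le_rfl),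
    fun i => (hq i).trans (Finset.sdiff_subset_sdiff (hq0' i) le_rfl), fun i => ?_, hpc, hqc, ?_, ?_⟩
  · rw [Finset.disjoint_left]
    intro x hx hx'
    exact (Finset.mem_sdiff.1 (hq0 i (Finset.mem_sdiff.1 (hq i hx')).1)).2
      (Finset.mem_sdiff.1 (hp i hx)).1
  · intro i x hx
    refine key (q (σ i)) (q0 (σ i)) (cσ i) x ((hq _).trans Finset.sdiff_subset) (hqc _) (hq0c _) ?_
    intro hlow
    exact (Finset.mem_sdiff.1 hx).2 (Finset.mem_union_left _
      (Finset.mem_filter.2 ⟨(Finset.mem_sdiff.1 hx).1, hlow⟩))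
  · intro i y hy
    refine key (p i) (p0 i) (cσ i) y ((hp _).trans Finset.sdiff_subset) (hpc _) (hp0c _) ?_
    intro hlow
    refine (Finset.mem_sdiff.1 hy).2 (Finset.mem_union_right _
      (Finset.mem_filter.2 ⟨(Finset.mem_sdiff.1 hy).1, ?_⟩))
    rw [Equiv.symm_apply_apply]
    exact hlow

lemma sum_loads {ι : Type*} [Fintype ι] [DecidableEq ι] (H : ι → ι → Prop)
    [Fintype {e : ι × ι // H e.1 e.2}] (x : ι → ι → ℕ)
    (hx : ∀ i j, x i j ≠ 0 → H i j) (i : ι) :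
    ∑ e : {e : ι × ι // H e.1 e.2}, ((if e.1.1 = i then x e.1.1 e.1.2 else 0) +
      if e.1.2 = i then x e.1.1 e.1.2 else 0) = ∑ j, (x i j + x j i) := by
  classical
  let f : ι × ι → ℕ := fun e => (if e.1 = i then x e.1 e.2 else 0) +
      if e.2 = i then x e.1 e.2 else 0
  have h1 : ∑ e ∈ Finset.univ.filter (fun e : ι × ι => H e.1 e.2), f e =
      ∑ e : {e : ι × ι // H e.1 e.2}, f e.1 := Finset.sum_subtype _ (by simp) f
  have h2 : ∑ e ∈ Finset.univ.filter (fun e : ι × ι => H e.1 e.2), f e = ∑ e, f e := by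
    refine Finset.sum_filter_of_ne (fun e _ he => hx _ _ (fun h0 => he ?_))
    simp [f, h0]
  have h3 : ∑ e, f e = ∑ j, (x i j + x j i) := by
    rw [Fintype.sum_prod_type]
    simp only [f, Finset.sum_add_distrib]
    congr 1
    · rw [Finset.sum_comm]; simp
    · simp
  rw [← h3, ← h2, h1]

theorem exists_total_fill {r : ℕ} {ι : Type*} [DecidableEq V] [Fintype ι] [DecidableEq ι]
    {R : Fin r → V → V → Prop} [∀ c, DecidableRel (R c)]
    (hsymm : ∀ c u v, R c u v → R c v u) {H : ι → ι → Prop} [DecidableRel H]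
    {σ : Equiv.Perm ι} {cσ : ι → Fin r} {colr : {e : ι × ι // H e.1 e.2} → Fin r}
    {F : ι → Finset V}
    {nx : ι ⊕ {e : ι × ι // H e.1 e.2} → ι ⊕ {e : ι × ι // H e.1 e.2}} {P ℓ : ℕ}
    (sk : Skeleton R F (Sum.elim id (fun e => e.1.1)) (Sum.elim σ (fun e => e.1.2))
      (Sum.elim cσ colr) nx P ℓ)
    (s : ℕ) (hs : 0 < s) (hP : 0 < P) (C p q : ι → Finset V)
    (hC : ∀ i j, i ≠ j → Disjoint (C i) (C j))
    (hp : ∀ i, p i ⊆ C i) (hq : ∀ i, q i ⊆ C i) (hpq : ∀ i, Disjoint (p i) (q i)) (w : ℕ)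
    (hpw : ∀ i, (p i).card = w) (hqw : ∀ i, (q i).card = w)
    (hF : ∀ i, F i = C i \ (p i ∪ q i))
    (hG : ∀ i, HalfGood (R (cσ i)) (C i) (C (σ i)) s P)
    (hGe : ∀ e : {e : ι × ι // H e.1 e.2}, HalfGood (R (colr e)) (C e.1.1) (C e.1.2) s P)
    (hσ : ∀ i, i ≠ σ i) (hne : ∀ e : {e : ι × ι // H e.1 e.2}, e.1.1 ≠ e.1.2)
    (hx : ∀ i, ∀ x ∈ C i, 20 * s + 20 ≤ ((q (σ i)).filter (R (cσ i) x ·)).card)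
    (hy : ∀ i, ∀ y ∈ C (σ i), 20 * s + 20 ≤ ((p i).filter (R (cσ i) y ·)).card)
    (Us : Finset V) (hUp : ∀ i, Disjoint Us (p i)) (hUq : ∀ i, Disjoint Us (q i))
    (hsU : ∀ e, ∀ x ∈ sk.base e, x ∈ Us) (K h U k : ℕ)
    (hK : ∀ i, (F i).card ≤ (F i \ Us).card + K) (b t : ι → ℕ) (x : ι → ι → ℕ)
    (hb : ∀ i, (C i \ Us).card = b i + 2 * h) (hbU : ∀ i, b i ≤ U) (ht : ∑ i, t i ≤ k)
    (hxH : ∀ i j, x i j ≠ 0 → H i j) (hbal : ∀ i, ∑ j, (x i j + x j i) + t i = b i)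
    (hwh : w ≤ h) (hsz : ∀ i, P * (2 * U + (K + k) + 2 * s + P * (s + 1)) ≤ (F i).card) :
    ∃ (Sg : Finset V) (fill : ι ⊕ {e : ι × ι // H e.1 e.2} → List V),
      Sg.card ≤ k ∧ Disjoint Sg Us ∧ sk.Fill fill ∧
      (∀ e, ∀ y ∈ fill e, y ∉ Us ∧ y ∉ Sg) ∧
      ∀ i, ∀ y ∈ C i, y ∉ Us → y ∉ Sg → ∃ e, y ∈ fill e := by
  have hFC : ∀ i, F i ⊆ C i := fun i => by rw [hF]; exact Finset.sdiff_subset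
  have hpqC : ∀ i, p i ∪ q i ⊆ C i := fun i => Finset.union_subset (hp i) (hq i)
  have hpqw : ∀ i, (p i ∪ q i).card = 2 * w := fun i => by
    rw [Finset.card_union_of_disjoint (hpq i), hpw, hqw]; ring
  have hUpq : ∀ i, ∀ y ∈ p i ∪ q i, y ∉ Us := by
    intro i y hy hyU
    rcases Finset.mem_union.1 hy with h | h
    · exact Finset.disjoint_left.1 (hUp i) hyU h
    · exact Finset.disjoint_left.1 (hUq i) hyU h
  have hpqF : ∀ i j, ∀ y ∈ p i ∪ q i, y ∉ F j := by
    intro i j y hy hyF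
    by_cases hij : i = j
    · subst hij; rw [hF] at hyF; exact (Finset.mem_sdiff.1 hyF).2 hy
    · exact Finset.disjoint_left.1 (hC i j hij) (hpqC i hy) (hFC j hyF)
  have hFU : ∀ i, (F i \ Us).card + 2 * w = b i + 2 * h := by
    intro i
    rw [← hb i, ← hpqw i]
    have he : C i \ Us = (F i \ Us) ∪ (p i ∪ q i) := by
      ext y
      have := hUpq i y
      have h' := @hpqC i y
      rw [Finset.mem_union, Finset.mem_sdiff, Finset.mem_sdiff, hF, Finset.mem_sdiff]
      tauto
    rw [he]
    refine (Finset.card_union_of_disjoint ?_).symm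
    rw [Finset.disjoint_right]
    intro y hy hy'
    exact hpqF i i y hy (Finset.mem_sdiff.1 hy').1
  have hti : ∀ i, t i ≤ b i := fun i => by have := hbal i; omega
  have hS0 : ∀ i, ∃ S ⊆ F i \ Us, S.card = t i := fun i =>
    Finset.exists_subset_card_eq (by have := hFU i; have := hti i; omega)
  choose Si hSi hSic using hS0
  have htk : ∀ i, t i ≤ k := fun i =>
    (Finset.single_le_sum (fun j _ => Nat.zero_le (t j)) (Finset.mem_univ i)).trans ht
  let rem : ι → Finset V := fun i => (F i \ Us) \ Si i
  have hremF : ∀ i, rem i ⊆ F i := fun i => Finset.sdiff_subset.trans Finset.sdiff_subset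
  have hrd : ∀ i j, i ≠ j → Disjoint (rem i) (rem j) := fun i j hij =>
    (hC i j hij).mono ((hremF i).trans (hFC i)) ((hremF j).trans (hFC j))
  have hremc : ∀ i, (rem i).card + t i = (F i \ Us).card := by
    intro i
    simp only [rem]
    rw [Finset.card_sdiff_of_subset (hSi i), hSic]
    have := Finset.card_le_card (hSi i); rw [hSic] at this; omega
  let E : Finset (ι ⊕ {e : ι × ι // H e.1 e.2}) := Finset.univ.map Function.Embedding.inr
  have hloads : ∀ i, ∑ e ∈ E, ((if Sum.elim id (fun e : {e : ι × ι // H e.1 e.2} => e.1.1) e = i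
        then Sum.elim (fun _ => 0) (fun e : {e : ι × ι // H e.1 e.2} => x e.1.1 e.1.2) e else 0) +
      if Sum.elim σ (fun e : {e : ι × ι // H e.1 e.2} => e.1.2) e = i
        then Sum.elim (fun _ => 0) (fun e : {e : ι × ι // H e.1 e.2} => x e.1.1 e.1.2) e else 0) =
      b i - t i := by
    intro i
    simp only [E, Finset.sum_map, Function.Embedding.inr_apply, Sum.elim_inr]
    rw [sum_loads H x hxH]
    have := hbal i; omega
  obtain ⟨fd, hfd, hfdd, hfdc⟩ := exists_demand_fill hsymm sk s hs hP
    (by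
      rintro (i | e)
      · exact (hG i).mono (hFC _) (hFC _)
      · exact (hGe e).mono (hFC _) (hFC _))
    (by
      rintro (i | e)
      · exact hσ i
      · exact hne e) rem hrd hremF (K + k) U
    (fun i => by have := hK i; have := hremc i; have := htk i; omega) E
    (Sum.elim (fun _ => 0) (fun e => x e.1.1 e.1.2))
    (fun i => by rw [hloads]; have := hbU i; omega) hsz
  simp only [hloads] at hfdc
  let D : Finset V := E.biUnion (fun e => (fd e).toFinset)
  have hmemE : ∀ e : {e : ι × ι // H e.1 e.2}, Sum.inr e ∈ E := by intro e; simp [E]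
  have hDrem : ∀ y ∈ D, ∃ i, y ∈ rem i := by
    intro y hy
    obtain ⟨e, he, hye⟩ := Finset.mem_biUnion.1 hy
    rcases Finset.mem_union.1 ((hfd e he).2.2 y (List.mem_toFinset.1 hye)) with h' | h'
    exacts [⟨_, h'⟩, ⟨_, h'⟩]
  let rem' : ι → Finset V := fun i => ((C i \ Us) \ Si i) \ D
  have hremC : ∀ i, rem i ⊆ (C i \ Us) \ Si i := fun i =>
    Finset.sdiff_subset_sdiff (Finset.sdiff_subset_sdiff (hFC i) le_rfl) le_rfl
  have hDi : ∀ i, D ∩ ((C i \ Us) \ Si i) = D ∩ rem i := by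
    intro i
    refine Finset.Subset.antisymm (fun y hy => ?_) (Finset.inter_subset_inter_left (hremC i))
    rw [Finset.mem_inter] at hy ⊢
    refine ⟨hy.1, ?_⟩
    obtain ⟨j, hj⟩ := hDrem y hy.1
    by_cases hij : i = j
    · subst hij; exact hj
    · exact (Finset.disjoint_left.1 (hC i j hij)
        (Finset.mem_sdiff.1 (Finset.mem_sdiff.1 hy.2).1).1 (hFC j (hremF j hj))).elim
  have hrem'c : ∀ i, (rem' i).card = 2 * h := by
    intro i
    simp only [rem']
    rw [Finset.card_sdiff, hDi, hfdc,
      Finset.card_sdiff_of_subset ((hSi i).trans (Finset.sdiff_subset_sdiff (hFC i) le_rfl)),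
      hb, hSic]
    have := hti i; omega
  have hrem'C : ∀ i, rem' i ⊆ C i := fun i =>
    Finset.sdiff_subset.trans (Finset.sdiff_subset.trans Finset.sdiff_subset)
  have hpqr : ∀ i, p i ∪ q i ⊆ rem' i := by
    intro i y hy
    refine Finset.mem_sdiff.2 ⟨Finset.mem_sdiff.2 ⟨Finset.mem_sdiff.2 ⟨hpqC i hy, hUpq i y hy⟩,
      fun h' => ?_⟩, fun h' => ?_⟩
    · exact hpqF i i y hy (Finset.mem_sdiff.1 (hSi i h')).1
    · obtain ⟨j, hj⟩ := hDrem y h'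
      exact hpqF i j y hy (hremF j hj)
  obtain ⟨fb, hfb, hfbd, hfbc⟩ := exists_base_fill hsymm σ cσ rem' p q hσ
    (fun i j hij => (hC i j hij).mono (hrem'C i) (hrem'C j)) s h w
    (fun i => Finset.subset_union_left.trans (hpqr i))
    (fun i => Finset.subset_union_right.trans (hpqr i)) hpq hpw hqw hrem'c
    (fun i => ((hG i).mono (hrem'C _) (hrem'C _)).noHole hs)
    (fun i => sk.u (Sum.inl i)) (fun i => sk.v (Sum.inl i)) (fun i => sk.rel (Sum.inl i))
    (by
      rintro i y (hy' | rfl)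
      · exact hx i y (hrem'C i hy')
      · exact hx i _ (hFC _ (sk.u_mem (Sum.inl i))))
    (by
      rintro i y (hy' | rfl)
      · exact hy i y (hrem'C _ hy')
      · exact hy i _ (hFC _ (sk.v_mem (Sum.inl i))))
  have hfbmem : ∀ i, ∀ y ∈ fb i, ∃ j, y ∈ rem' j := fun i y hy' => (hfbc y).1 ⟨i, hy'⟩
  have hfdmem : ∀ e : {e : ι × ι // H e.1 e.2}, ∀ y ∈ fd (Sum.inr e), y ∈ D := fun e y hy' =>
    Finset.mem_biUnion.2 ⟨_, hmemE e, List.mem_toFinset.2 hy'⟩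
  have hfbfd : ∀ i e, List.Disjoint (fb i) (fd (Sum.inr e)) := by
    intro i e y hy1 hy2
    obtain ⟨j, hj⟩ := hfbmem i y hy1
    exact (Finset.mem_sdiff.1 hj).2 (hfdmem e y hy2)
  have hSgU : Disjoint (Finset.univ.biUnion Si) Us := by
    rw [Finset.disjoint_left]
    intro y hy' hyU
    obtain ⟨i, _, hi⟩ := Finset.mem_biUnion.1 hy'
    exact (Finset.mem_sdiff.1 (hSi i hi)).2 hyU
  have hout : ∀ e, ∀ y ∈ (Sum.elim fb (fun e => fd (Sum.inr e)) :
      ι ⊕ {e : ι × ι // H e.1 e.2} → List V) e, y ∉ Us ∧ y ∉ Finset.univ.biUnion Si := by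
    have hj' : ∀ j, ∀ y ∈ C j, y ∉ Si j → y ∉ Finset.univ.biUnion Si := by
      intro j y hyC hyS hy'
      obtain ⟨i, _, hi⟩ := Finset.mem_biUnion.1 hy'
      by_cases hij : i = j
      · subst hij; exact hyS hi
      · exact Finset.disjoint_left.1 (hC i j hij)
          (hFC i (Finset.mem_sdiff.1 (hSi i hi)).1) hyC
    have hj2 : ∀ j, ∀ y ∈ (C j \ Us) \ Si j, y ∉ Us ∧ y ∉ Finset.univ.biUnion Si := by
      intro j y hy'
      rw [Finset.mem_sdiff, Finset.mem_sdiff] at hy'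
      exact ⟨hy'.1.2, hj' j y hy'.1.1 hy'.2⟩
    rintro (i | e) y hy'
    · obtain ⟨j, hj⟩ := hfbmem i y hy'
      exact hj2 j y (Finset.sdiff_subset hj)
    · obtain ⟨j, hj⟩ := hDrem y (hfdmem e y hy')
      exact hj2 j y (hremC j hj)
  refine ⟨Finset.univ.biUnion Si, Sum.elim fb (fun e => fd (Sum.inr e)), ?_, hSgU,
    ⟨?_, ?_, ?_, ?_⟩, hout, ?_⟩
  · refine Finset.card_biUnion_le.trans ?_
    simp only [hSic]; exact ht
  · rintro (i | e)
    · exact (hfb i).2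
    · exact (hfd _ (hmemE e)).2.1
  · rintro (i | e)
    · exact (hfb i).1
    · exact (hfd _ (hmemE e)).1
  · intro e e' y hy1 hy2
    exact (hout e y hy1).1 (hsU e' y hy2)
  · rintro (i | e) (j | e') hee
    · exact hfbd i j (fun h' => hee (by rw [h']))
    · exact hfbfd i e'
    · exact (hfbfd j e).symm
    · exact hfdd _ (hmemE e) _ (hmemE e') hee
  · intro i y hyC hyU hyS
    by_cases hyD : y ∈ D
    · obtain ⟨e, he, hye⟩ := Finset.mem_biUnion.1 hyD
      obtain ⟨e, _, rfl⟩ := Finset.mem_map.1 he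
      exact ⟨Sum.inr e, List.mem_toFinset.1 hye⟩
    · obtain ⟨j, hj⟩ := (hfbc y).2 ⟨i, Finset.mem_sdiff.2 ⟨Finset.mem_sdiff.2
        ⟨Finset.mem_sdiff.2 ⟨hyC, hyU⟩, fun h' => hyS
          (Finset.mem_biUnion.2 ⟨i, Finset.mem_univ _, h'⟩)⟩, hyD⟩⟩
      exact ⟨Sum.inl j, hj⟩

lemma IsCyc.abs_sum_le [DecidableEq V] {R : V → V → Prop} {l : List V} (h : IsCyc R l) (f : V → ℤ)
    (hf : ∀ u v, R u v → f u + f v = 0) (hf1 : ∀ v, |f v| ≤ 1) :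
    |∑ v ∈ l.toFinset, f v| ≤ 1 := by
  rw [List.sum_toFinset f h.1]
  by_cases hl : l.length = 1
  · obtain ⟨a, rfl⟩ := List.length_eq_one_iff.1 hl
    simpa using hf1 a
  · rw [h.sum_eq_zero hl f hf]; simp

/-- The vertices of a skeleton are balanced, because they form a union of cycles. -/
lemma Skeleton.sum_base_eq_zero {r : ℕ} {ι S κ : Type*} [DecidableEq V] [Fintype S] [DecidableEq S]
    [Fintype κ] [DecidableEq κ] {R : Fin r → V → V → Prop} [∀ c, DecidableRel (R c)]
    {F : ι → Finset V} {src tgt : S → ι} {col : S → Fin r} {nx : S → S} {P ℓ : ℕ}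
    (sk : Skeleton R F src tgt col nx P ℓ) (key : S → κ) (g : κ → List S)
    (hcol : ∀ e e', key e = key e' → col e = col e')
    (hg : ∀ k e, e ∈ g k ↔ key e = k) (hgn : ∀ k, (g k).Nodup)
    (hgc : ∀ k, ∀ a ∈ (g k).head?, List.IsChain (fun x y => y = nx x) (g k ++ [a]))
    (side : V → ℤ) (hside : ∀ c u v, R c u v → side u + side v = 0) :
    ∑ v ∈ Finset.univ.biUnion (fun e => (sk.base e).toFinset), side v = 0 := by
  have hU : Finset.univ.biUnion (fun e => (sk.base e).toFinset) = Finset.univ.biUnion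
      (fun k => ((g k).flatMap (sk.block (fun _ => []))).toFinset) := by
    ext v
    simp only [Finset.mem_biUnion, Finset.mem_univ, true_and, List.mem_toFinset, List.mem_flatMap,
      sk.mem_block, List.not_mem_nil, false_or]
    constructor
    · rintro ⟨e, he⟩; exact ⟨key e, e, (hg _ _).2 rfl, he⟩
    · rintro ⟨k, e, _, he⟩; exact ⟨e, he⟩
  rw [hU, Finset.sum_biUnion]
  · refine Finset.sum_eq_zero (fun k _ => ?_)
    by_cases hk : g k = []
    · simp [hk]
    · obtain ⟨e0, he0⟩ := List.exists_mem_of_ne_nil _ hk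
      have h := sk.fill_nil.isCyc (col e0) (g k) (hgn k)
        (fun e he => hcol e e0 (((hg _ _).1 he).trans ((hg _ _).1 he0).symm)) (hgc k)
      rw [List.sum_toFinset side h.1]
      exact h.sum_eq_zero (sk.length_flatMap_ne_one _ _) side (hside _)
  · intro k _ k' _ hkk
    rw [Function.onFun, Finset.disjoint_left]
    intro x hx hx'
    simp only [List.mem_toFinset, List.mem_flatMap] at hx hx'
    obtain ⟨e, he, hx⟩ := hx
    obtain ⟨e', he', hx'⟩ := hx'
    refine sk.fill_nil.block_disjoint (e := e) (e' := e') ?_ hx hx'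
    rintro rfl
    exact hkk (((hg _ _).1 he).symm.trans ((hg _ _).1 he'))

lemma exists_colour_of_card {r : ℕ} [DecidableEq V] (R : Fin r → V → V → Prop)
    [∀ c, DecidableRel (R c)] (c₀ : Fin r) (A : Finset V) (z : V) (g : ℕ)
    (hA : r * g ≤ (A.filter (fun x => ∃ c, R c z x)).card) :
    ∃ c, g ≤ (A.filter (R c z ·)).card := by
  by_contra! hcon
  have h1 : (A.filter (fun x => ∃ c, R c z x)).card ≤ ∑ c, (A.filter (R c z ·)).card := by
    refine (Finset.card_le_card ?_).trans Finset.card_biUnion_le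
    intro x hx
    obtain ⟨hxA, c, hc⟩ := Finset.mem_filter.1 hx
    exact Finset.mem_biUnion.2 ⟨c, Finset.mem_univ _, Finset.mem_filter.2 ⟨hxA, hc⟩⟩
  have h2 : ∑ c, (A.filter (R c z ·)).card < ∑ _c : Fin r, g :=
    Finset.sum_lt_sum_of_nonempty ⟨c₀, Finset.mem_univ _⟩ (fun c _ => hcon c)
  simp at h2
  omega

lemma card_sdiff_eq_add [DecidableEq V] {A C U : Finset V} (hA : A ⊆ C) (hU : ∀ y ∈ A, y ∉ U) :
    (C \ U).card = ((C \ A) \ U).card + A.card := by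
  have he : C \ U = ((C \ A) \ U) ∪ A := by
    ext y
    have h1 := hU y
    have h2 := @hA y
    simp only [Finset.mem_union, Finset.mem_sdiff]
    tauto
  rw [he]
  refine Finset.card_union_of_disjoint ?_
  rw [Finset.disjoint_right]
  intro y hy hy'
  exact (Finset.mem_sdiff.1 (Finset.mem_sdiff.1 hy').1).2 hy

set_option maxHeartbeats 1000000 in
theorem exists_partition_of_clusters {r : ℕ} {ι κ : Type*} [Fintype V] [DecidableEq V] [Nonempty V]
    [Fintype ι] [DecidableEq ι] [Fintype κ] [DecidableEq κ]
    (G : SimpleGraph V) (col : Sym2 V → Fin r) (c₀ : Fin r)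
    (R : Fin r → V → V → Prop) [∀ c, DecidableRel (R c)]
    (hR : ∀ c u v, R c u v ↔ G.Adj u v ∧ col s(u, v) = c)
    (cl : ι → Finset V) (hcl : ∀ i j, i ≠ j → Disjoint (cl i) (cl j)) (m : ℕ)
    (hm : ∀ i, (cl i).card = m) (Γ : Fin r → SimpleGraph ι) (s P : ℕ) (hs : 0 < s) (hP : 0 < P)
    (hG : ∀ c i j, (Γ c).Adj i j → HalfGood (R c) (cl i) (cl j) s P)
    (H : ι → ι → Prop) [DecidableRel H] (colr : ι → ι → Fin r)
    (hH : ∀ i j, H i j → (Γ (colr i j)).Adj i j) (key : ι → ι → κ)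
    (hkey : ∀ i j i' j', H i j → H i' j' → key i j = key i' j' →
      colr i j = colr i' j' ∧ (Γ (colr i j)).Reachable j j')
    (σ : Equiv.Perm ι) (hσ : ∀ i, H i (σ i))
    (side : V → ℤ) (hside1 : ∀ v, |side v| ≤ 1) (hside : ∀ u v, G.Adj u v → side u + side v = 0)
    (hside0 : ∑ v, side v = 0) (sd : ι → ℤ) (hsd : ∀ i, ∀ v ∈ cl i, side v = sd i)
    (hsd0 : ∑ i, sd i = 0) (U K α : ℕ) (hdist : Distributes H sd U K (r * α)) (δ : ℕ)
    (hδ : ∀ z, δ ≤ (Finset.univ.filter (fun x => ∃ c, R c z x)).card) (zb τ w L γ g h : ℕ)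
    (hzb : (Finset.univ \ Finset.univ.biUnion cl).card + 2 * s * Fintype.card ι ≤ zb)
    (hτ : (Fintype.card ι + Fintype.card ι ^ 2) * (Fintype.card ι + 3) ≤ τ)
    (hw : P * (22 * s + 20) ≤ w) (hm1 : 2 * w + 4 * s ≤ m)
    (hm2 : P * (τ + 2 * s + P * (Fintype.card ι + 3)) + 2 * w + 2 * s ≤ m)
    (hL : 0 < L) (hγ : zb * (L + m) ≤ L * γ)
    (hα : Fintype.card V + (α + 1) ^ 2 * γ < (α + 1) * g)
    (hg : r * g + (zb + 2 * w * Fintype.card ι + τ) ≤ δ)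
    (hK : 2 * s + τ + L ≤ K) (hKU : K ≤ U) (hUm : m = U + 2 * h) (hwh : w ≤ h)
    (hm3 : P * (2 * U + (K + (r * α + 2)) + 2 * s + P * (s + 1)) + 2 * w + 2 * s ≤ m) :
    ∃ k ≤ Fintype.card κ + r * α + (r * α + 2), MonoCyclePartition G col k := by
  classical
  have hsymm : ∀ c u v, R c u v → R c v u := by
    intro c u v huv
    rw [hR] at huv ⊢
    exact ⟨huv.1.symm, by rw [Sym2.eq_swap]; exact huv.2⟩
  have hirr : ∀ c v, ¬ R c v v := fun c v hv => G.loopless.irrefl v ((hR _ _ _).1 hv).1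
  set N := Fintype.card ι with hN
  obtain ⟨nx, gl, hnx, hgl, hgln, hglc⟩ := exists_cyclic_next
    (Sum.elim (fun i => key i (σ i)) (fun e => key e.1.1 e.1.2) :
      ι ⊕ {e : ι × ι // H e.1 e.2} → κ)
  set keyS : ι ⊕ {e : ι × ι // H e.1 e.2} → κ :=
    Sum.elim (fun i => key i (σ i)) (fun e => key e.1.1 e.1.2) with hkeyS
  set src : ι ⊕ {e : ι × ι // H e.1 e.2} → ι := Sum.elim id (fun e => e.1.1) with hsrc
  set tgt : ι ⊕ {e : ι × ι // H e.1 e.2} → ι := Sum.elim σ (fun e => e.1.2) with htgt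
  set cS : ι ⊕ {e : ι × ι // H e.1 e.2} → Fin r :=
    Sum.elim (fun i => colr i (σ i)) (fun e => colr e.1.1 e.1.2) with hcS
  have hkeyS' : ∀ e, keyS e = key (src e) (tgt e) := by rintro (i | e) <;> rfl
  have hcS' : ∀ e, cS e = colr (src e) (tgt e) := by rintro (i | e) <;> rfl
  have hHS : ∀ e, H (src e) (tgt e) := by
    rintro (i | e)
    · exact hσ i
    · exact e.2
  have hcolS : ∀ e e', keyS e = keyS e' → cS e = cS e' := by
    intro e e' hee
    rw [hkeyS', hkeyS'] at hee
    rw [hcS', hcS']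
    exact (hkey _ _ _ _ (hHS e) (hHS e') hee).1
  obtain ⟨T, p, q, hTcl, hT, hp, hq, hpq, hpw, hqw, hxq, hyp⟩ := exists_cores R σ
    (fun i => colr i (σ i)) cl s P w hP (fun i => hG _ _ _ (hH _ _ (hσ i)))
    (fun i => hG _ _ _ (hH _ _ (hσ i)).symm) hw (fun i => by rw [hm]; exact hm1)
  let C : ι → Finset V := fun i => cl i \ T i
  have hCcl : ∀ i, C i ⊆ cl i := fun i => Finset.sdiff_subset
  have hCd : ∀ i j, i ≠ j → Disjoint (C i) (C j) := fun i j hij =>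
    (hcl i j hij).mono (hCcl i) (hCcl j)
  have hCc : ∀ i, m ≤ (C i).card + 2 * s := by
    intro i
    have h1 := Finset.le_card_sdiff (T i) (cl i)
    have h2 := hT i
    rw [hm] at h1
    simp only [C]; omega
  have hCm : ∀ i, (C i).card ≤ m := fun i => by rw [← hm i]; exact Finset.card_le_card (hCcl i)
  let F : ι → Finset V := fun i => C i \ (p i ∪ q i)
  have hFC : ∀ i, F i ⊆ C i := fun i => Finset.sdiff_subset
  have hpqC : ∀ i, p i ∪ q i ⊆ C i := fun i => Finset.union_subset (hp i) (hq i)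
  have hpqw : ∀ i, (p i ∪ q i).card = 2 * w := fun i => by
    rw [Finset.card_union_of_disjoint (hpq i), hpw, hqw]; ring
  have hFc : ∀ i, (F i).card + 2 * w = (C i).card := by
    intro i
    have h1 := Finset.card_sdiff_add_card_eq_card (hpqC i)
    rw [hpqw] at h1; exact h1
  have hFd : ∀ i j, i ≠ j → Disjoint (F i) (F j) := fun i j hij =>
    (hCd i j hij).mono (hFC i) (hFC j)
  have hpqF : ∀ i j, ∀ y ∈ p i ∪ q i, y ∉ F j := by
    intro i j y hy hyF
    by_cases hij : i = j
    · subst hij; exact (Finset.mem_sdiff.1 hyF).2 hy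
    · exact Finset.disjoint_left.1 (hCd i j hij) (hpqC i hy) (hFC j hyF)
  have hGC : ∀ c i j, (Γ c).Adj i j → HalfGood (R c) (C i) (C j) s P := fun c i j hij =>
    (hG c i j hij).mono (hCcl i) (hCcl j)
  have hcardS : Fintype.card (ι ⊕ {e : ι × ι // H e.1 e.2}) ≤ N + N ^ 2 := by
    rw [Fintype.card_sum]
    have h1 : Fintype.card {e : ι × ι // H e.1 e.2} ≤ Fintype.card (ι × ι) :=
      Fintype.card_subtype_le _
    rw [Fintype.card_prod, ← hN, ← sq] at h1
    omega
  have hτ' : Fintype.card (ι ⊕ {e : ι × ι // H e.1 e.2}) * (N + 3) ≤ τ :=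
    (Nat.mul_le_mul_right _ hcardS).trans hτ
  obtain ⟨sk⟩ := exists_skeleton R hsymm hirr F Γ s P hs hP
    (fun c i j hij => (hGC c i j hij).mono (hFC i) (hFC j)) src tgt cS
    (fun e => by rw [hcS']; exact hH _ _ (hHS e)) nx (fun e => hcolS _ _ (hnx e))
    (fun e => by
      have h1 := hnx e
      change keyS _ = keyS _ at h1
      rw [hkeyS', hkeyS'] at h1
      rw [hcS']
      exact (hkey _ _ _ _ (hHS e) (hHS (nx e)) h1.symm).2) τ hτ'
    (fun i => by have := hFc i; have := hCc i; rw [← hN]; omega)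
  let B : Finset V := Finset.univ.biUnion (fun e => (sk.base e).toFinset)
  have hBc : B.card ≤ τ := by
    refine (Finset.card_biUnion_le_card_mul _ _ (N + 3) (fun e _ => ?_)).trans hτ'
    refine (List.toFinset_card_le _).trans ?_
    have := sk.len e
    simp only [Skeleton.base, List.length_cons]; omega
  have hBF : ∀ x ∈ B, ∃ i, x ∈ F i := by
    intro x hx
    obtain ⟨e, _, hx⟩ := Finset.mem_biUnion.1 hx
    rw [List.mem_toFinset, Skeleton.base, List.mem_cons, List.mem_cons] at hx
    rcases hx with rfl | rfl | hx
    exacts [⟨_, sk.u_mem e⟩, ⟨_, sk.v_mem e⟩, sk.p_mem e x hx]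
  let Z : Finset V := Finset.univ \ Finset.univ.biUnion C
  have hZC : ∀ x, x ∉ Z → ∃ i, x ∈ C i := by
    intro x hx
    simpa [Z] using hx
  have hZC' : ∀ x ∈ Z, ∀ i, x ∉ C i := by
    intro x hx
    simpa [Z] using hx
  have hZc : Z.card ≤ zb := by
    have h1 : Z ⊆ (Finset.univ \ Finset.univ.biUnion cl) ∪ Finset.univ.biUnion T := by
      intro x hx
      by_cases hxc : x ∈ Finset.univ.biUnion cl
      · obtain ⟨i, _, hi⟩ := Finset.mem_biUnion.1 hxc
        refine Finset.mem_union_right _ (Finset.mem_biUnion.2 ⟨i, Finset.mem_univ _, ?_⟩)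
        by_contra hxT
        exact hZC' x hx i (Finset.mem_sdiff.2 ⟨hi, hxT⟩)
      · exact Finset.mem_union_left _ (Finset.mem_sdiff.2 ⟨Finset.mem_univ _, hxc⟩)
    have h2 : (Finset.univ.biUnion T).card ≤ N * (2 * s) :=
      Finset.card_biUnion_le_card_mul _ _ _ (fun i _ => hT i)
    have h3 := (Finset.card_le_card h1).trans (Finset.card_union_le _ _)
    have h4 : N * (2 * s) = 2 * s * N := by ring
    omega
  let F' : ι → Finset V := fun i => F i \ B
  have hF'F : ∀ i, F' i ⊆ F i := fun i => Finset.sdiff_subset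
  obtain ⟨f, hfc, hfd, hfZ, hfm, hfL⟩ := exists_cover R hsymm F'
    (fun i j hij => (hFd i j hij).mono (hF'F i) (hF'F j)) m L γ g (Fintype.card V) α
    (fun i => (Finset.card_le_card ((hF'F i).trans (hFC i))).trans (hCm i)) hL Z
    (fun i => by
      rw [Finset.disjoint_left]
      intro x hx hx'
      exact hZC' x hx i (hFC i (hF'F i hx'))) (Finset.card_le_univ _)
    (by
      intro z _
      refine exists_colour_of_card R c₀ _ z g ?_
      have h1 : Finset.univ.filter (fun x => ∃ c, R c z x) ⊆
          (Finset.univ.biUnion F').filter (fun x => ∃ c, R c z x) ∪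
            (Z ∪ Finset.univ.biUnion (fun i => p i ∪ q i) ∪ B) := by
        intro x hx
        rw [Finset.mem_filter] at hx
        by_cases hxZ : x ∈ Z
        · simp [hxZ]
        obtain ⟨i, hi⟩ := hZC x hxZ
        by_cases hxp : x ∈ p i ∪ q i
        · refine Finset.mem_union_right _ (Finset.mem_union_left _ (Finset.mem_union_right _ ?_))
          exact Finset.mem_biUnion.2 ⟨i, Finset.mem_univ _, hxp⟩
        by_cases hxB : x ∈ B
        · simp [hxB]
        · refine Finset.mem_union_left _ (Finset.mem_filter.2 ⟨Finset.mem_biUnion.2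
            ⟨i, Finset.mem_univ _, ?_⟩, hx.2⟩)
          exact Finset.mem_sdiff.2 ⟨Finset.mem_sdiff.2 ⟨hi, hxp⟩, hxB⟩
      have h2 := (Finset.card_le_card h1).trans (Finset.card_union_le _ _)
      have h3 := Finset.card_union_le (Z ∪ Finset.univ.biUnion (fun i => p i ∪ q i)) B
      have h4 := Finset.card_union_le Z (Finset.univ.biUnion (fun i => p i ∪ q i))
      have h5 : (Finset.univ.biUnion (fun i => p i ∪ q i)).card ≤ N * (2 * w) :=
        Finset.card_biUnion_le_card_mul _ _ _ (fun i _ => (hpqw i).le)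
      have h6 : N * (2 * w) = 2 * w * N := by ring
      have h7 := hδ z
      omega)
    hα ((Nat.mul_le_mul_right _ hZc).trans hγ)
  let B' : Finset V := Finset.univ.biUnion (fun p => (f p).toFinset)
  have hmB' : ∀ x, x ∈ B' ↔ ∃ p, x ∈ f p := by intro x; simp [B']
  have hB'm : ∀ x ∈ B', x ∈ Z ∨ ∃ i, x ∈ F' i := by
    intro x hx
    obtain ⟨p, hp⟩ := (hmB' x).1 hx
    exact hfm p x hp
  have hBB' : Disjoint B B' := by
    rw [Finset.disjoint_left]
    intro x hx hx'
    rcases hB'm x hx' with h1 | ⟨i, h1⟩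
    · obtain ⟨i, hi⟩ := hBF x hx
      exact hZC' x h1 i (hFC i hi)
    · exact (Finset.mem_sdiff.1 h1).2 hx
  let Us := B ∪ B'
  have hZU : ∀ x, x ∉ Us → ∃ i, x ∈ C i := by
    intro x hx
    refine hZC x (fun hxZ => hx (Finset.mem_union_right _ ((hmB' x).2 (hfZ x hxZ))))
  have hUpq : ∀ i, ∀ y ∈ p i ∪ q i, y ∉ Us := by
    intro i y hy hyU
    rcases Finset.mem_union.1 hyU with h1 | h1
    · obtain ⟨j, hj⟩ := hBF y h1
      exact hpqF i j y hy hj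
    · rcases hB'm y h1 with h1 | ⟨j, h1⟩
      · exact hZC' y h1 i (hpqC i hy)
      · exact hpqF i j y hy (hF'F j h1)
  have hFU : ∀ i, (F i).card ≤ (F i \ Us).card + (τ + L) := by
    intro i
    have h1 : F i ⊆ (F i \ Us) ∪ (B ∪ (F' i).filter (fun x => ∃ p, x ∈ f p)) := by
      intro x hx
      by_cases hxB : x ∈ B
      · simp [hxB]
      by_cases hxB' : x ∈ B'
      · refine Finset.mem_union_right _ (Finset.mem_union_right _ (Finset.mem_filter.2 ⟨?_, ?_⟩))
        · exact Finset.mem_sdiff.2 ⟨hx, hxB⟩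
        · exact (hmB' x).1 hxB'
      · refine Finset.mem_union_left _ (Finset.mem_sdiff.2 ⟨hx, fun hxU => ?_⟩)
        rcases Finset.mem_union.1 hxU with h1 | h1
        exacts [hxB h1, hxB' h1]
    have h2 := (Finset.card_le_card h1).trans (Finset.card_union_le _ _)
    have h3 := Finset.card_union_le B ((F' i).filter (fun x => ∃ p, x ∈ f p))
    have := hfL i
    omega
  have hCU : ∀ i, (C i \ Us).card = (F i \ Us).card + 2 * w := fun i => by
    rw [← hpqw i]
    exact card_sdiff_eq_add (hpqC i) (hUpq i)
  have hCU1 : ∀ i, m ≤ (C i \ Us).card + K := by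
    intro i
    have := hCU i; have := hFU i; have := hFc i; have := hCc i
    omega
  have hCU2 : ∀ i, (C i \ Us).card ≤ m := fun i =>
    (Finset.card_le_card Finset.sdiff_subset).trans (hCm i)
  obtain ⟨b, hb⟩ : ∃ b : ι → ℕ, ∀ i, (C i \ Us).card = b i + 2 * h :=
    ⟨fun i => (C i \ Us).card - 2 * h, fun i => by
      change _ = _ - 2 * h + 2 * h
      have := hCU1 i; have := hCU2 i; omega⟩
  have hbsum : |∑ i, sd i * (b i : ℤ)| ≤ ((r * α : ℕ) : ℤ) := by
    have h1 : ∑ i, sd i * (b i : ℤ) = ∑ i, ∑ v ∈ C i \ Us, side v := by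
      have h2 : ∀ i, ∑ v ∈ C i \ Us, side v = sd i * (b i : ℤ) + sd i * (2 * h : ℤ) := by
        intro i
        rw [Finset.sum_congr rfl (fun v hv => hsd i v (hCcl i (Finset.mem_sdiff.1 hv).1)),
          Finset.sum_const, hb]
        simp only [nsmul_eq_mul]; push_cast; ring
      simp only [h2, Finset.sum_add_distrib]
      rw [← Finset.sum_mul _ _ (2 * (h : ℤ)), hsd0]; ring
    have h2 : ∑ i, ∑ v ∈ C i \ Us, side v = ∑ v ∈ Finset.univ \ Us, side v := by
      rw [← Finset.sum_biUnion]
      · congr 1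
        ext x
        simp only [Finset.mem_biUnion, Finset.mem_univ, true_and, Finset.mem_sdiff]
        constructor
        · rintro ⟨i, _, hx⟩; exact hx
        · intro hx; obtain ⟨i, hi⟩ := hZU x hx; exact ⟨i, hi, hx⟩
      · intro i _ j _ hij
        exact (hCd i j hij).mono Finset.sdiff_subset Finset.sdiff_subset
    have h3 : ∑ v ∈ Finset.univ \ Us, side v + ∑ v ∈ Us, side v = 0 := by
      rw [Finset.sum_sdiff (Finset.subset_univ _), hside0]
    have h4 : ∑ v ∈ Us, side v = ∑ v ∈ B', side v := by
      simp only [Us]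
      rw [Finset.sum_union hBB', sk.sum_base_eq_zero keyS gl hcolS hgl hgln hglc side
        (fun c u v huv => hside u v ((hR _ _ _).1 huv).1), zero_add]
    have h5 : ∑ v ∈ B', side v = ∑ p, ∑ v ∈ (f p).toFinset, side v := by
      refine Finset.sum_biUnion ?_
      intro p _ p' _ hpp
      rw [Function.onFun, Finset.disjoint_left]
      intro x hx hx'
      exact hfd p p' hpp (List.mem_toFinset.1 hx) (List.mem_toFinset.1 hx')
    have h6 : |∑ p, ∑ v ∈ (f p).toFinset, side v| ≤ ∑ _p : Fin r × Fin α, (1 : ℤ) :=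
      (Finset.abs_sum_le_sum_abs _ _).trans (Finset.sum_le_sum (fun p _ =>
        (hfc p).abs_sum_le side (fun u v huv => hside u v ((hR _ _ _).1 huv).1) hside1))
    rw [h1, h2, eq_neg_of_add_eq_zero_left h3, abs_neg, h4, h5]
    refine h6.trans (le_of_eq ?_)
    simp [Fintype.card_prod]
  obtain ⟨t, x, htk, hxH, hbal⟩ := hdist b (fun i => by have := hb i; have := hCU2 i; omega)
    (fun i => by have := hb i; have := hCU1 i; omega) hbsum
  obtain ⟨Sg, fill, hSgc, hSgU, hfill, hout, hcov⟩ := exists_total_fill hsymm sk s hs hP C p q hCd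
    (fun i => hp i) (fun i => hq i) hpq w hpw hqw (fun i => rfl)
    (fun i => hGC _ _ _ (hH _ _ (hσ i))) (fun e => hGC _ _ _ (hH _ _ e.2))
    (fun i => (hH _ _ (hσ i)).ne) (fun e => (hH _ _ e.2).ne) hxq hyp Us
    (fun i => by
      rw [Finset.disjoint_right]; intro y hy; exact hUpq i y (Finset.mem_union_left _ hy))
    (fun i => by
      rw [Finset.disjoint_right]; intro y hy; exact hUpq i y (Finset.mem_union_right _ hy))
    (fun e y hy => Finset.mem_union_left _ (Finset.mem_biUnion.2
      ⟨e, Finset.mem_univ _, List.mem_toFinset.2 hy⟩)) K h U (r * α + 2)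
    (fun i => by have := hFU i; omega) b t x hb
    (fun i => by have := hb i; have := hCU2 i; omega) htk hxH hbal hwh
    (fun i => by have := hFc i; have := hCc i; omega)
  have hbaseU : ∀ e, ∀ y ∈ sk.base e, y ∈ B := fun e y hy =>
    Finset.mem_biUnion.2 ⟨e, Finset.mem_univ _, List.mem_toFinset.2 hy⟩
  have hRfun : ∀ c, R c = fun u v => G.Adj u v ∧ col s(u, v) = c := fun c => by
    funext u v; exact propext (hR c u v)
  let fam : κ ⊕ (Fin r × Fin α) ⊕ {x // x ∈ Sg} → List V :=
    Sum.elim (fun k => (gl k).flatMap (sk.block fill)) (Sum.elim f (fun x => [x.1]))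
  have hmemk : ∀ k y, y ∈ fam (Sum.inl k) → y ∉ Sg ∧ y ∉ B' := by
    intro k y hy
    obtain ⟨e, _, hy⟩ := List.mem_flatMap.1 hy
    rcases (sk.mem_block fill e y).1 hy with h1 | h1
    · exact ⟨(hout e y h1).2, fun h2 => (hout e y h1).1 (Finset.mem_union_right _ h2)⟩
    · have h2 := hbaseU e y h1
      exact ⟨fun h3 => Finset.disjoint_left.1 hSgU h3 (Finset.mem_union_left _ h2),
        Finset.disjoint_left.1 hBB' h2⟩
  have hfS : ∀ p (z : {x // x ∈ Sg}), List.Disjoint (f p) [z.1] := by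
    intro p z y hy hy'
    rw [List.mem_singleton] at hy'
    subst hy'
    exact Finset.disjoint_left.1 hSgU z.2 (Finset.mem_union_right _ ((hmB' _).2 ⟨p, hy⟩))
  have hfk : ∀ k p, List.Disjoint (fam (Sum.inl k)) (f p) := fun k p y hy hy' =>
    (hmemk k y hy).2 ((hmB' y).2 ⟨p, hy'⟩)
  have hSk : ∀ k (z : {x // x ∈ Sg}), List.Disjoint (fam (Sum.inl k)) [z.1] := by
    intro k z y hy hy'
    rw [List.mem_singleton] at hy'
    subst hy'
    exact (hmemk k _ hy).1 z.2
  have hpart := monoCyclePartition_of_family G col fam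
    (by
      rintro (k | p | z)
      · by_cases hk : gl k = []
        · exact ⟨c₀, isCyc_of_length_le (by simp [fam, hk])⟩
        · obtain ⟨e0, he0⟩ := List.exists_mem_of_ne_nil _ hk
          refine ⟨cS e0, ?_⟩
          rw [← hRfun]
          exact hfill.isCyc (cS e0) (gl k) (hgln k)
            (fun e he => hcolS e e0 (((hgl _ _).1 he).trans ((hgl _ _).1 he0).symm)) (hglc k)
      · refine ⟨p.1, ?_⟩
        rw [← hRfun]; exact hfc p
      · exact ⟨c₀, isCyc_of_length_le (by simp [fam])⟩)
    (by
      rintro (k | p | z) (k' | p' | z') hne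
      · intro y hy hy'
        obtain ⟨e, he, hy⟩ := List.mem_flatMap.1 hy
        obtain ⟨e', he', hy'⟩ := List.mem_flatMap.1 hy'
        refine hfill.block_disjoint (e := e) (e' := e') ?_ hy hy'
        rintro rfl
        exact hne (by rw [((hgl _ _).1 he).symm.trans ((hgl _ _).1 he')])
      · exact hfk k p'
      · exact hSk k z'
      · exact (hfk k' p).symm
      · exact hfd p p' (fun h1 => hne (by rw [h1]))
      · exact hfS p z'
      · exact (hSk k' z).symm
      · exact (hfS p' z).symm
      · intro y hy hy'
        simp only [fam, Sum.elim_inr, List.mem_singleton] at hy hy'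
        exact hne (by rw [Subtype.ext (hy.symm.trans hy')]))
    (by
      intro v
      by_cases hvB : v ∈ B
      · obtain ⟨e, _, he⟩ := Finset.mem_biUnion.1 hvB
        refine ⟨Sum.inl (keyS e), List.mem_flatMap.2 ⟨e, (hgl _ _).2 rfl, ?_⟩⟩
        exact (sk.mem_block fill e v).2 (Or.inr (List.mem_toFinset.1 he))
      by_cases hvB' : v ∈ B'
      · obtain ⟨p, hp⟩ := (hmB' v).1 hvB'
        exact ⟨Sum.inr (Sum.inl p), hp⟩
      by_cases hvS : v ∈ Sg
      · exact ⟨Sum.inr (Sum.inr ⟨v, hvS⟩), by simp [fam]⟩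
      have hvU : v ∉ Us := fun h1 => (Finset.mem_union.1 h1).elim hvB hvB'
      obtain ⟨i, hi⟩ := hZU v hvU
      obtain ⟨e, he⟩ := hcov i v hi hvU hvS
      exact ⟨Sum.inl (keyS e), List.mem_flatMap.2 ⟨e, (hgl _ _).2 rfl,
        (sk.mem_block fill e v).2 (Or.inl he)⟩⟩)
  refine ⟨_, ?_, hpart⟩
  rw [Fintype.card_sum, Fintype.card_sum, Fintype.card_prod, Fintype.card_fin, Fintype.card_fin,
    Fintype.card_coe]
  omega

section averaging
variable {X κ κ' : Type*} [Fintype X] [DecidableEq κ] [DecidableEq κ']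

/-- The average of `f` over the fibre of `Φ` through a point. -/
noncomputable def avg (Φ : X → κ) (f : X → ℝ) (x : X) : ℝ :=
  (∑ y with Φ y = Φ x, f y) / ((Finset.univ.filter (fun y => Φ y = Φ x)).card : ℝ)

lemma avg_congr (Φ : X → κ) (f : X → ℝ) {x y : X} (h : Φ x = Φ y) : avg Φ f x = avg Φ f y := by
  simp only [avg, h]

lemma sum_mul_avg (Φ : X → κ) (f h : X → ℝ) (hh : ∀ x y, Φ x = Φ y → h x = h y) :
    ∑ x, h x * avg Φ f x = ∑ x, h x * f x := by
  have h1 : ∀ x, h x * avg Φ f x = ∑ y, if Φ y = Φ x then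
      f y * (h x / ((Finset.univ.filter (fun y => Φ y = Φ x)).card : ℝ)) else 0 := by
    intro x
    rw [avg, ← Finset.sum_filter, ← Finset.sum_mul]
    ring
  simp only [h1]
  rw [Finset.sum_comm]
  refine Finset.sum_congr rfl (fun y _ => ?_)
  have h2 : ∀ x, (if Φ y = Φ x then
      f y * (h x / ((Finset.univ.filter (fun y => Φ y = Φ x)).card : ℝ)) else 0) =
      if Φ x = Φ y then f y * (h y / ((Finset.univ.filter (fun z => Φ z = Φ y)).card : ℝ))
        else 0 := by
    intro x
    by_cases hxy : Φ y = Φ x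
    · rw [if_pos hxy, if_pos hxy.symm, hh y x hxy, hxy]
    · rw [if_neg hxy, if_neg (fun h => hxy h.symm)]
  simp only [h2]
  rw [← Finset.sum_filter, Finset.sum_const, nsmul_eq_mul]
  have h3 : ((Finset.univ.filter (fun z => Φ z = Φ y)).card : ℝ) ≠ 0 := by
    rw [Nat.cast_ne_zero]
    exact Finset.card_ne_zero_of_mem (Finset.mem_filter.2 ⟨Finset.mem_univ y, rfl⟩)
  field_simp

lemma sum_sq_avg_sub (Φ : X → κ) (Ψ : X → κ') (f : X → ℝ)
    (href : ∀ x y, Ψ x = Ψ y → Φ x = Φ y) :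
    ∑ x, (avg Ψ f x - avg Φ f x) ^ 2 = ∑ x, avg Ψ f x ^ 2 - ∑ x, avg Φ f x ^ 2 := by
  have h1 := sum_mul_avg Ψ f (avg Φ f) (fun x y h => avg_congr Φ f (href x y h))
  have h2 := sum_mul_avg Φ f (avg Φ f) (fun x y h => avg_congr Φ f h)
  have h3 : ∀ x, (avg Ψ f x - avg Φ f x) ^ 2 =
      avg Ψ f x ^ 2 - 2 * (avg Φ f x * avg Ψ f x) + avg Φ f x * avg Φ f x := by
    intro x; ring
  have h4 : ∀ x, avg Φ f x ^ 2 = avg Φ f x * avg Φ f x := fun x => by ring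
  simp only [h3, h4, Finset.sum_add_distrib, Finset.sum_sub_distrib, ← Finset.mul_sum]
  rw [h1, h2]; ring

lemma avg_nonneg (Φ : X → κ) (f : X → ℝ) (h0 : ∀ x, 0 ≤ f x) (x : X) : 0 ≤ avg Φ f x :=
  div_nonneg (Finset.sum_nonneg (fun y _ => h0 y)) (Nat.cast_nonneg _)

lemma avg_le_one (Φ : X → κ) (f : X → ℝ) (h1 : ∀ x, f x ≤ 1) (x : X) : avg Φ f x ≤ 1 := by
  refine div_le_one_of_le₀ ?_ (Nat.cast_nonneg _)
  refine (Finset.sum_le_sum (fun y _ => h1 y)).trans ?_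
  simp

lemma sum_sq_avg_le (Φ : X → κ) (f : X → ℝ) (h0 : ∀ x, 0 ≤ f x) (h1 : ∀ x, f x ≤ 1) :
    ∑ x, avg Φ f x ^ 2 ≤ Fintype.card X := by
  refine (Finset.sum_le_sum (g := fun _ => (1 : ℝ)) (fun x _ => ?_)).trans (by simp)
  have := avg_nonneg Φ f h0 x
  have := avg_le_one Φ f h1 x
  nlinarith

/-- On a union of fibres of `Ψ` whose average deviates from the `Φ`-average, the two averages
differ in mean square. -/
lemma le_sum_sq_avg_sub (Φ : X → κ) (Ψ : X → κ') (f : X → ℝ) (S : Finset X)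
    (hS : ∀ x y, Ψ x = Ψ y → x ∈ S → y ∈ S) (d ε : ℝ) (hd : ∀ x ∈ S, avg Φ f x = d)
    (hε : 0 ≤ ε) (hf : ∑ x ∈ S, f x ≤ (d - ε) * S.card) :
    ε ^ 2 * S.card ≤ ∑ x ∈ S, (avg Ψ f x - avg Φ f x) ^ 2 := by
  classical
  have h1 : ∑ x ∈ S, avg Ψ f x = ∑ x ∈ S, f x := by
    have := sum_mul_avg Ψ f (fun x => if x ∈ S then 1 else 0) (fun x y h => by
      by_cases hx : x ∈ S
      · rw [if_pos hx, if_pos (hS x y h hx)]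
      · rw [if_neg hx, if_neg (fun hy => hx (hS y x h.symm hy))])
    simpa using this
  have h2 : ∑ x ∈ S, (avg Ψ f x - avg Φ f x) = ∑ x ∈ S, f x - d * S.card := by
    rw [Finset.sum_sub_distrib, h1, Finset.sum_congr rfl hd]; simp; ring
  have h3 : ∑ x ∈ S, (-2 * ε * (avg Ψ f x - avg Φ f x) - ε ^ 2) ≤
      ∑ x ∈ S, (avg Ψ f x - avg Φ f x) ^ 2 :=
    Finset.sum_le_sum (fun x _ => by nlinarith [sq_nonneg (avg Ψ f x - avg Φ f x + ε)])
  rw [Finset.sum_sub_distrib, ← Finset.mul_sum, h2] at h3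
  simp only [Finset.sum_const, nsmul_eq_mul] at h3
  nlinarith

end averaging

/-- The sets in `𝓕` are pairwise disjoint. -/
def DisjFam (𝓕 : Finset (Finset V)) : Prop := ∀ C ∈ 𝓕, ∀ D ∈ 𝓕, C ≠ D → Disjoint C D

lemma DisjFam.eq_of_mem {𝓕 : Finset (Finset V)} (h : DisjFam 𝓕) {C D : Finset V} (hC : C ∈ 𝓕)
    (hD : D ∈ 𝓕) {x : V} (hx : x ∈ C) (hx' : x ∈ D) : C = D := by
  by_contra hne
  exact Finset.disjoint_left.1 (h C hC D hD hne) hx hx'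

/-- The number of pairs in `A × B` related by `R`. -/
def pairs (R : V → V → Prop) [DecidableRel R] (A B : Finset V) : ℕ :=
  ((A ×ˢ B).filter (fun p => R p.1 p.2)).card

lemma sum_ind_eq_pairs (R : V → V → Prop) [DecidableRel R] (A B : Finset V) :
    ∑ z ∈ A ×ˢ B, (if R z.1 z.2 then (1 : ℝ) else 0) = pairs R A B := by
  rw [Finset.sum_boole]; rfl

section regularity
variable [Fintype V] [DecidableEq V]

/-- The class of `x` in the partition consisting of the sets in `𝓕` and singletons. -/
def part (𝓕 : Finset (Finset V)) (x : V) : Finset V :=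
  Finset.univ.filter (fun y => y = x ∨ ∃ C ∈ 𝓕, x ∈ C ∧ y ∈ C)

/-- The vertices outside all sets in `𝓕`. -/
def uncov (𝓕 : Finset (Finset V)) : Finset V := Finset.univ.filter (fun x => ∀ C ∈ 𝓕, x ∉ C)

lemma part_eq_of_mem {𝓕 : Finset (Finset V)} (h : DisjFam 𝓕) {C : Finset V} (hC : C ∈ 𝓕) {x : V}
    (hx : x ∈ C) : part 𝓕 x = C := by
  ext y
  simp only [part, Finset.mem_filter, Finset.mem_univ, true_and]
  constructor
  · rintro (rfl | ⟨D, hD, hxD, hyD⟩)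
    · exact hx
    · rwa [h.eq_of_mem hC hD hx hxD]
  · intro hy; exact Or.inr ⟨C, hC, hx, hy⟩

lemma mem_part_self (𝓕 : Finset (Finset V)) (x : V) : x ∈ part 𝓕 x := by simp [part]

lemma eq_or_mem_of_part_eq {𝓕 : Finset (Finset V)} {x y : V} (h : part 𝓕 x = part 𝓕 y) :
    y = x ∨ ∃ C ∈ 𝓕, x ∈ C ∧ y ∈ C := by
  have := mem_part_self 𝓕 y
  rw [← h] at this
  simpa [part] using this

lemma part_eq_of_refines {𝓕 𝓠 : Finset (Finset V)} (h : DisjFam 𝓕)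
    (href : ∀ D ∈ 𝓠, ∃ C ∈ 𝓕, D ⊆ C) {x y : V} (hxy : part 𝓠 x = part 𝓠 y) :
    part 𝓕 x = part 𝓕 y := by
  rcases eq_or_mem_of_part_eq hxy with rfl | ⟨D, hD, hx, hy⟩
  · rfl
  · obtain ⟨C, hC, hDC⟩ := href D hD
    rw [part_eq_of_mem h hC (hDC hx), part_eq_of_mem h hC (hDC hy)]

/-- Cut the sets of `𝓕` into sets of size `m'` on which a labelling is constant. -/
lemma exists_chop {α : Type*} [Fintype α] [DecidableEq α] (𝓕 : Finset (Finset V))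
    (lab : V → α) (m' : ℕ) (hm' : 0 < m') :
    ∃ 𝓠 : Finset (Finset V), DisjFam 𝓠 ∧ (∀ D ∈ 𝓠, D.card = m') ∧
      (∀ D ∈ 𝓠, ∃ C ∈ 𝓕, D ⊆ C) ∧ (∀ D ∈ 𝓠, ∀ x ∈ D, ∀ y ∈ D, lab x = lab y) ∧
      (uncov 𝓠).card ≤ (uncov 𝓕).card + 𝓕.card * Fintype.card α * m' := by
  classical
  let good : Finset (Finset V) → Prop := fun 𝓠 => DisjFam 𝓠 ∧ (∀ D ∈ 𝓠, D.card = m') ∧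
      (∀ D ∈ 𝓠, ∃ C ∈ 𝓕, D ⊆ C) ∧ (∀ D ∈ 𝓠, ∀ x ∈ D, ∀ y ∈ D, lab x = lab y)
  obtain ⟨𝓠, h𝓠, hmax⟩ := Finset.exists_max_image (Finset.univ.filter good) Finset.card
    ⟨∅, Finset.mem_filter.2 ⟨Finset.mem_univ _, by simp [good, DisjFam]⟩⟩
  have hgood : good 𝓠 := (Finset.mem_filter.1 h𝓠).2
  have hsmall : ∀ C ∈ 𝓕, ∀ a : α, ((C.filter (fun x => lab x = a)) ∩ uncov 𝓠).card ≤ m' := by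
    intro C hC a
    by_contra hbig
    obtain ⟨D, hD, hDc⟩ := Finset.exists_subset_card_eq (not_le.1 hbig).le
    have hDu : ∀ x ∈ D, ∀ E ∈ 𝓠, x ∉ E := by
      intro x hx
      have := (Finset.mem_inter.1 (hD hx)).2
      simpa [uncov] using this
    have hDa : ∀ x ∈ D, x ∈ C ∧ lab x = a := fun x hx =>
      Finset.mem_filter.1 (Finset.mem_inter.1 (hD hx)).1
    have hDn : D ∉ 𝓠 := by
      intro hDQ
      obtain ⟨x, hx⟩ := Finset.card_pos.1 (hDc ▸ hm')
      exact hDu x hx D hDQ hx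
    have hins : good (insert D 𝓠) := by
      refine ⟨?_, ?_, ?_, ?_⟩
      · intro E hE E' hE' hne
        rw [Finset.mem_insert] at hE hE'
        rcases hE with rfl | hE <;> rcases hE' with rfl | hE'
        · exact (hne rfl).elim
        · exact Finset.disjoint_left.2 (fun x hx => hDu x hx E' hE')
        · exact Finset.disjoint_right.2 (fun x hx => hDu x hx E hE)
        · exact hgood.1 E hE E' hE' hne
      · intro E hE
        rcases Finset.mem_insert.1 hE with rfl | hE
        · exact hDc
        · exact hgood.2.1 E hE
      · intro E hE
        rcases Finset.mem_insert.1 hE with rfl | hE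
        · exact ⟨C, hC, fun x hx => (hDa x hx).1⟩
        · exact hgood.2.2.1 E hE
      · intro E hE
        rcases Finset.mem_insert.1 hE with rfl | hE
        · intro x hx y hy; rw [(hDa x hx).2, (hDa y hy).2]
        · exact hgood.2.2.2 E hE
    have := hmax _ (Finset.mem_filter.2 ⟨Finset.mem_univ _, hins⟩)
    rw [Finset.card_insert_of_notMem hDn] at this
    omega
  refine ⟨𝓠, hgood.1, hgood.2.1, hgood.2.2.1, hgood.2.2.2, ?_⟩
  have hsub : uncov 𝓠 ⊆ uncov 𝓕 ∪ (𝓕 ×ˢ (Finset.univ : Finset α)).biUnion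
      (fun p => (p.1.filter (fun x => lab x = p.2)) ∩ uncov 𝓠) := by
    intro x hx
    by_cases hxP : x ∈ uncov 𝓕
    · exact Finset.mem_union_left _ hxP
    · simp only [uncov, Finset.mem_filter, Finset.mem_univ, true_and, not_forall, not_not] at hxP
      obtain ⟨C, hC, hxC⟩ := hxP
      refine Finset.mem_union_right _ (Finset.mem_biUnion.2 ⟨(C, lab x),
        Finset.mem_product.2 ⟨hC, Finset.mem_univ _⟩, ?_⟩)
      exact Finset.mem_inter.2 ⟨Finset.mem_filter.2 ⟨hxC, rfl⟩, hx⟩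
  refine (Finset.card_le_card hsub).trans ((Finset.card_union_le _ _).trans ?_)
  have := Finset.card_biUnion_le_card_mul (𝓕 ×ˢ (Finset.univ : Finset α))
    (fun p => (p.1.filter (fun x => lab x = p.2)) ∩ uncov 𝓠) m'
    (fun p hp => hsmall p.1 (Finset.mem_product.1 hp).1 p.2)
  rw [Finset.card_product, Finset.card_univ] at this
  omega

variable {r : ℕ} (R : Fin r → V → V → Prop) [∀ c, DecidableRel (R c)]

/-- In some colour, the density drops by more than `ε` on large subsets of `C` and `D`. -/
def Irreg (ε : ℝ) (C D : Finset V) : Prop :=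
  ∃ c, ∃ A ⊆ C, ∃ B ⊆ D, ε * C.card ≤ A.card ∧ ε * D.card ≤ B.card ∧
    (pairs (R c) A B : ℝ) < (pairs (R c) C D / (C.card * D.card) - ε) * (A.card * B.card)

/-- The mean square of the densities between the classes of a partition. -/
noncomputable def energy (𝓕 : Finset (Finset V)) : ℝ :=
  ∑ c, ∑ z : V × V, avg (Prod.map (part 𝓕) (part 𝓕))
    (fun z => if R c z.1 z.2 then (1 : ℝ) else 0) z ^ 2

lemma energy_le (𝓕 : Finset (Finset V)) : energy R 𝓕 ≤ r * (Fintype.card V : ℝ) ^ 2 := by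
  have : ∀ c, ∑ z : V × V, avg (Prod.map (part 𝓕) (part 𝓕))
      (fun z => if R c z.1 z.2 then (1 : ℝ) else 0) z ^ 2 ≤ (Fintype.card V : ℝ) ^ 2 := by
    intro c
    refine (sum_sq_avg_le _ _ (fun z => ?_) (fun z => ?_)).trans (le_of_eq ?_)
    · split_ifs <;> norm_num
    · split_ifs <;> norm_num
    · rw [Fintype.card_prod]; push_cast; ring
  refine (Finset.sum_le_sum (fun c _ => this c)).trans ?_
  simp

lemma avg_part_eq {𝓕 : Finset (Finset V)} (h : DisjFam 𝓕) (c : Fin r) {C D : Finset V}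
    (hC : C ∈ 𝓕) (hD : D ∈ 𝓕) {z : V × V} (hz : z ∈ C ×ˢ D) :
    avg (Prod.map (part 𝓕) (part 𝓕)) (fun z => if R c z.1 z.2 then (1 : ℝ) else 0) z =
      pairs (R c) C D / (C.card * D.card) := by
  have hz' := Finset.mem_product.1 hz
  have hfib : Finset.univ.filter (fun y => Prod.map (part 𝓕) (part 𝓕) y =
      Prod.map (part 𝓕) (part 𝓕) z) = C ×ˢ D := by
    ext y
    simp only [Finset.mem_filter, Finset.mem_univ, true_and, Finset.mem_product, Prod.map,
      Prod.mk.injEq, part_eq_of_mem h hC hz'.1, part_eq_of_mem h hD hz'.2]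
    constructor
    · rintro ⟨h1, h2⟩
      exact ⟨h1 ▸ mem_part_self 𝓕 y.1, h2 ▸ mem_part_self 𝓕 y.2⟩
    · rintro ⟨h1, h2⟩
      exact ⟨part_eq_of_mem h hC h1, part_eq_of_mem h hD h2⟩
  rw [avg, hfib, sum_ind_eq_pairs, Finset.card_product]
  push_cast; rfl

theorem energy_increment {𝓕 𝓠 : Finset (Finset V)} (h : DisjFam 𝓕) (m : ℕ)
    (hm : ∀ C ∈ 𝓕, C.card = m) (href : ∀ D ∈ 𝓠, ∃ C ∈ 𝓕, D ⊆ C)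
    (ε : ℝ) (hε : 0 ≤ ε) (I : Finset (Finset V × Finset V)) (hI : I ⊆ 𝓕 ×ˢ 𝓕)
    (c : Finset V × Finset V → Fin r) (A B : Finset V × Finset V → Finset V)
    (hA : ∀ p ∈ I, A p ⊆ p.1) (hB : ∀ p ∈ I, B p ⊆ p.2)
    (hAc : ∀ p ∈ I, ε * p.1.card ≤ (A p).card) (hBc : ∀ p ∈ I, ε * p.2.card ≤ (B p).card)
    (hlow : ∀ p ∈ I, (pairs (R (c p)) (A p) (B p) : ℝ) <
      (pairs (R (c p)) p.1 p.2 / (p.1.card * p.2.card) - ε) * ((A p).card * (B p).card))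
    (hAQ : ∀ p ∈ I, ∀ Q ∈ 𝓠, ∀ x ∈ Q, ∀ y ∈ Q, x ∈ A p → y ∈ A p)
    (hBQ : ∀ p ∈ I, ∀ Q ∈ 𝓠, ∀ x ∈ Q, ∀ y ∈ Q, x ∈ B p → y ∈ B p) :
    energy R 𝓕 + I.card * (ε ^ 4 * m ^ 2) ≤ energy R 𝓠 := by
  let ind : Fin r → V × V → ℝ := fun c z => if R c z.1 z.2 then (1 : ℝ) else 0
  let Φ := Prod.map (part 𝓕) (part 𝓕)
  let Ψ := Prod.map (part 𝓠) (part 𝓠)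
  have hdiff : energy R 𝓠 - energy R 𝓕 =
      ∑ c, ∑ z : V × V, (avg Ψ (ind c) z - avg Φ (ind c) z) ^ 2 := by
    rw [energy, energy, ← Finset.sum_sub_distrib]
    refine Finset.sum_congr rfl (fun c _ => ?_)
    refine (sum_sq_avg_sub Φ Ψ (ind c) (fun x y hxy => ?_)).symm
    simp only [Ψ, Φ, Prod.map, Prod.mk.injEq] at hxy ⊢
    exact ⟨part_eq_of_refines h href hxy.1, part_eq_of_refines h href hxy.2⟩
  have hcl : ∀ (T : Finset V), (∀ Q ∈ 𝓠, ∀ x ∈ Q, ∀ y ∈ Q, x ∈ T → y ∈ T) →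
      ∀ x y, part 𝓠 x = part 𝓠 y → x ∈ T → y ∈ T := by
    intro T hT x y hxy hx
    rcases eq_or_mem_of_part_eq hxy with rfl | ⟨D, hD, hxD, hyD⟩
    · exact hx
    · exact hT D hD x hxD y hyD hx
  have hone : ∀ p ∈ I, ε ^ 4 * (m : ℝ) ^ 2 ≤ ∑ z ∈ A p ×ˢ B p,
      ∑ c', (avg Ψ (ind c') z - avg Φ (ind c') z) ^ 2 := by
    intro p hp
    have hp12 := Finset.mem_product.1 (hI hp)
    have h1 := le_sum_sq_avg_sub Φ Ψ (ind (c p)) (A p ×ˢ B p)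
      (fun x y hxy hx => by
        simp only [Ψ, Prod.map, Prod.mk.injEq] at hxy
        rw [Finset.mem_product] at hx ⊢
        exact ⟨hcl _ (hAQ p hp) _ _ hxy.1 hx.1, hcl _ (hBQ p hp) _ _ hxy.2 hx.2⟩)
      (pairs (R (c p)) p.1 p.2 / (p.1.card * p.2.card)) ε
      (fun z hz => avg_part_eq R h (c p) hp12.1 hp12.2
        (Finset.product_subset_product (hA p hp) (hB p hp) hz)) hε
      (by
        simp only [ind]
        rw [sum_ind_eq_pairs, Finset.card_product]
        push_cast
        exact (hlow p hp).le)
    have h2 : ∑ z ∈ A p ×ˢ B p, (avg Ψ (ind (c p)) z - avg Φ (ind (c p)) z) ^ 2 ≤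
        ∑ z ∈ A p ×ˢ B p, ∑ c', (avg Ψ (ind c') z - avg Φ (ind c') z) ^ 2 :=
      Finset.sum_le_sum (fun z _ => Finset.single_le_sum
        (f := fun c' => (avg Ψ (ind c') z - avg Φ (ind c') z) ^ 2)
        (fun c' _ => sq_nonneg _) (Finset.mem_univ (c p)))
    refine le_trans ?_ (h1.trans h2)
    have h3 := hAc p hp
    have h4 := hBc p hp
    rw [hm _ hp12.1] at h3
    rw [hm _ hp12.2] at h4
    have h5 : (ε * m) * (ε * m) ≤ ((A p).card : ℝ) * (B p).card :=
      mul_le_mul h3 h4 (by positivity) (by positivity)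
    rw [Finset.card_product]
    push_cast
    nlinarith [mul_le_mul_of_nonneg_left h5 (sq_nonneg ε)]
  have hsum : ∑ p ∈ I, ∑ z ∈ A p ×ˢ B p, ∑ c', (avg Ψ (ind c') z - avg Φ (ind c') z) ^ 2 ≤
      ∑ z : V × V, ∑ c', (avg Ψ (ind c') z - avg Φ (ind c') z) ^ 2 := by
    rw [← Finset.sum_biUnion]
    · exact Finset.sum_le_sum_of_subset_of_nonneg (Finset.subset_univ _)
        (fun z _ _ => Finset.sum_nonneg (fun c' _ => sq_nonneg _))
    · intro p hp p' hp' hne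
      rw [Function.onFun, Finset.disjoint_left]
      intro z hz hz'
      rw [Finset.mem_product] at hz hz'
      have hpI := Finset.mem_product.1 (hI hp)
      have hpI' := Finset.mem_product.1 (hI hp')
      exact hne (Prod.ext (h.eq_of_mem hpI.1 hpI'.1 (hA p hp hz.1) (hA p' hp' hz'.1))
        (h.eq_of_mem hpI.2 hpI'.2 (hB p hp hz.2) (hB p' hp' hz'.2)))
  have hle := Finset.sum_le_sum hone
  rw [Finset.sum_const, nsmul_eq_mul] at hle
  rw [Finset.sum_comm] at hdiff
  linarith

end regularity

open Classical in
/-- The irregular pairs in a family. -/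
noncomputable def irregPairs [Fintype V] [DecidableEq V] {r : ℕ} (R : Fin r → V → V → Prop)
    [∀ c, DecidableRel (R c)] (ε : ℝ) (𝓕 : Finset (Finset V)) : Finset (Finset V × Finset V) :=
  (𝓕 ×ˢ 𝓕).filter (fun p => Irreg R ε p.1 p.2)

section iteration
variable [Fintype V] [DecidableEq V]

lemma card_mul_add_card_uncov {𝓕 : Finset (Finset V)} (h : DisjFam 𝓕) {m : ℕ}
    (hm : ∀ C ∈ 𝓕, C.card = m) : 𝓕.card * m + (uncov 𝓕).card = Fintype.card V := by
  have h1 : (𝓕.biUnion id).card = 𝓕.card * m := by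
    rw [Finset.card_biUnion (t := id) (fun C hC D hD hne => h C hC D hD hne)]
    simp only [id]
    rw [Finset.sum_congr rfl hm, Finset.sum_const, smul_eq_mul]
  have h2 : uncov 𝓕 = Finset.univ \ 𝓕.biUnion id := by
    ext x; simp [uncov]
  have h3 := Finset.card_sdiff_of_subset (Finset.subset_univ (𝓕.biUnion id))
  have h4 := Finset.card_le_univ (𝓕.biUnion id)
  rw [h2, h3, Finset.card_univ, ← h1]
  omega

lemma energy_nonneg {r : ℕ} (R : Fin r → V → V → Prop) [∀ c, DecidableRel (R c)]
    (𝓕 : Finset (Finset V)) : 0 ≤ energy R 𝓕 :=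
  Finset.sum_nonneg (fun _ _ => Finset.sum_nonneg (fun _ _ => sq_nonneg _))

lemma regularity_step {r : ℕ} (R : Fin r → V → V → Prop) [∀ c, DecidableRel (R c)]
    (ε : ℝ) (hε : 0 ≤ ε) {𝓕 : Finset (Finset V)} (h : DisjFam 𝓕) (m : ℕ)
    (hm : ∀ C ∈ 𝓕, C.card = m) (m' : ℕ) (hm' : 0 < m') :
    ∃ 𝓠 : Finset (Finset V), DisjFam 𝓠 ∧ (∀ D ∈ 𝓠, D.card = m') ∧
      (∀ D ∈ 𝓠, ∃ C ∈ 𝓕, D ⊆ C) ∧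
      (uncov 𝓠).card ≤ (uncov 𝓕).card + 𝓕.card * 4 ^ 𝓕.card ^ 2 * m' ∧
      energy R 𝓕 + (irregPairs R ε 𝓕).card * (ε ^ 4 * m ^ 2) ≤ energy R 𝓠 := by
  classical
  have hex : ∀ p : Finset V × Finset V, ∃ w : Finset V × Finset V, p ∈ irregPairs R ε 𝓕 →
      ∃ c : Fin r, w.1 ⊆ p.1 ∧ w.2 ⊆ p.2 ∧ ε * p.1.card ≤ w.1.card ∧ ε * p.2.card ≤ w.2.card ∧
        (pairs (R c) w.1 w.2 : ℝ) <
          (pairs (R c) p.1 p.2 / (p.1.card * p.2.card) - ε) * (w.1.card * w.2.card) := by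
    intro p
    by_cases hp : p ∈ irregPairs R ε 𝓕
    · obtain ⟨c, A, hA, B, hB, h1, h2, h3⟩ := (Finset.mem_filter.1 hp).2
      exact ⟨(A, B), fun _ => ⟨c, hA, hB, h1, h2, h3⟩⟩
    · exact ⟨(∅, ∅), fun hp' => (hp hp').elim⟩
  choose w hw using hex
  let lab : V → (↥(𝓕 ×ˢ 𝓕) → Bool × Bool) := fun x p =>
    (decide (x ∈ (w p).1), decide (x ∈ (w p).2))
  obtain ⟨𝓠, hd, hc, href, hlab, hunc⟩ := exists_chop 𝓕 lab m' hm'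
  refine ⟨𝓠, hd, hc, href, ?_, ?_⟩
  · have : Fintype.card (↥(𝓕 ×ˢ 𝓕) → Bool × Bool) = 4 ^ 𝓕.card ^ 2 := by
      rw [Fintype.card_fun, Fintype.card_coe, Finset.card_product, Fintype.card_prod,
        Fintype.card_bool, ← sq 𝓕.card]
    rwa [this] at hunc
  · by_cases hr : Nonempty (Fin r)
    · have hex2 : ∀ p : Finset V × Finset V, ∃ c : Fin r, p ∈ irregPairs R ε 𝓕 →
          (w p).1 ⊆ p.1 ∧ (w p).2 ⊆ p.2 ∧ ε * p.1.card ≤ (w p).1.card ∧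
          ε * p.2.card ≤ (w p).2.card ∧ (pairs (R c) (w p).1 (w p).2 : ℝ) <
          (pairs (R c) p.1 p.2 / (p.1.card * p.2.card) - ε) *
            ((w p).1.card * (w p).2.card) := by
        intro p
        by_cases hp : p ∈ irregPairs R ε 𝓕
        · obtain ⟨c, hc⟩ := hw p hp
          exact ⟨c, fun _ => hc⟩
        · exact ⟨hr.some, fun hp' => (hp hp').elim⟩
      choose c hcol using hex2
      have hsub : irregPairs R ε 𝓕 ⊆ 𝓕 ×ˢ 𝓕 := Finset.filter_subset _ _
      refine energy_increment R h m hm href ε hε (irregPairs R ε 𝓕) hsub c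
        (fun p => (w p).1) (fun p => (w p).2) (fun p hp => (hcol p hp).1)
        (fun p hp => (hcol p hp).2.1) (fun p hp => (hcol p hp).2.2.1)
        (fun p hp => (hcol p hp).2.2.2.1) (fun p hp => (hcol p hp).2.2.2.2) ?_ ?_
      · intro p hp Q hQ x hx y hy hxA
        have := congrArg Prod.fst (congrFun (hlab Q hQ x hx y hy) ⟨p, hsub hp⟩)
        simp only [lab, decide_eq_decide] at this
        exact this.1 hxA
      · intro p hp Q hQ x hx y hy hxA
        have := congrArg Prod.snd (congrFun (hlab Q hQ x hx y hy) ⟨p, hsub hp⟩)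
        simp only [lab, decide_eq_decide] at this
        exact this.1 hxA
    · have h0 : irregPairs R ε 𝓕 = ∅ := by
        rw [Finset.eq_empty_iff_forall_notMem]
        intro p hp
        obtain ⟨c, -⟩ := hw p hp
        exact hr ⟨c⟩
      have hr0 : IsEmpty (Fin r) := not_nonempty_iff.1 hr
      simp [h0, energy]

end iteration

lemma regularity_iterate (r : ℕ) (ε : ℝ) (hε : 0 ≤ ε) (Q : ℕ) (hQ : 0 < Q) (t : ℕ)
    (ht : 2 * t ≤ Q) :
    ∃ K n₀ : ℕ, 0 < K ∧ ∀ (V : Type) [Fintype V] [DecidableEq V], n₀ ≤ Fintype.card V →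
      ∀ (R : Fin r → V → V → Prop) [∀ c, DecidableRel (R c)] (side : V → Bool),
      ∃ (𝓕 : Finset (Finset V)) (m : ℕ), 0 < m ∧ (∀ C ∈ 𝓕, C.card = m) ∧ DisjFam 𝓕 ∧
        (∀ C ∈ 𝓕, ∀ x ∈ C, ∀ y ∈ C, side x = side y) ∧ Fintype.card V ≤ K * m ∧
        m * Q ≤ Fintype.card V ∧ Q * (uncov 𝓕).card ≤ (t + 1) * Fintype.card V ∧
        (((irregPairs R ε 𝓕).card : ℝ) ≤ ε * (𝓕.card : ℝ) ^ 2 ∨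
          t * (ε ^ 5 / 4) * (Fintype.card V : ℝ) ^ 2 ≤ energy R 𝓕) := by
  induction t with
  | zero =>
    refine ⟨4 * Q, 2 * Q, by omega, ?_⟩
    intro V _ _ hn R _ side
    have hm' : 0 < Fintype.card V / (2 * Q) := Nat.div_pos hn (by omega)
    have h1 : 2 * Q * (Fintype.card V / (2 * Q)) ≤ Fintype.card V := Nat.mul_div_le _ _
    have h2 : Fintype.card V < 2 * Q * (Fintype.card V / (2 * Q) + 1) := by
      have := Nat.lt_div_mul_add (a := Fintype.card V) (b := 2 * Q) (by omega)
      nlinarith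
    obtain ⟨𝓠, hd, hc, -, hlab, hunc⟩ := exists_chop {Finset.univ} side _ hm'
    have h3 : uncov ({Finset.univ} : Finset (Finset V)) = ∅ := by
      simp [uncov]
    rw [h3, Finset.card_empty, Finset.card_singleton, Fintype.card_bool] at hunc
    refine ⟨𝓠, _, hm', hc, hd, hlab, ?_, ?_, ?_, Or.inr ?_⟩
    · nlinarith
    · nlinarith
    · nlinarith
    · have := energy_nonneg R 𝓠
      simpa using this
  | succ t ih =>
    obtain ⟨K, n₀, hK, hmain⟩ := ih (by omega)
    set D := Q * 4 ^ K ^ 2 with hD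
    have hD0 : 0 < D := by positivity
    refine ⟨2 * K * D, max n₀ (K * D), by positivity, ?_⟩
    intro V _ _ hn R _ side
    obtain ⟨𝓕, m, hm, hc, hd, hside, hKm, hmQ, hunc, hreg⟩ :=
      hmain V (le_trans (le_max_left _ _) hn) R side
    by_cases hregular : ((irregPairs R ε 𝓕).card : ℝ) ≤ ε * (𝓕.card : ℝ) ^ 2
    · refine ⟨𝓕, m, hm, hc, hd, hside, ?_, hmQ, by nlinarith, Or.inl hregular⟩
      calc Fintype.card V ≤ K * m := hKm
        _ ≤ 2 * K * D * m := by
          refine Nat.mul_le_mul_right _ ?_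
          nlinarith
    · have hDm : D ≤ m := by
        have : K * D ≤ K * m := (le_trans (le_max_right _ _) hn).trans hKm
        exact Nat.le_of_mul_le_mul_left this hK
      have hm' : 0 < m / D := Nat.div_pos hDm hD0
      have h1 : D * (m / D) ≤ m := Nat.mul_div_le _ _
      have h2 : m < D * (m / D + 1) := by
        have := Nat.lt_div_mul_add (a := m) (b := D) hD0
        nlinarith
      have h2' : m ≤ 2 * D * (m / D) := by nlinarith
      obtain ⟨𝓠, hd', hc', href, hunc', hen⟩ := regularity_step R ε hε hd m hc _ hm'
      have hcov := card_mul_add_card_uncov hd hc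
      have hFK : 𝓕.card ≤ K := by
        have : 𝓕.card * m ≤ K * m := by omega
        exact Nat.le_of_mul_le_mul_right this hm
      refine ⟨𝓠, m / D, hm', hc', hd', ?_, ?_, ?_, ?_, Or.inr ?_⟩
      · intro E hE x hx y hy
        obtain ⟨C, hC, hEC⟩ := href E hE
        exact hside C hC x (hEC hx) y (hEC hy)
      · calc Fintype.card V ≤ K * m := hKm
          _ ≤ K * (2 * D * (m / D)) := Nat.mul_le_mul_left _ h2'
          _ = 2 * K * D * (m / D) := by ring
      · exact le_trans (Nat.mul_le_mul_right _ (Nat.div_le_self _ _)) hmQ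
      · have h3 : 4 ^ 𝓕.card ^ 2 ≤ 4 ^ K ^ 2 :=
          Nat.pow_le_pow_right (by norm_num) (Nat.pow_le_pow_left hFK 2)
        have h4 : Q * (𝓕.card * 4 ^ 𝓕.card ^ 2 * (m / D)) ≤ 𝓕.card * m := by
          calc Q * (𝓕.card * 4 ^ 𝓕.card ^ 2 * (m / D))
              ≤ Q * (𝓕.card * 4 ^ K ^ 2 * (m / D)) := by gcongr
            _ = 𝓕.card * (D * (m / D)) := by rw [hD]; ring
            _ ≤ 𝓕.card * m := Nat.mul_le_mul_left _ h1
        have h5 := Nat.mul_le_mul_left Q hunc'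
        rw [Nat.mul_add] at h5
        have h6 : (t + 1 + 1) * Fintype.card V = (t + 1) * Fintype.card V + Fintype.card V := by
          ring
        omega
      · rcases hreg with hreg | hreg
        · exact (hregular hreg).elim
        · push Not at hregular
          have h7 : Fintype.card V ≤ 2 * (𝓕.card * m) := by
            have : 2 * (t + 1) * (uncov 𝓕).card ≤ (t + 1) * Fintype.card V :=
              le_trans (Nat.mul_le_mul_right _ ht) hunc
            have h8 : 2 * (uncov 𝓕).card ≤ Fintype.card V :=
              Nat.le_of_mul_le_mul_left (by linarith) (Nat.succ_pos t)
            omega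
          have h7' : (Fintype.card V : ℝ) ≤ 2 * (𝓕.card * m) := by exact_mod_cast h7
          have h9 : (Fintype.card V : ℝ) ^ 2 ≤ 4 * (𝓕.card * m) ^ 2 := by
            have := pow_le_pow_left₀ (by positivity) h7' 2
            linarith
          have h10 : ε * (𝓕.card : ℝ) ^ 2 * (ε ^ 4 * m ^ 2) ≤
              (irregPairs R ε 𝓕).card * (ε ^ 4 * m ^ 2) :=
            mul_le_mul_of_nonneg_right hregular.le (by positivity)
          have h11 : ε ^ 5 / 4 * (Fintype.card V : ℝ) ^ 2 ≤
              ε * (𝓕.card : ℝ) ^ 2 * (ε ^ 4 * m ^ 2) := by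
            have := mul_le_mul_of_nonneg_left h9 (show 0 ≤ ε ^ 5 / 4 by positivity)
            linarith
          push_cast
          linarith

lemma Irreg.mono {r : ℕ} {R : Fin r → V → V → Prop} [∀ c, DecidableRel (R c)] {ε ε' : ℝ}
    (h : ε' ≤ ε) {C D : Finset V} (hI : Irreg R ε C D) : Irreg R ε' C D := by
  obtain ⟨c, A, hA, B, hB, h1, h2, h3⟩ := hI
  refine ⟨c, A, hA, B, hB, le_trans (mul_le_mul_of_nonneg_right h (by positivity)) h1,
    le_trans (mul_le_mul_of_nonneg_right h (by positivity)) h2, h3.trans_le ?_⟩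
  exact mul_le_mul_of_nonneg_right (by linarith) (by positivity)

section post
variable [Fintype V] [DecidableEq V]

open Classical in
/-- The members of `𝓕` forming an irregular pair with `C`, in either order. -/
noncomputable def irregNbrs {r : ℕ} (R : Fin r → V → V → Prop)
    [∀ c, DecidableRel (R c)] (ε : ℝ) (𝓕 : Finset (Finset V)) (C : Finset V) :
    Finset (Finset V) :=
  𝓕.filter (fun D => Irreg R ε C D ∨ Irreg R ε D C)

lemma sum_card_irregNbrs_le {r : ℕ} (R : Fin r → V → V → Prop)
    [∀ c, DecidableRel (R c)] (ε : ℝ) (𝓕 : Finset (Finset V)) :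
    ∑ C ∈ 𝓕, (irregNbrs R ε 𝓕 C).card ≤ 2 * (irregPairs R ε 𝓕).card := by
  classical
  have h1 : ∑ C ∈ 𝓕, (𝓕.filter (fun D => Irreg R ε C D)).card = (irregPairs R ε 𝓕).card := by
    rw [irregPairs, Finset.card_filter, Finset.sum_product]
    exact Finset.sum_congr rfl (fun C _ => Finset.card_filter _ _)
  have h2 : ∑ C ∈ 𝓕, (𝓕.filter (fun D => Irreg R ε D C)).card = (irregPairs R ε 𝓕).card := by
    rw [irregPairs, Finset.card_filter, Finset.sum_product_right]
    exact Finset.sum_congr rfl (fun C _ => Finset.card_filter _ _)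
  rw [two_mul]
  nth_rewrite 1 [← h1]
  rw [← h2, ← Finset.sum_add_distrib]
  refine Finset.sum_le_sum (fun C _ => ?_)
  rw [irregNbrs, Finset.filter_or]
  exact Finset.card_union_le _ _

end post

/-- A form of the regularity lemma: up to a few vertices, the vertex set splits into equally large
clusters respecting a given bipartition, each in few irregular pairs. -/
theorem exists_regular_family (r : ℕ) (ε : ℝ) (hε : 0 < ε) (hε1 : ε ≤ 1) :
    ∃ K n₀ : ℕ, 0 < K ∧ ∀ (V : Type) [Fintype V] [DecidableEq V], n₀ ≤ Fintype.card V →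
      ∀ (R : Fin r → V → V → Prop) [∀ c, DecidableRel (R c)] (side : V → Bool),
      ∃ (𝓕 : Finset (Finset V)) (m : ℕ), 0 < m ∧ (∀ C ∈ 𝓕, C.card = m) ∧ DisjFam 𝓕 ∧
        (∀ C ∈ 𝓕, ∀ x ∈ C, ∀ y ∈ C, side x = side y) ∧ Fintype.card V ≤ K * m ∧
        (m : ℝ) ≤ ε * Fintype.card V ∧ ((uncov 𝓕).card : ℝ) ≤ ε * Fintype.card V ∧
        ∀ C ∈ 𝓕, (m : ℝ) * (irregNbrs R ε 𝓕 C).card ≤ ε * Fintype.card V := by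
  set ε₀ := ε ^ 2 / 4 with hε₀
  have hε₀pos : 0 < ε₀ := by positivity
  obtain ⟨T, hT⟩ := exists_nat_gt (r / (ε₀ ^ 5 / 4))
  obtain ⟨Q₁, hQ₁⟩ := exists_nat_gt (2 * (T + 1) / ε)
  set Q := 2 * T + 1 + Q₁ with hQ
  obtain ⟨K, n₀, hK, hmain⟩ := regularity_iterate r ε₀ hε₀pos.le Q (by omega) T (by omega)
  refine ⟨K, max n₀ 1, hK, ?_⟩
  intro V _ _ hn R _ side
  obtain ⟨𝓕, m, hm, hc, hd, hside, hKm, hmQ, hunc, hreg⟩ :=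
    hmain V (le_trans (le_max_left _ _) hn) R side
  set n := Fintype.card V with hndef
  have hn1 : (1 : ℝ) ≤ n := by exact_mod_cast le_trans (le_max_right _ _) hn
  have hI : ((irregPairs R ε₀ 𝓕).card : ℝ) ≤ ε₀ * (𝓕.card : ℝ) ^ 2 := by
    rcases hreg with h | h
    · exact h
    · exfalso
      have h1 := energy_le R 𝓕
      rw [div_lt_iff₀ (by positivity)] at hT
      have h2 : (0 : ℝ) < (n : ℝ) ^ 2 := by positivity
      have h3 := mul_lt_mul_of_pos_right hT h2
      linarith
  have hQε : 2 * ((T : ℝ) + 1) ≤ ε * Q := by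
    rw [div_lt_iff₀ hε] at hQ₁
    have : (Q₁ : ℝ) ≤ Q := by exact_mod_cast (by omega : Q₁ ≤ Q)
    nlinarith
  have hQpos : (0 : ℝ) < Q := by exact_mod_cast (by omega : 0 < Q)
  have hunc1 : ((uncov 𝓕).card : ℝ) ≤ ε / 2 * n := by
    have h1 : (Q : ℝ) * (uncov 𝓕).card ≤ (T + 1) * n := by exact_mod_cast hunc
    have h2 : (T + 1 : ℝ) * n ≤ ε / 2 * Q * n :=
      mul_le_mul_of_nonneg_right (by linarith) (by positivity)
    refine le_of_mul_le_mul_left ?_ hQpos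
    linarith
  have hmε : (m : ℝ) ≤ ε * n := by
    have h1 : (m : ℝ) * Q ≤ n := by exact_mod_cast hmQ
    have h2 : (1 : ℝ) ≤ ε * Q := by
      have : (0 : ℝ) ≤ T := Nat.cast_nonneg _
      linarith
    have h3 : (n : ℝ) ≤ ε * Q * n := by nlinarith
    refine le_of_mul_le_mul_right ?_ hQpos
    linarith
  classical
  let good : Finset V → Prop := fun C => ((irregNbrs R ε₀ 𝓕 C).card : ℝ) ≤ ε * 𝓕.card
  let 𝓠 := 𝓕.filter good
  have hsub : 𝓠 ⊆ 𝓕 := Finset.filter_subset _ _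
  have hbad : ((𝓕.filter (fun C => ¬ good C)).card : ℝ) ≤ ε / 2 * 𝓕.card := by
    have h1 : ((𝓕.filter (fun C => ¬ good C)).card : ℝ) * (ε * 𝓕.card) ≤
        ∑ C ∈ 𝓕, ((irregNbrs R ε₀ 𝓕 C).card : ℝ) := by
      rw [← nsmul_eq_mul]
      refine le_trans (Finset.card_nsmul_le_sum _ (fun C => ((irregNbrs R ε₀ 𝓕 C).card : ℝ)) _
        (fun C hC => ?_)) (Finset.sum_le_sum_of_subset_of_nonneg (Finset.filter_subset _ _)
        (fun _ _ _ => Nat.cast_nonneg _))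
      exact (not_le.1 (Finset.mem_filter.1 hC).2).le
    have h2 : ∑ C ∈ 𝓕, ((irregNbrs R ε₀ 𝓕 C).card : ℝ) ≤ 2 * (irregPairs R ε₀ 𝓕).card := by
      exact_mod_cast sum_card_irregNbrs_le R ε₀ 𝓕
    rcases Nat.eq_zero_or_pos 𝓕.card with h0 | hpos
    · have := Finset.card_filter_le 𝓕 (fun C => ¬ good C)
      have h3 : (𝓕.filter (fun C => ¬ good C)).card = 0 := by omega
      rw [h3, h0]; simp
    · have hpos' : (0 : ℝ) < ε * 𝓕.card := mul_pos hε (by exact_mod_cast hpos)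
      refine le_of_mul_le_mul_right ?_ hpos'
      rw [hε₀] at hI
      linarith
  have hd' : DisjFam 𝓠 := fun C hC D hD => hd C (hsub hC) D (hsub hD)
  have hc' : ∀ C ∈ 𝓠, C.card = m := fun C hC => hc C (hsub hC)
  have e1 := card_mul_add_card_uncov hd hc
  have e2 := card_mul_add_card_uncov hd' hc'
  have e3 : 𝓠.card + (𝓕.filter (fun C => ¬ good C)).card = 𝓕.card :=
    Finset.card_filter_add_card_filter_not _
  have e1' : (𝓕.card : ℝ) * m + (uncov 𝓕).card = n := by exact_mod_cast e1
  have e2' : (𝓠.card : ℝ) * m + (uncov 𝓠).card = n := by exact_mod_cast e2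
  have e3' : (𝓠.card : ℝ) + (𝓕.filter (fun C => ¬ good C)).card = 𝓕.card := by exact_mod_cast e3
  have hFn : (𝓕.card : ℝ) * m ≤ n := by
    have : (0 : ℝ) ≤ (uncov 𝓕).card := Nat.cast_nonneg _
    linarith
  refine ⟨𝓠, m, hm, hc', hd', fun C hC => hside C (hsub hC), hKm, hmε, ?_, ?_⟩
  · have h1 := mul_le_mul_of_nonneg_right hbad (Nat.cast_nonneg (α := ℝ) m)
    have h2 : ε / 2 * 𝓕.card * m ≤ ε / 2 * n := by
      rw [mul_assoc]; exact mul_le_mul_of_nonneg_left hFn (by positivity)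
    nlinarith
  · intro C hC
    have h1 : ((irregNbrs R ε₀ 𝓕 C).card : ℝ) ≤ ε * 𝓕.card := (Finset.mem_filter.1 hC).2
    have h2 : irregNbrs R ε 𝓠 C ⊆ irregNbrs R ε₀ 𝓕 C := by
      intro D hD
      have hle : ε₀ ≤ ε := by rw [hε₀]; nlinarith
      have := Finset.mem_filter.1 hD
      exact Finset.mem_filter.2 ⟨hsub this.1, this.2.imp (Irreg.mono hle) (Irreg.mono hle)⟩
    have h3 : ((irregNbrs R ε 𝓠 C).card : ℝ) ≤ (irregNbrs R ε₀ 𝓕 C).card := by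
      exact_mod_cast Finset.card_le_card h2
    have hm0 : (0 : ℝ) ≤ m := Nat.cast_nonneg _
    calc (m : ℝ) * (irregNbrs R ε 𝓠 C).card ≤ m * (ε * 𝓕.card) :=
          mul_le_mul_of_nonneg_left (h3.trans h1) hm0
      _ = ε * (𝓕.card * m) := by ring
      _ ≤ ε * n := mul_le_mul_of_nonneg_left hFn hε.le

set_option maxHeartbeats 1000000 in
theorem exists_partition_of_reduced {r : ℕ} (hr : 1 ≤ r) {ι κ : Type*} [Fintype V] [DecidableEq V]
    [Nonempty V] [Fintype ι] [DecidableEq ι] [Fintype κ] [DecidableEq κ]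
    (G : SimpleGraph V) (col : Sym2 V → Fin r)
    (R : Fin r → V → V → Prop) [∀ c, DecidableRel (R c)]
    (hR : ∀ c u v, R c u v ↔ G.Adj u v ∧ col s(u, v) = c)
    (cl : ι → Finset V) (hcl : ∀ i j, i ≠ j → Disjoint (cl i) (cl j)) (m : ℕ)
    (hm : ∀ i, (cl i).card = m) (Γ : Fin r → SimpleGraph ι) (P : ℕ) (hP : 1000 ≤ P)
    (ν ε : ℝ) (hν : 0 < ν) (hν1 : ν ≤ 1 / 1000)
    (hε : ε * (10 ^ 9 * (P : ℝ) ^ 2 * r ^ 2) = ν)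
    (hG : ∀ c i j, (Γ c).Adj i j → HalfGood (R c) (cl i) (cl j) ⌈ε * m⌉₊ P)
    (H : ι → ι → Prop) [DecidableRel H] (colr : ι → ι → Fin r)
    (hH : ∀ i j, H i j → (Γ (colr i j)).Adj i j) (key : ι → ι → κ)
    (hkey : ∀ i j i' j', H i j → H i' j' → key i j = key i' j' →
      colr i j = colr i' j' ∧ (Γ (colr i j)).Reachable j j')
    (σ : Equiv.Perm ι) (hσ : ∀ i, H i (σ i))
    (side : V → ℤ) (hside1 : ∀ v, |side v| ≤ 1) (hside : ∀ u v, G.Adj u v → side u + side v = 0)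
    (hside0 : ∑ v, side v = 0) (sd : ι → ℤ) (hsd : ∀ i, ∀ v ∈ cl i, side v = sd i)
    (hsd0 : ∑ i, sd i = 0)
    (hdist : ∀ U K q : ℕ, ((K + q + 2 * Fintype.card ι + 5 : ℕ) : ℝ) * 16 ≤ ν * U →
      Distributes H sd U K q)
    (hδ : ∀ z, (Fintype.card V : ℝ) / 40 ≤ (Finset.univ.filter (fun x => ∃ c, R c z x)).card)
    (hunc : ((Finset.univ \ Finset.univ.biUnion cl).card : ℝ) ≤ 2 * ε * Fintype.card V)
    (hNm : Fintype.card ι * m ≤ Fintype.card V) (hN : 0 < Fintype.card ι)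
    (hlarge : (((Fintype.card ι + Fintype.card ι ^ 2) * (Fintype.card ι + 3) +
      P * (Fintype.card ι + 100) + 42 * r ^ 2 : ℕ) : ℝ) ≤ ε * m) :
    ∃ k ≤ Fintype.card κ + 84 * r ^ 2 + 2, MonoCyclePartition G col k := by
  set N := Fintype.card ι with hNdef
  set n := Fintype.card V with hndef
  set s := ⌈ε * m⌉₊ with hsdef
  set y := ε * m with hy
  set τ := (N + N ^ 2) * (N + 3) with hτ
  have hP' : (1000 : ℝ) ≤ P := by exact_mod_cast hP
  have hr' : (1 : ℝ) ≤ r := by exact_mod_cast hr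
  have hN' : (1 : ℝ) ≤ N := by exact_mod_cast hN
  have hNm' : (N : ℝ) * m ≤ n := by exact_mod_cast hNm
  have hm0 : (0 : ℝ) ≤ m := Nat.cast_nonneg _
  have hεpos : 0 < ε := by
    by_contra hneg
    have : ε * (10 ^ 9 * (P : ℝ) ^ 2 * r ^ 2) ≤ 0 :=
      mul_nonpos_of_nonpos_of_nonneg (not_lt.1 hneg) (by positivity)
    linarith
  have hlarge' : (τ : ℝ) + P * (N + 100) + 42 * r ^ 2 ≤ y := by
    have := hlarge
    push_cast at this ⊢
    exact this
  have hτ0 : (0 : ℝ) ≤ τ := Nat.cast_nonneg _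
  have hPN : (P : ℝ) * 100 ≤ P * (N + 100) := by nlinarith only [hP', hN']
  have hPN2 : (N : ℝ) ≤ P * N := by nlinarith only [hP', hN']
  have hr2 : (1 : ℝ) ≤ (r : ℝ) ^ 2 := by nlinarith only [hr']
  have hrr : (r : ℝ) ≤ (r : ℝ) ^ 2 := by nlinarith only [hr']
  have hy1 : 100000 ≤ y := by linarith
  have hs1 : y ≤ s := Nat.le_ceil _
  have hs2 : (s : ℝ) ≤ 2 * y := by
    have := (Nat.ceil_lt_add_one (by linarith : 0 ≤ y)).le
    linarith
  have hy0 : 0 ≤ y := by linarith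
  -- the products of `y` with powers of `P` and `r`
  set X := (P : ℝ) ^ 2 * r ^ 2 * y with hX
  have hνm : ν * m = 10 ^ 9 * X := by rw [hX, hy, ← hε]; ring
  have hmX : 10 ^ 12 * X ≤ m := by
    have := mul_le_mul_of_nonneg_right hν1 hm0
    linarith
  have hPy : 1000 * y ≤ P * y := mul_le_mul_of_nonneg_right hP' hy0
  have hPPy : 1000 * (P * y) ≤ (P : ℝ) ^ 2 * y := by
    have := mul_le_mul_of_nonneg_right hP' (by positivity : (0 : ℝ) ≤ P * y)
    linarith
  have hPPX : (P : ℝ) ^ 2 * y ≤ X := by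
    have := mul_le_mul_of_nonneg_left hr2 (by positivity : (0 : ℝ) ≤ (P : ℝ) ^ 2 * y)
    linarith
  set Z := (P : ℝ) * r ^ 2 * y with hZ
  have hPyZ : (P : ℝ) * y ≤ Z := by
    have := mul_le_mul_of_nonneg_left hr2 (by positivity : (0 : ℝ) ≤ (P : ℝ) * y)
    linarith
  have hZX : (P : ℝ) * Z = X := by rw [hZ, hX]; ring
  have hZX' : 1000 * Z ≤ X := by
    rw [← hZX]; exact mul_le_mul_of_nonneg_right hP' (by positivity)
  have hry : (r : ℝ) ^ 2 * 1000 ≤ Z := by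
    rw [hZ]
    have h1 : (1000 : ℝ) ≤ P * y := by linarith only [hPy, hy1]
    have h2 := mul_le_mul_of_nonneg_left h1 (sq_nonneg (r : ℝ))
    linarith only [h2]
  have hmn : (m : ℝ) ≤ n := by nlinarith only [hN', hm0, hNm']
  have hn0 : (0 : ℝ) ≤ n := Nat.cast_nonneg _
  have hYN : y * N ≤ ε * n := by
    have := mul_le_mul_of_nonneg_left hNm' hεpos.le
    rw [hy]; linarith
  have hyn : y ≤ ε * n := by nlinarith only [hYN, hN', hy0]
  set w := P * (22 * s + 20) with hw
  have hPs : (P : ℝ) * s ≤ 2 * (P * y) := by nlinarith only [hs2, hP']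
  have hPs' : (P : ℝ) * y ≤ P * s := by nlinarith only [hs1, hP']
  have hPPs : (P : ℝ) ^ 2 * s ≤ 2 * ((P : ℝ) ^ 2 * y) := by
    have := mul_le_mul_of_nonneg_left hs2 (sq_nonneg (P : ℝ))
    linarith only [this]
  have hw' : (w : ℝ) ≤ 64 * (P * y) := by
    rw [hw]; push_cast; nlinarith only [hPs, hy1, hP']
  set L := 10 ^ 5 * P * r ^ 2 * s with hL
  have hL1 : 10 ^ 5 * Z ≤ L := by
    have : (10 ^ 5 * (P : ℝ) * r ^ 2) * y ≤ (10 ^ 5 * (P : ℝ) * r ^ 2) * s :=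
      mul_le_mul_of_nonneg_left hs1 (by positivity)
    rw [hL, hZ]; push_cast; linarith
  have hL2 : (L : ℝ) ≤ 2 * 10 ^ 5 * Z := by
    have : (10 ^ 5 * (P : ℝ) * r ^ 2) * s ≤ (10 ^ 5 * (P : ℝ) * r ^ 2) * (2 * y) :=
      mul_le_mul_of_nonneg_left hs2 (by positivity)
    rw [hL, hZ]; push_cast; linarith
  set zb := (Finset.univ \ Finset.univ.biUnion cl).card + 2 * s * N with hzb
  have hsN : (s : ℝ) * N ≤ 2 * (ε * n) := by
    have := mul_le_mul_of_nonneg_right hs2 (by linarith : (0 : ℝ) ≤ N)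
    linarith
  have hzb' : (zb : ℝ) ≤ 6 * (ε * n) := by
    rw [hzb]; push_cast; linarith
  set γ := ⌊(n : ℝ) / (100000 * r ^ 2)⌋₊ with hγ
  have hnr : 1000000 * (r : ℝ) ^ 2 ≤ n := by linarith
  have hγ1 : (γ : ℝ) * (100000 * r ^ 2) ≤ n := by
    have := Nat.floor_le (by positivity : 0 ≤ (n : ℝ) / (100000 * r ^ 2))
    rwa [le_div_iff₀ (by positivity)] at this
  have hγ2 : (n : ℝ) ≤ γ * (200000 * r ^ 2) := by
    have := Nat.lt_floor_add_one ((n : ℝ) / (100000 * r ^ 2))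
    rw [div_lt_iff₀ (by positivity)] at this
    rw [← hγ] at this
    linarith only [this, hnr, hγ1]
  set g := ⌊(n : ℝ) / (41 * r)⌋₊ with hg
  have hg1 : (g : ℝ) * (41 * r) ≤ n := by
    have := Nat.floor_le (by positivity : 0 ≤ (n : ℝ) / (41 * r))
    rwa [le_div_iff₀ (by positivity)] at this
  have hg2 : (n : ℝ) < (g + 1) * (41 * r) := by
    have := Nat.lt_floor_add_one ((n : ℝ) / (41 * r))
    rwa [div_lt_iff₀ (by positivity)] at this
  set δ := ⌊(n : ℝ) / 40⌋₊ with hδdef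
  have hδ2 : (n : ℝ) / 40 < δ + 1 := Nat.lt_floor_add_one _
  set K := 2 * s + τ + L with hK
  have hK' : (K : ℝ) ≤ 3 * 10 ^ 5 * Z := by
    rw [hK]; push_cast; linarith
  set u := m / (32 * P) with hu
  set h := m / 2 - u with hh
  set U := m - 2 * h with hU
  have hu1 : 32 * (P * u) ≤ m := by
    have := Nat.mul_div_le m (32 * P)
    rw [hu]; linarith
  have hu2 : m < 32 * (P * u) + 32 * P := by
    have := Nat.lt_div_mul_add (a := m) (b := 32 * P) (by omega)
    rw [hu]; linarith
  have hu3 : 32 * u ≤ m := by nlinarith only [hu1, hP]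
  have hUu : 2 * u ≤ U ∧ U ≤ 2 * u + 1 := by omega
  have hUm : m = U + 2 * h := by omega
  have hhm : m ≤ 4 * h + 4 := by omega
  have hu1' : 32 * ((P : ℝ) * u) ≤ m := by exact_mod_cast hu1
  have hu2' : (m : ℝ) ≤ 32 * (P * u) + 32 * P := by exact_mod_cast hu2.le
  have hU1' : 2 * (u : ℝ) ≤ U := by exact_mod_cast hUu.1
  have hU2' : (U : ℝ) ≤ 2 * u + 1 := by exact_mod_cast hUu.2
  have hPU : (P : ℝ) * U ≤ 2 * (P * u) + P := by nlinarith only [hU2', hP']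
  have hPleX : (P : ℝ) ≤ X := by nlinarith only [hPPX, hPPy, hy1, hP']
  have hνu : 10 ^ 7 * Z ≤ ν * u := by
    have h1 : (P : ℝ) * (10 ^ 7 * Z) ≤ P * (ν * u) := by
      have h2 := mul_le_mul_of_nonneg_left hu2' hν.le
      have h3 : ν * (32 * P) ≤ X := by nlinarith only [hν1, hP', hPleX]
      have h4 : 0 ≤ X := by positivity
      have h5 : (P : ℝ) * (10 ^ 7 * Z) = 10 ^ 7 * X := by rw [← hZX]; ring
      rw [h5]
      linarith only [h2, h3, h4, hνm]
    exact le_of_mul_le_mul_left h1 (by linarith)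
  have hZ0 : 0 ≤ Z := by positivity
  have hX0 : 0 ≤ X := by positivity
  have hKu : 10 ^ 10 * Z ≤ u := by
    have : ν * u ≤ 1 / 1000 * u := mul_le_mul_of_nonneg_right hν1 (Nat.cast_nonneg _)
    linarith
  have hα1 : 42 * r - 1 + 1 = 42 * r := by omega
  have hq : r * (42 * r - 1) ≤ 42 * r ^ 2 := by
    have : r * (42 * r - 1) ≤ r * (42 * r) := Nat.mul_le_mul_left _ (Nat.sub_le _ _)
    linarith
  have hq' : ((r * (42 * r - 1) : ℕ) : ℝ) ≤ 42 * r ^ 2 := by exact_mod_cast hq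
  suffices hmain : ∃ k ≤ Fintype.card κ + r * (42 * r - 1) + (r * (42 * r - 1) + 2),
      MonoCyclePartition G col k by
    obtain ⟨k, hk, hpart⟩ := hmain
    exact ⟨k, hk.trans (by omega), hpart⟩
  refine exists_partition_of_clusters G col ⟨0, hr⟩ R hR cl hcl m hm Γ s P
    (by have : (0 : ℝ) < s := by linarith
        exact_mod_cast this) (by omega) hG H colr hH key hkey σ hσ side hside1 hside hside0 sd hsd
    hsd0 U K (42 * r - 1) (hdist U K _ ?_) δ ?_ zb τ w L γ g h le_rfl le_rfl le_rfl ?_ ?_ ?_ ?_ ?_ ?_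
    le_rfl ?_ hUm ?_ ?_
  · have h1 : ((K + r * (42 * r - 1) + 2 * N + 5 : ℕ) : ℝ) =
        (K : ℝ) + ((r * (42 * r - 1) : ℕ) : ℝ) + 2 * N + 5 := by push_cast; ring
    rw [h1]
    have h2 := mul_le_mul_of_nonneg_left hU1' hν.le
    linarith
  · intro z
    exact Nat.floor_le_of_le (hδ z)
  · have : 2 * (w : ℝ) + 4 * s ≤ m := by linarith
    exact_mod_cast this
  · have h1 : (P : ℝ) * (τ + 2 * s + P * (N + 3)) + 2 * w + 2 * s ≤ m := by
      have h2 : (P : ℝ) * τ ≤ P * y :=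
        mul_le_mul_of_nonneg_left (by linarith) (by linarith)
      have h3 : (P : ℝ) * (P * (N + 3)) ≤ P * y :=
        mul_le_mul_of_nonneg_left (by linarith) (by linarith)
      linarith
    exact_mod_cast h1
  · have h1 : (0 : ℝ) < L := by linarith
    exact_mod_cast h1
  · have h1 : (zb : ℝ) * (L + m) ≤ L * γ := by
      have h2 : (L : ℝ) + m ≤ 2 * m := by linarith
      have h3 : (zb : ℝ) * (L + m) ≤ 6 * (ε * n) * (2 * m) :=
        mul_le_mul hzb' h2 (by positivity) (by positivity)
      have h4 : 6 * (ε * n) * (2 * m) = 12 * (n * y) := by rw [hy]; ring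
      have h5 : 10 ^ 5 * Z * γ ≤ L * γ := mul_le_mul_of_nonneg_right hL1 (Nat.cast_nonneg _)
      have h6 : (P : ℝ) * y * n ≤ P * y * (γ * (200000 * r ^ 2)) :=
        mul_le_mul_of_nonneg_left hγ2 (by positivity)
      have h7 : (P : ℝ) * y * (γ * (200000 * r ^ 2)) = 2 * (10 ^ 5 * Z * γ) := by rw [hZ]; ring
      have h8 : 1000 * y * n ≤ P * y * n := mul_le_mul_of_nonneg_right hPy hn0
      have h9 : 0 ≤ n * y := by positivity
      linarith
    exact_mod_cast h1
  · rw [hα1]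
    have h1 : (n : ℝ) + (42 * r) ^ 2 * γ < 42 * r * g := by
      linarith only [hγ1, hg2, hnr, hrr]
    exact_mod_cast h1
  · have h1 : (r : ℝ) * g + (zb + 2 * w * N + τ) ≤ δ := by
      have h2 : (w : ℝ) * N ≤ 64 * (P * (ε * n)) := by
        have h3 := mul_le_mul_of_nonneg_right hw' (by linarith : (0 : ℝ) ≤ N)
        have h4 := mul_le_mul_of_nonneg_left hYN (by linarith : (0 : ℝ) ≤ P)
        linarith
      have h3 : (P : ℝ) * (ε * n) * 10 ^ 12 ≤ n := by
        have h4 : ε * (10 ^ 9 * (P : ℝ)) ≤ ν := by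
          rw [← hε]
          have : (10 ^ 9 * (P : ℝ)) ≤ 10 ^ 9 * (P : ℝ) ^ 2 * r ^ 2 := by
            have h5 : (P : ℝ) ≤ (P : ℝ) ^ 2 := by nlinarith only [hP']
            have h6 : (P : ℝ) ^ 2 ≤ (P : ℝ) ^ 2 * r ^ 2 :=
              le_mul_of_one_le_right (sq_nonneg _) hr2
            linarith
          exact mul_le_mul_of_nonneg_left this hεpos.le
        have h5 : ε * P * 10 ^ 12 ≤ 1 := by linarith
        have h6 := mul_le_mul_of_nonneg_right h5 hn0
        linarith
      have h4 : ε * n ≤ P * (ε * n) := by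
        have : 0 ≤ ε * n := by positivity
        nlinarith only [this, hP']
      linarith
    exact_mod_cast h1
  · have : (K : ℝ) ≤ U := by linarith
    exact_mod_cast this
  · have h1 : (m : ℝ) ≤ 4 * h + 4 := by exact_mod_cast hhm
    have : (w : ℝ) ≤ h := by linarith
    exact_mod_cast this
  · have h1 : (P : ℝ) * (2 * U + (K + (((r * (42 * r - 1) : ℕ) : ℝ) + 2)) + 2 * s + P * (s + 1)) +
        2 * w + 2 * s ≤ m := by
      have h2 : (P : ℝ) * K ≤ 3 * 10 ^ 5 * X := by
        have := mul_le_mul_of_nonneg_left hK' (by linarith : (0 : ℝ) ≤ P)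
        rw [← hZX]; linarith
      have h3 : (P : ℝ) * (((r * (42 * r - 1) : ℕ) : ℝ) + 2) ≤ P * (2 * y) :=
        mul_le_mul_of_nonneg_left (by linarith) (by linarith)
      have h4 : (P : ℝ) * P ≤ (P : ℝ) ^ 2 * y := by
        have : (P : ℝ) ^ 2 * 1 ≤ (P : ℝ) ^ 2 * y :=
          mul_le_mul_of_nonneg_left (by linarith only [hy1]) (sq_nonneg _)
        linarith only [this]
      linarith
    exact_mod_cast h1

lemma pairs_eq_sum (R : V → V → Prop) [DecidableRel R] (A B : Finset V) :
    pairs R A B = ∑ a ∈ A, (B.filter (fun b => R a b)).card := by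
  rw [pairs, Finset.card_filter, Finset.sum_product]
  exact Finset.sum_congr rfl (fun a _ => (Finset.card_filter _ _).symm)

lemma pairs_comm (R : V → V → Prop) [DecidableRel R] (h : ∀ u v, R u v → R v u)
    (A B : Finset V) : pairs R A B = pairs R B A := by
  have key : ∀ A B : Finset V, pairs R A B ≤ pairs R B A := by
    intro A B
    refine Finset.card_le_card_of_injOn Prod.swap ?_ Prod.swap_injective.injOn
    intro p hp
    have hp' := Finset.mem_filter.1 (Finset.mem_coe.1 hp)
    have hp2 := Finset.mem_product.1 hp'.1
    exact Finset.mem_coe.2 (Finset.mem_filter.2 ⟨Finset.mem_product.2 ⟨hp2.2, hp2.1⟩, h _ _ hp'.2⟩)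
  exact le_antisymm (key A B) (key B A)

lemma pairs_le_mul (R : V → V → Prop) [DecidableRel R] (A B : Finset V) :
    pairs R A B ≤ A.card * B.card := by
  rw [← Finset.card_product]; exact Finset.card_filter_le _ _

section reduced
variable {r : ℕ} {ι : Type*} (R : Fin r → V → V → Prop) [∀ c, DecidableRel (R c)]

/-- The reduced graph in colour `c`: regular pairs that are dense in colour `c`. -/
def redGraph (ε d : ℝ) (cl : ι → Finset V) (c : Fin r) : SimpleGraph ι where
  Adj i j := i ≠ j ∧ (¬ Irreg R ε (cl i) (cl j) ∧ ¬ Irreg R ε (cl j) (cl i)) ∧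
    (2 * d * ((cl i).card * (cl j).card) ≤ pairs (R c) (cl i) (cl j) ∧
      2 * d * ((cl j).card * (cl i).card) ≤ pairs (R c) (cl j) (cl i))
  symm := ⟨fun _ _ h => ⟨h.1.symm, h.2.1.symm, h.2.2.symm⟩⟩
  loopless := ⟨fun _ h => h.1 rfl⟩

lemma halfGood_of_redGraph (ε d : ℝ) (hεd : ε ≤ d) (cl : ι → Finset V) (m : ℕ)
    (hm : ∀ i, (cl i).card = m) (hεm : 0 < ε * m) (P : ℕ) (hP : 1 ≤ P * d) (c : Fin r) (i j : ι)
    (h : (redGraph R ε d cl c).Adj i j) : HalfGood (R c) (cl i) (cl j) ⌈ε * m⌉₊ P := by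
  intro A hA B hB hsA hsB
  have hA1 : ε * m ≤ A.card := (Nat.le_ceil _).trans (by exact_mod_cast hsA)
  have hB1 : ε * m ≤ B.card := (Nat.le_ceil _).trans (by exact_mod_cast hsB)
  have hmpos : (0 : ℝ) < m := by
    rcases (Nat.cast_nonneg (α := ℝ) m).lt_or_eq with h0 | h0
    · exact h0
    · rw [← h0] at hεm; simp at hεm
  obtain ⟨-, ⟨hreg, -⟩, hdens, -⟩ := h
  have hlow : (pairs (R c) (cl i) (cl j) / ((cl i).card * (cl j).card) - ε) *
      (A.card * B.card) ≤ pairs (R c) A B := by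
    by_contra hneg
    exact hreg ⟨c, A, hA, B, hB, by rwa [hm], by rwa [hm], not_le.1 hneg⟩
  rw [hm, hm] at hlow hdens
  have h2d : 2 * d ≤ pairs (R c) (cl i) (cl j) / ((m : ℝ) * m) := by
    rwa [le_div_iff₀ (by positivity)]
  have hAB : d * (A.card * B.card) ≤ pairs (R c) A B := by
    refine le_trans (mul_le_mul_of_nonneg_right ?_ (by positivity)) hlow
    linarith
  by_contra hcon
  push Not at hcon
  have hApos : 0 < A.card := by
    have : (0 : ℝ) < A.card := hεm.trans_le hA1
    exact_mod_cast this
  have hlt : P * pairs (R c) A B < A.card * B.card := by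
    rw [pairs_eq_sum, Finset.mul_sum, ← smul_eq_mul (A.card), ← Finset.sum_const]
    exact Finset.sum_lt_sum_of_nonempty (Finset.card_pos.1 hApos) hcon
  have hlt' : (P : ℝ) * pairs (R c) A B < A.card * B.card := by exact_mod_cast hlt
  have h3 := mul_le_mul_of_nonneg_left hAB (Nat.cast_nonneg (α := ℝ) P)
  have h4 := mul_le_mul_of_nonneg_right hP
    (by positivity : (0 : ℝ) ≤ (A.card : ℝ) * B.card)
  linarith

open Classical in
/-- The vertices reachable from `i`. -/
noncomputable def reach [Fintype ι] (Γ : SimpleGraph ι) (i : ι) : Finset ι :=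
  Finset.univ.filter (fun k => Γ.Reachable i k)

/-- Adjacency in some colour within a component containing at least a proportion `μ / r` of the
vertices. -/
def bigAdj [Fintype ι] (Γ : Fin r → SimpleGraph ι) (μ : ℝ) (i j : ι) : Prop :=
  ∃ c, (Γ c).Adj i j ∧ μ * Fintype.card ι ≤ r * (reach (Γ c) i).card

lemma reach_eq_of_adj [Fintype ι] {Γ : SimpleGraph ι} {i j : ι} (h : Γ.Adj i j) :
    reach Γ i = reach Γ j := by
  ext k
  simp only [reach, Finset.mem_filter, Finset.mem_univ, true_and]
  exact ⟨fun hk => h.reachable.symm.trans hk, fun hk => h.reachable.trans hk⟩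

lemma bigAdj_symm [Fintype ι] (Γ : Fin r → SimpleGraph ι) (μ : ℝ) {i j : ι}
    (h : bigAdj Γ μ i j) : bigAdj Γ μ j i := by
  obtain ⟨c, hadj, hbig⟩ := h
  exact ⟨c, hadj.symm, by rwa [← reach_eq_of_adj hadj]⟩

open Classical in
lemma card_small_le [Fintype ι] (Γ : Fin r → SimpleGraph ι) (μ : ℝ) (hμ : 0 ≤ μ) (hr : 1 ≤ r)
    (i : ι) : ((Finset.univ.filter (fun j => (∃ c, (Γ c).Adj i j) ∧ ¬ bigAdj Γ μ i j)).card : ℝ) ≤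
      μ * Fintype.card ι := by
  set S := Finset.univ.filter (fun c : Fin r => r * ((reach (Γ c) i).card : ℝ) ≤
    μ * Fintype.card ι) with hS
  have hsub : Finset.univ.filter (fun j => (∃ c, (Γ c).Adj i j) ∧ ¬ bigAdj Γ μ i j) ⊆
      S.biUnion (fun c => reach (Γ c) i) := by
    intro j hj
    obtain ⟨-, ⟨c, hc⟩, hnot⟩ := Finset.mem_filter.1 hj
    refine Finset.mem_biUnion.2 ⟨c, Finset.mem_filter.2 ⟨Finset.mem_univ _, ?_⟩, ?_⟩
    · by_contra hlt
      exact hnot ⟨c, hc, (not_le.1 hlt).le⟩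
    · exact Finset.mem_filter.2 ⟨Finset.mem_univ _, hc.reachable⟩
  have h1 := (Finset.card_le_card hsub).trans Finset.card_biUnion_le
  have h1' : ((Finset.univ.filter (fun j => (∃ c, (Γ c).Adj i j) ∧ ¬ bigAdj Γ μ i j)).card : ℝ) ≤
      ∑ c ∈ S, ((reach (Γ c) i).card : ℝ) := by exact_mod_cast h1
  have h2 : r * ∑ c ∈ S, ((reach (Γ c) i).card : ℝ) ≤ r * (μ * Fintype.card ι) := by
    rw [Finset.mul_sum]
    refine (Finset.sum_le_sum (fun c hc => (Finset.mem_filter.1 hc).2)).trans ?_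
    rw [Finset.sum_const, nsmul_eq_mul]
    refine mul_le_mul_of_nonneg_right ?_ (by positivity)
    have := Finset.card_le_univ S
    rw [Fintype.card_fin] at this
    exact Nat.cast_le.2 this
  have hr' : (0 : ℝ) < r := by exact_mod_cast hr
  exact h1'.trans (le_of_mul_le_mul_left h2 hr')

open Classical in
lemma sum_pairs_le [Fintype ι] (hsymm : ∀ c u v, R c u v → R c v u) (ε d μ : ℝ)
    (hd : 0 ≤ d) (hμ : 0 ≤ μ) (hr : 1 ≤ r) (cl : ι → Finset V) (m : ℕ)
    (hm : ∀ i, (cl i).card = m) (n : ℝ) (hNm : Fintype.card ι * m ≤ n) (hmn : m ≤ ε * n) (i : ι)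
    (hirr : (m : ℝ) * (Finset.univ.filter (fun j => Irreg R ε (cl i) (cl j) ∨
      Irreg R ε (cl j) (cl i))).card ≤ ε * n)
    (A : Finset V) (hA : A ⊆ cl i) (T : Finset ι) :
    ∑ j ∈ T, (pairs (fun u v => ∃ c, R c u v) A (cl j) : ℝ) ≤
      A.card * m * (T.filter (fun j => bigAdj (redGraph R ε d cl) μ i j)).card +
        A.card * (μ * n) + m * n * (2 * ε + 2 * d * r) := by
  set Γ := redGraph R ε d cl with hΓ
  set N := Fintype.card ι with hN
  have hAm : (A.card : ℝ) ≤ m := by rw [← hm i]; exact_mod_cast Finset.card_le_card hA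
  have hm0 : (0 : ℝ) ≤ m := Nat.cast_nonneg _
  have hA0 : (0 : ℝ) ≤ A.card := Nat.cast_nonneg _
  have htriv : ∀ j, (pairs (fun u v => ∃ c, R c u v) A (cl j) : ℝ) ≤ A.card * m := by
    intro j
    have := pairs_le_mul (fun u v => ∃ c, R c u v) A (cl j)
    rw [hm] at this
    exact_mod_cast this
  have hpoint : ∀ j, (pairs (fun u v => ∃ c, R c u v) A (cl j) : ℝ) ≤
      (if bigAdj Γ μ i j then (A.card : ℝ) * m else 0) + (if j = i then (m : ℝ) * m else 0) +
      (if Irreg R ε (cl i) (cl j) ∨ Irreg R ε (cl j) (cl i) then (m : ℝ) * m else 0) +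
      (if (∃ c, (Γ c).Adj i j) ∧ ¬ bigAdj Γ μ i j then (A.card : ℝ) * m else 0) +
      2 * d * r * (m * m) := by
    intro j
    have e0 : 0 ≤ 2 * d * r * (m * m : ℝ) := by positivity
    have e1 : 0 ≤ (if bigAdj Γ μ i j then (A.card : ℝ) * m else 0) := by
      split_ifs <;> positivity
    have e2 : 0 ≤ (if j = i then (m : ℝ) * m else 0) := by split_ifs <;> positivity
    have e3 : 0 ≤ (if Irreg R ε (cl i) (cl j) ∨ Irreg R ε (cl j) (cl i) then (m : ℝ) * m
      else 0) := by split_ifs <;> positivity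
    have e4 : 0 ≤ (if (∃ c, (Γ c).Adj i j) ∧ ¬ bigAdj Γ μ i j then (A.card : ℝ) * m else 0) := by
      split_ifs <;> positivity
    have hle := htriv j
    have hAmm : (A.card : ℝ) * m ≤ m * m := mul_le_mul_of_nonneg_right hAm hm0
    by_cases c1 : bigAdj Γ μ i j
    · rw [if_pos c1] at e1 ⊢; linarith
    by_cases c2 : j = i
    · rw [if_pos c2] at e2 ⊢; linarith
    by_cases c3 : Irreg R ε (cl i) (cl j) ∨ Irreg R ε (cl j) (cl i)
    · rw [if_pos c3] at e3 ⊢; linarith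
    by_cases c4 : ∃ c, (Γ c).Adj i j
    · have c5 : (∃ c, (Γ c).Adj i j) ∧ ¬ bigAdj Γ μ i j := ⟨c4, c1⟩
      rw [if_pos c5] at e4 ⊢; linarith
    have hsparse : ∀ c, (pairs (R c) (cl i) (cl j) : ℝ) ≤ 2 * d * (m * m) := by
      intro c
      by_contra hgt
      push Not at c3 hgt
      refine c4 ⟨c, fun h => c2 h.symm, c3, ?_, ?_⟩
      · rw [hm, hm]; exact hgt.le
      · rw [hm, hm, pairs_comm _ (hsymm c)]; exact hgt.le
    have hsum : pairs (fun u v => ∃ c, R c u v) A (cl j) ≤ ∑ c, pairs (R c) (cl i) (cl j) := by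
      refine le_trans (Finset.card_le_card ?_) (Finset.card_biUnion_le
        (s := Finset.univ) (t := fun c => ((cl i ×ˢ cl j).filter (fun p => R c p.1 p.2))))
      intro p hp
      rw [Finset.mem_filter, Finset.mem_product] at hp
      obtain ⟨⟨h1, h2⟩, c, hc⟩ := hp
      exact Finset.mem_biUnion.2 ⟨c, Finset.mem_univ _,
        Finset.mem_filter.2 ⟨Finset.mem_product.2 ⟨hA h1, h2⟩, hc⟩⟩
    have hsum' : (pairs (fun u v => ∃ c, R c u v) A (cl j) : ℝ) ≤
        ∑ c, (pairs (R c) (cl i) (cl j) : ℝ) := by exact_mod_cast hsum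
    have hsum2 : ∑ c, (pairs (R c) (cl i) (cl j) : ℝ) ≤ r * (2 * d * (m * m)) := by
      refine (Finset.sum_le_sum (fun c _ => hsparse c)).trans (le_of_eq ?_)
      simp
    linarith
  refine (Finset.sum_le_sum (fun j _ => hpoint j)).trans ?_
  simp only [Finset.sum_add_distrib, ← Finset.sum_filter, Finset.sum_const, nsmul_eq_mul]
  have b2 : ((T.filter (fun j => j = i)).card : ℝ) ≤ 1 := by
    have : (T.filter (fun j => j = i)).card ≤ ({i} : Finset ι).card :=
      Finset.card_le_card (fun j hj => Finset.mem_singleton.2 (Finset.mem_filter.1 hj).2)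
    rw [Finset.card_singleton] at this
    exact_mod_cast this
  have b3 : ((T.filter (fun j => Irreg R ε (cl i) (cl j) ∨ Irreg R ε (cl j) (cl i))).card : ℝ) ≤
      (Finset.univ.filter (fun j => Irreg R ε (cl i) (cl j) ∨ Irreg R ε (cl j) (cl i))).card := by
    exact_mod_cast Finset.card_le_card (Finset.filter_subset_filter _ (Finset.subset_univ T))
  have b4 : ((T.filter (fun j => (∃ c, (Γ c).Adj i j) ∧ ¬ bigAdj Γ μ i j)).card : ℝ) ≤
      μ * N := by
    refine le_trans ?_ (card_small_le Γ μ hμ hr i)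
    exact_mod_cast Finset.card_le_card (Finset.filter_subset_filter _ (Finset.subset_univ T))
  have b5 : (T.card : ℝ) ≤ N := by exact_mod_cast Finset.card_le_univ T
  have f2 := mul_le_mul_of_nonneg_right b2 (by positivity : (0 : ℝ) ≤ m * m)
  have f2' := mul_le_mul_of_nonneg_left hmn hm0
  have f3 := mul_le_mul_of_nonneg_right b3 (by positivity : (0 : ℝ) ≤ m * m)
  have f3' := mul_le_mul_of_nonneg_left hirr hm0
  have f4 := mul_le_mul_of_nonneg_right b4 (by positivity : (0 : ℝ) ≤ A.card * m)
  have f4' := mul_le_mul_of_nonneg_left hNm (by positivity : (0 : ℝ) ≤ A.card * μ)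
  have f5 := mul_le_mul_of_nonneg_right b5 (by positivity : (0 : ℝ) ≤ 2 * d * r * (m * m))
  have f5' := mul_le_mul_of_nonneg_left hNm (by positivity : (0 : ℝ) ≤ 2 * d * r * m)
  linarith

end reduced

section inherit
variable [Fintype V] [DecidableEq V] {r : ℕ} {ι : Type*} [Fintype ι]
  (R : Fin r → V → V → Prop) [∀ c, DecidableRel (R c)]

open Classical in
lemma le_card_bigAdj (hsymm : ∀ c u v, R c u v → R c v u) (ε d μ : ℝ)
    (hd : 0 ≤ d) (hμ : 0 ≤ μ) (hr : 1 ≤ r) (cl : ι → Finset V) (m : ℕ) (hm0 : 0 < m)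
    (hm : ∀ i, (cl i).card = m) (hNm : (Fintype.card ι : ℝ) * m ≤ Fintype.card V)
    (hmn : m ≤ ε * Fintype.card V)
    (hunc : ((Finset.univ \ Finset.univ.biUnion cl).card : ℝ) ≤ 2 * ε * Fintype.card V) (i : ι)
    (hirr : (m : ℝ) * (Finset.univ.filter (fun j => Irreg R ε (cl i) (cl j) ∨
      Irreg R ε (cl j) (cl i))).card ≤ ε * Fintype.card V)
    (A : Finset V) (hA : A ⊆ cl i) (κ θ β : ℝ) (hκ : 0 < κ) (hκA : κ * m ≤ A.card)
    (hθ : 4 * ε + 2 * d * r ≤ θ * κ) (hθ0 : 0 ≤ θ) (hβ : 0 ≤ β - μ - θ)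
    (hdeg : ∀ x ∈ A, β * Fintype.card V ≤ (Finset.univ.filter (fun y => ∃ c, R c x y)).card) :
    (β - μ - θ) * Fintype.card ι ≤
      (Finset.univ.filter (fun j => bigAdj (redGraph R ε d cl) μ i j)).card := by
  set n := (Fintype.card V : ℝ) with hn
  set D := ((Finset.univ.filter (fun j => bigAdj (redGraph R ε d cl) μ i j)).card : ℝ) with hD
  have hm0' : (0 : ℝ) < m := by exact_mod_cast hm0
  have hApos : (0 : ℝ) < A.card := lt_of_lt_of_le (by positivity) hκA
  have hn0 : 0 ≤ n := Nat.cast_nonneg _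
  have hAm : (A.card : ℝ) ≤ m := by rw [← hm i]; exact_mod_cast Finset.card_le_card hA
  have h1 : (A.card : ℝ) * (β * n) ≤ pairs (fun u v => ∃ c, R c u v) A Finset.univ := by
    rw [pairs_eq_sum, ← nsmul_eq_mul]
    push_cast
    exact Finset.card_nsmul_le_sum _ _ _ hdeg
  have h2 : pairs (fun u v => ∃ c, R c u v) A Finset.univ ≤
      A.card * (Finset.univ \ Finset.univ.biUnion cl).card +
        ∑ j, pairs (fun u v => ∃ c, R c u v) A (cl j) := by
    refine le_trans (Finset.card_le_card (t := (A ×ˢ (Finset.univ \ Finset.univ.biUnion cl)) ∪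
      Finset.univ.biUnion (fun j => (A ×ˢ cl j).filter (fun p => ∃ c, R c p.1 p.2))) ?_) ?_
    · intro p hp
      rw [Finset.mem_filter, Finset.mem_product] at hp
      by_cases hpc : p.2 ∈ Finset.univ.biUnion cl
      · obtain ⟨j, -, hj⟩ := Finset.mem_biUnion.1 hpc
        exact Finset.mem_union_right _ (Finset.mem_biUnion.2 ⟨j, Finset.mem_univ _,
          Finset.mem_filter.2 ⟨Finset.mem_product.2 ⟨hp.1.1, hj⟩, hp.2⟩⟩)
      · exact Finset.mem_union_left _ (Finset.mem_product.2 ⟨hp.1.1,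
          Finset.mem_sdiff.2 ⟨Finset.mem_univ _, hpc⟩⟩)
    · refine (Finset.card_union_le _ _).trans ?_
      rw [Finset.card_product]
      exact Nat.add_le_add_left Finset.card_biUnion_le _
  have h2' : (pairs (fun u v => ∃ c, R c u v) A Finset.univ : ℝ) ≤
      A.card * (Finset.univ \ Finset.univ.biUnion cl).card +
        ∑ j, (pairs (fun u v => ∃ c, R c u v) A (cl j) : ℝ) := by exact_mod_cast h2
  have h3 := sum_pairs_le R hsymm ε d μ hd hμ hr cl m hm n hNm hmn i hirr A hA Finset.univ
  have h4 : (A.card : ℝ) * (Finset.univ \ Finset.univ.biUnion cl).card ≤ m * (2 * ε * n) :=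
    mul_le_mul hAm hunc (by positivity) hm0'.le
  have h5 : m * n * (4 * ε + 2 * d * r) ≤ A.card * (θ * n) := by
    have e1 := mul_le_mul_of_nonneg_left hθ (by positivity : 0 ≤ m * n)
    have e2 := mul_le_mul_of_nonneg_right hκA (by positivity : 0 ≤ θ * n)
    linarith
  have h6 : (A.card : ℝ) * ((β - μ - θ) * n) ≤ A.card * (m * D) := by linarith
  have h7 : (β - μ - θ) * n ≤ m * D := le_of_mul_le_mul_left h6 hApos
  have h8 := mul_le_mul_of_nonneg_left hNm hβ
  refine le_of_mul_le_mul_left ?_ hm0'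
  linarith

open Classical in
lemma card_lt_of_independent (G : SimpleGraph V) (hRG : ∀ u v, G.Adj u v → ∃ c, R c u v)
    (hsymm : ∀ c u v, R c u v → R c v u) (ε d μ ν : ℝ) (hε : 0 ≤ ε)
    (hd : 0 ≤ d) (hμ : 0 ≤ μ) (hr : 1 ≤ r) (cl : ι → Finset V)
    (hcl : ∀ i j, i ≠ j → Disjoint (cl i) (cl j)) (m : ℕ)
    (hm : ∀ i, (cl i).card = m) (hNm : (Fintype.card ι : ℝ) * m ≤ Fintype.card V)
    (hV : 0 < Fintype.card V) (hmn : m ≤ ε * Fintype.card V)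
    (hNm' : (1 - 2 * ε) * (Fintype.card V : ℝ) ≤ Fintype.card ι * m)
    (hirr : ∀ i, (m : ℝ) * (Finset.univ.filter (fun j => Irreg R ε (cl i) (cl j) ∨
      Irreg R ε (cl j) (cl i))).card ≤ ε * Fintype.card V)
    (hν : ν ≤ 1 / 2) (hεν : 4 * ε ≤ ν) (hν' : μ + (2 * ε + 2 * d * r) < ν)
    (hG : ∀ S : Set V, (1 / 2 - ν) * (Nat.card V : ℝ) ≤ (S.ncard : ℝ) →
      ν * (Nat.card V : ℝ) ^ 2 ≤ (edgesIn G S : ℝ))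
    (S : Finset ι) (hS : ∀ i ∈ S, ∀ j ∈ S, ¬ bigAdj (redGraph R ε d cl) μ i j) :
    (S.card : ℝ) < (1 / 2 - ν / 2) * Fintype.card ι := by
  by_contra hge
  push Not at hge
  rw [Nat.card_eq_fintype_card] at hG
  set n := (Fintype.card V : ℝ) with hn
  have hn0 : 0 < n := Nat.cast_pos.2 hV
  have hm0 : (0 : ℝ) ≤ m := Nat.cast_nonneg _
  set X := S.biUnion cl with hX
  have hXc : X.card = S.card * m := by
    rw [hX, Finset.card_biUnion (fun i _ j _ h => hcl i j h), Finset.sum_congr rfl (fun i _ => hm i),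
      Finset.sum_const, smul_eq_mul]
  have hXc' : (X.card : ℝ) = S.card * m := by exact_mod_cast hXc
  have h1 := hG (X : Set V) (by
    rw [Set.ncard_coe_finset, hXc']
    have e1 := mul_le_mul_of_nonneg_right hge hm0
    have e2 := mul_le_mul_of_nonneg_left hNm' (by linarith : 0 ≤ 1 / 2 - ν / 2)
    have e3 : (1 / 2 - ν) * n ≤ (1 / 2 - ν / 2) * ((1 - 2 * ε) * n) := by
      rw [← mul_assoc]
      refine mul_le_mul_of_nonneg_right ?_ hn0.le
      nlinarith
    linarith)
  have h2 : edgesIn G (X : Set V) ≤ pairs (fun u v => ∃ c, R c u v) X X := by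
    rw [edgesIn, pairs]
    refine le_trans (Set.ncard_le_ncard (t := (((X ×ˢ X).filter
      (fun p => ∃ c, R c p.1 p.2)).image (fun p => s(p.1, p.2)) : Finset (Sym2 V)))
      ?_ (Finset.finite_toSet _)) ?_
    · rintro e ⟨he, hmem⟩
      induction e with
      | h u v =>
        simp only [Sym2.mem_iff, forall_eq_or_imp, forall_eq, Finset.mem_coe] at hmem
        exact Finset.mem_coe.2 (Finset.mem_image.2 ⟨(u, v), Finset.mem_filter.2
          ⟨Finset.mem_product.2 hmem, hRG u v he⟩, rfl⟩)
    · rw [Set.ncard_coe_finset]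
      exact Finset.card_image_le
  have h3 : pairs (fun u v => ∃ c, R c u v) X X ≤
      ∑ i ∈ S, ∑ j ∈ S, pairs (fun u v => ∃ c, R c u v) (cl i) (cl j) := by
    rw [← Finset.sum_product']
    refine le_trans (Finset.card_le_card ?_) (Finset.card_biUnion_le (s := S ×ˢ S)
      (t := fun q => (cl q.1 ×ˢ cl q.2).filter (fun p => ∃ c, R c p.1 p.2)))
    intro p hp
    rw [Finset.mem_filter, Finset.mem_product] at hp
    obtain ⟨i, hi, hpi⟩ := Finset.mem_biUnion.1 hp.1.1
    obtain ⟨j, hj, hpj⟩ := Finset.mem_biUnion.1 hp.1.2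
    exact Finset.mem_biUnion.2 ⟨(i, j), Finset.mem_product.2 ⟨hi, hj⟩,
      Finset.mem_filter.2 ⟨Finset.mem_product.2 ⟨hpi, hpj⟩, hp.2⟩⟩
  have h23 : (edgesIn G (X : Set V) : ℝ) ≤
      ∑ i ∈ S, ∑ j ∈ S, (pairs (fun u v => ∃ c, R c u v) (cl i) (cl j) : ℝ) := by
    exact_mod_cast h2.trans h3
  have h4 : ∀ i ∈ S, ∑ j ∈ S, (pairs (fun u v => ∃ c, R c u v) (cl i) (cl j) : ℝ) ≤
      m * n * (μ + (2 * ε + 2 * d * r)) := by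
    intro i hi
    have h5 := sum_pairs_le R hsymm ε d μ hd hμ hr cl m hm n hNm hmn i (hirr i) (cl i)
      (Finset.Subset.refl _) S
    have h6 : S.filter (fun j => bigAdj (redGraph R ε d cl) μ i j) = ∅ :=
      Finset.filter_false_of_mem (fun j hj => hS i hi j hj)
    rw [h6, Finset.card_empty, hm] at h5
    push_cast at h5
    linarith
  have h7 := h23.trans (Finset.sum_le_sum h4)
  rw [Finset.sum_const, nsmul_eq_mul] at h7
  have h8 : (S.card : ℝ) * m ≤ n := by
    rw [← hXc']; exact Nat.cast_le.2 (Finset.card_le_univ X)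
  have h9 : (0 : ℝ) ≤ n * (μ + (2 * ε + 2 * d * r)) := by positivity
  have h10 := mul_le_mul_of_nonneg_right h8 h9
  have h11 : n * (n * (μ + (2 * ε + 2 * d * r))) < ν * n ^ 2 := by
    have := mul_lt_mul_of_pos_right hν' (by positivity : 0 < n ^ 2)
    linarith
  linarith

end inherit

section expansion
variable {ι : Type*} [Fintype ι] (H : ι → ι → Prop) [DecidableRel H]

lemma filter_subset_nbr {X : Finset ι} {i : ι} (hi : i ∈ X) :
    Finset.univ.filter (H i) ⊆ nbr H X := by
  intro j hj
  exact mem_nbr.2 ⟨i, hi, (Finset.mem_filter.1 hj).2⟩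

lemma expansion_of_large_degree [DecidableEq ι] (hsymm : ∀ i j, H i j → H j i) (ρ ν : ℝ)
    (hdeg : ∀ i, (1 / 2 - ρ) * Fintype.card ι ≤ (Finset.univ.filter (H i)).card)
    (hind : ∀ S : Finset ι, (∀ i ∈ S, ∀ j ∈ S, ¬ H i j) →
      (S.card : ℝ) < (1 / 2 - ν / 2) * Fintype.card ι)
    (D : ℕ) (hD : (D : ℝ) ≤ (ν / 2 - ρ) * Fintype.card ι) (X : Finset ι) (hX : ¬ X ⊆ nbr H X) :
    X.card + D ≤ (nbr H X).card := by
  obtain ⟨v, hvX, hv⟩ := Finset.not_subset.1 hX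
  have h1 := hind (X \ nbr H X) (fun i hi j hj hij => (Finset.mem_sdiff.1 hj).2
    (mem_nbr.2 ⟨i, (Finset.mem_sdiff.1 hi).1, hij⟩))
  have hdisj : Disjoint (Finset.univ.filter (H v)) (X ∩ nbr H X) := by
    rw [Finset.disjoint_left]
    intro j hj hj'
    exact hv (mem_nbr.2 ⟨j, (Finset.mem_inter.1 hj').1, hsymm _ _ (Finset.mem_filter.1 hj).2⟩)
  have h2 : (Finset.univ.filter (H v)).card + (X ∩ nbr H X).card ≤ (nbr H X).card := by
    rw [← Finset.card_union_of_disjoint hdisj]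
    exact Finset.card_le_card (Finset.union_subset (filter_subset_nbr H hvX)
      Finset.inter_subset_right)
  have h3 := Finset.card_sdiff_add_card_inter X (nbr H X)
  have h4 := hdeg v
  have h2' : ((Finset.univ.filter (H v)).card : ℝ) + (X ∩ nbr H X).card ≤ (nbr H X).card := by
    exact_mod_cast h2
  have h3' : ((X \ nbr H X).card : ℝ) + (X ∩ nbr H X).card = X.card := by exact_mod_cast h3
  have h5 : (X.card : ℝ) + D ≤ (nbr H X).card := by linarith
  exact_mod_cast h5

lemma expansion_of_bipartite [DecidableEq ι] (hsymm : ∀ i j, H i j → H j i) (ζ : ℝ) (hζ : ζ ≤ 1 / 1000)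
    (A B : Finset ι) (hA : (A.card : ℝ) = Fintype.card ι / 2)
    (hB : (B.card : ℝ) = Fintype.card ι / 2) (hAB : ∀ i ∈ A, ∀ j, H i j → j ∈ B)
    (hBA : ∀ i ∈ B, ∀ j, H i j → j ∈ A)
    (hdeg : ∀ i, (1 / 32 - ζ) * Fintype.card ι ≤ (Finset.univ.filter (H i)).card)
    (hlow : ((Finset.univ.filter (fun i => ((Finset.univ.filter (H i)).card : ℝ) <
      (1 / 3 - ζ) * Fintype.card ι)).card : ℝ) ≤ (1 / 64 + ζ) * Fintype.card ι)
    (D : ℕ) (hD : (D : ℝ) ≤ Fintype.card ι / 1000) (X : Finset ι) (hXne : X.Nonempty)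
    (hXA : X ⊆ A) :
    B ⊆ nbr H X ∨ X.card + D ≤ ((nbr H X).filter (fun j => j ∈ B)).card := by
  set N := (Fintype.card ι : ℝ) with hN
  have hN0 : 0 ≤ N := Nat.cast_nonneg _
  have hζN : ζ * N ≤ N / 1000 := by
    have := mul_le_mul_of_nonneg_right hζ hN0
    linarith
  set Low := Finset.univ.filter (fun i => ((Finset.univ.filter (H i)).card : ℝ) <
    (1 / 3 - ζ) * N) with hLow
  have hsub : nbr H X ⊆ B := by
    intro j hj
    obtain ⟨i, hi, hij⟩ := mem_nbr.1 hj
    exact hAB i (hXA hi) j hij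
  have hfil : (nbr H X).filter (fun j => j ∈ B) = nbr H X :=
    Finset.filter_true_of_mem (fun j hj => hsub hj)
  rw [hfil]
  suffices h : B ⊆ nbr H X ∨ (X.card : ℝ) + D ≤ (nbr H X).card by
    rcases h with h | h
    · exact Or.inl h
    · exact Or.inr (by exact_mod_cast h)
  have hnb : ∀ i ∈ X, ((Finset.univ.filter (H i)).card : ℝ) ≤ (nbr H X).card := fun i hi => by
    exact_mod_cast Finset.card_le_card (filter_subset_nbr H hi)
  by_cases h1 : (X.card : ℝ) ≤ (1 / 64 + ζ) * N
  · obtain ⟨i, hi⟩ := hXne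
    have := hnb i hi
    have := hdeg i
    right; linarith
  by_cases h2 : (X.card : ℝ) ≤ (1 / 3 - 2 / 1000) * N
  · have : ∃ i ∈ X, i ∉ Low := by
      by_contra hcon
      push Not at hcon
      have : (X.card : ℝ) ≤ Low.card := by exact_mod_cast Finset.card_le_card hcon
      exact h1 (this.trans hlow)
    obtain ⟨i, hi, hiL⟩ := this
    have h3 : (1 / 3 - ζ) * N ≤ (Finset.univ.filter (H i)).card := by
      by_contra hlt
      exact hiL (Finset.mem_filter.2 ⟨Finset.mem_univ _, not_le.1 hlt⟩)
    have := hnb i hi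
    right; linarith
  push Not at h2
  by_cases hBsub : B ⊆ nbr H X
  · exact Or.inl hBsub
  right
  have hout : ∀ y ∈ B \ nbr H X, ((Finset.univ.filter (H y)).card : ℝ) + X.card ≤ N / 2 := by
    intro y hy
    rw [Finset.mem_sdiff] at hy
    have hdisj : Disjoint (Finset.univ.filter (H y)) X := by
      rw [Finset.disjoint_left]
      intro j hj hjX
      exact hy.2 (mem_nbr.2 ⟨j, hjX, hsymm _ _ (Finset.mem_filter.1 hj).2⟩)
    have : (Finset.univ.filter (H y)).card + X.card ≤ A.card := by
      rw [← Finset.card_union_of_disjoint hdisj]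
      exact Finset.card_le_card (Finset.union_subset
        (fun j hj => hBA y hy.1 j (Finset.mem_filter.1 hj).2) hXA)
    rw [← hA]
    exact_mod_cast this
  have hlowsub : B \ nbr H X ⊆ Low := by
    intro y hy
    refine Finset.mem_filter.2 ⟨Finset.mem_univ _, ?_⟩
    have := hout y hy
    linarith
  have h4 : ((B \ nbr H X).card : ℝ) ≤ (1 / 64 + ζ) * N :=
    le_trans (by exact_mod_cast Finset.card_le_card hlowsub) hlow
  obtain ⟨y, hyB, hyn⟩ := Finset.not_subset.1 hBsub
  have h5 := hout y (Finset.mem_sdiff.2 ⟨hyB, hyn⟩)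
  have h6 := hdeg y
  have h7 : (B.card : ℝ) ≤ (B \ nbr H X).card + (nbr H X).card := by
    have := Finset.card_sdiff_add_card_inter B (nbr H X)
    have h8 := Finset.card_le_card (Finset.inter_subset_right : B ∩ nbr H X ⊆ nbr H X)
    exact_mod_cast (by omega : B.card ≤ (B \ nbr H X).card + (nbr H X).card)
  linarith

end expansion

section keys
variable {r : ℕ} {ι : Type*} [Fintype ι]

lemma reach_eq_or_disjoint (Γ : SimpleGraph ι) (i j : ι) :
    reach Γ i = reach Γ j ∨ Disjoint (reach Γ i) (reach Γ j) := by
  by_cases h : Γ.Reachable i j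
  · left
    ext k
    simp only [reach, Finset.mem_filter, Finset.mem_univ, true_and]
    exact ⟨fun hk => h.symm.trans hk, fun hk => h.trans hk⟩
  · right
    rw [Finset.disjoint_left]
    intro k hk hk'
    simp only [reach, Finset.mem_filter, Finset.mem_univ, true_and] at hk hk'
    exact h (hk.trans hk'.symm)

open Classical in
lemma card_big_components_le (Γ : SimpleGraph ι) (s : ℝ) :
    ((Finset.univ.image (reach Γ)).filter (fun S => s ≤ S.card)).card * s ≤ Fintype.card ι := by
  set 𝓑 := (Finset.univ.image (reach Γ)).filter (fun S : Finset ι => s ≤ S.card) with h𝓑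
  have h1 : ∑ S ∈ 𝓑, S.card ≤ Fintype.card ι := by
    have h := Finset.card_biUnion (s := 𝓑) (t := id) ?_
    · refine h.symm.le.trans ?_
      exact Finset.card_le_univ _
    · intro S hS T hT hne
      obtain ⟨i, -, rfl⟩ := Finset.mem_image.1 (Finset.mem_filter.1 hS).1
      obtain ⟨j, -, rfl⟩ := Finset.mem_image.1 (Finset.mem_filter.1 hT).1
      exact (reach_eq_or_disjoint Γ i j).resolve_left hne
  have h2 : (𝓑.card : ℝ) * s ≤ ∑ S ∈ 𝓑, (S.card : ℝ) := by
    rw [← nsmul_eq_mul]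
    exact Finset.card_nsmul_le_sum _ _ _ (fun S hS => (Finset.mem_filter.1 hS).2)
  exact h2.trans (by exact_mod_cast h1)

/-- The edges of `bigAdj` can be labelled by few keys identifying colour and component. -/
lemma exists_component_keys (hr : 1 ≤ r) (Γ : Fin r → SimpleGraph ι) (μ : ℝ) (hμ : 0 < μ)
    (hN : 0 < Fintype.card ι) :
    ∃ (k : ℕ) (colr : ι → ι → Fin r) (key : ι → ι → Fin k), (k : ℝ) ≤ r ^ 2 / μ + 1 ∧
      (∀ i j, bigAdj Γ μ i j → (Γ (colr i j)).Adj i j) ∧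
      ∀ i j i' j', bigAdj Γ μ i j → bigAdj Γ μ i' j' → key i j = key i' j' →
        colr i j = colr i' j' ∧ (Γ (colr i j)).Reachable j j' := by
  classical
  have hr' : (0 : ℝ) < r := by exact_mod_cast hr
  have hN' : (0 : ℝ) < Fintype.card ι := by exact_mod_cast hN
  set s : ℝ := μ * Fintype.card ι / r with hs
  set 𝓚 : Finset (Σ _ : Fin r, Finset ι) := Finset.univ.sigma
    (fun c => (Finset.univ.image (reach (Γ c))).filter (fun S : Finset ι => s ≤ S.card)) with h𝓚
  have hcard : (𝓚.card : ℝ) ≤ r ^ 2 / μ := by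
    rw [h𝓚, Finset.card_sigma]
    push_cast
    have h1 : ∀ c : Fin r, (((Finset.univ.image (reach (Γ c))).filter
        (fun S : Finset ι => s ≤ S.card)).card : ℝ) ≤ r / μ := by
      intro c
      have h2 := card_big_components_le (Γ c) s
      rw [hs, mul_div_assoc', div_le_iff₀ hr'] at h2
      rw [le_div_iff₀ hμ]
      refine le_of_mul_le_mul_right ?_ hN'
      linarith
    refine (Finset.sum_le_sum (fun c _ => h1 c)).trans ?_
    rw [Finset.sum_const, nsmul_eq_mul, Finset.card_univ, Fintype.card_fin]
    apply le_of_eq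
    ring
  have hcol : ∀ i j, ∃ c, bigAdj Γ μ i j →
      (Γ c).Adj i j ∧ μ * Fintype.card ι ≤ r * (reach (Γ c) i).card := by
    intro i j
    by_cases h : bigAdj Γ μ i j
    · obtain ⟨c, hc⟩ := h
      exact ⟨c, fun _ => hc⟩
    · exact ⟨⟨0, hr⟩, fun h' => absurd h' h⟩
  choose colr hcolr using hcol
  have hmem : ∀ i j, bigAdj Γ μ i j →
      (⟨colr i j, reach (Γ (colr i j)) i⟩ : Σ _ : Fin r, Finset ι) ∈ 𝓚 := by
    intro i j h
    refine Finset.mem_sigma.2 ⟨Finset.mem_univ _, Finset.mem_filter.2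
      ⟨Finset.mem_image_of_mem _ (Finset.mem_univ _), ?_⟩⟩
    change s ≤ (reach (Γ (colr i j)) i).card
    rw [hs, div_le_iff₀ hr', mul_comm _ (r : ℝ)]
    exact (hcolr i j h).2
  let e := Fintype.equivFin (Option 𝓚)
  refine ⟨Fintype.card (Option 𝓚), colr, fun i j => e (if h : bigAdj Γ μ i j then
    some ⟨_, hmem i j h⟩ else none), ?_, fun i j h => (hcolr i j h).1, ?_⟩
  · rw [Fintype.card_option, Fintype.card_coe]
    push_cast
    linarith
  · intro i j i' j' h h' heq
    have heq' := e.injective heq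
    rw [dif_pos h, dif_pos h'] at heq'
    have hp : (⟨colr i j, reach (Γ (colr i j)) i⟩ : Σ _ : Fin r, Finset ι) =
      ⟨colr i' j', reach (Γ (colr i' j')) i'⟩ := congrArg Subtype.val (Option.some.inj heq')
    have hc : colr i j = colr i' j' := congrArg Sigma.fst hp
    have hreach : reach (Γ (colr i j)) i = reach (Γ (colr i' j')) i' := congrArg Sigma.snd hp
    refine ⟨hc, ?_⟩
    have hmem' : j' ∈ reach (Γ (colr i j)) i := by
      rw [hreach]
      exact Finset.mem_filter.2 ⟨Finset.mem_univ _, (hcolr i' j' h').1.reachable⟩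
    exact (hcolr i j h).1.reachable.symm.trans (Finset.mem_filter.1 hmem').2

end keys

lemma mul_le_mul_of_slack {ν : ℝ} (hν1 : ν ≤ 1) {N D U K a : ℕ}
    (hD : ν * N / 8 ≤ D) (h : ((K + a : ℕ) : ℝ) * 16 ≤ ν * U) :
    a ≤ U ∧ N * (K + a) ≤ D * (U - K) := by
  have hU0 : (0 : ℝ) ≤ U := Nat.cast_nonneg _
  have hνU : ν * U ≤ U := by nlinarith only [hν1, hU0]
  have hle : K + a ≤ U := by
    have : ((K + a : ℕ) : ℝ) ≤ U := by
      have : (0 : ℝ) ≤ ((K + a : ℕ) : ℝ) := Nat.cast_nonneg _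
      linarith
    exact_mod_cast this
  refine ⟨by omega, ?_⟩
  have hK : K ≤ U := by omega
  have h2 : (U : ℝ) / 2 ≤ ((U - K : ℕ) : ℝ) := by
    rw [Nat.cast_sub hK]
    push_cast at h
    have : (0 : ℝ) ≤ K := Nat.cast_nonneg _
    have : (0 : ℝ) ≤ a := Nat.cast_nonneg _
    linarith
  have h3 : ν * N / 8 * (U / 2) ≤ (D : ℝ) * ((U - K : ℕ) : ℝ) :=
    mul_le_mul hD h2 (by positivity) (Nat.cast_nonneg _)
  have h4 : (N : ℝ) * ((K + a : ℕ) : ℝ) ≤ D * ((U - K : ℕ) : ℝ) := by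
    have := mul_le_mul_of_nonneg_left h (Nat.cast_nonneg N : (0 : ℝ) ≤ N)
    linarith
  exact_mod_cast h4

section hall
variable {ι : Type*} [Fintype ι] [DecidableEq ι] (H : ι → ι → Prop) [DecidableRel H]

lemma perm_distributes_of_expansion (hsymm : ∀ i j, H i j → H j i) (sd : ι → ℤ) {ν : ℝ}
    (hν1 : ν ≤ 1) (D : ℕ) (hD : ν * Fintype.card ι / 8 ≤ D)
    (hexp : ∀ X : Finset ι, ¬ X ⊆ nbr H X → X.card + D ≤ (nbr H X).card)
    (hcl : ∀ X : Finset ι, X.Nonempty → nbr H X ⊆ X → Fintype.card ι < 3 * X.card) :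
    (∃ σ : Equiv.Perm ι, ∀ i, H i (σ i)) ∧ ∀ U K q : ℕ,
      ((K + q + 2 * Fintype.card ι + 5 : ℕ) : ℝ) * 16 ≤ ν * U → Distributes H sd U K q := by
  refine ⟨exists_perm_of_card_le_nbr H (fun X => ?_), fun U K q h => ?_⟩
  · by_cases hX : X ⊆ nbr H X
    · exact Finset.card_le_card hX
    · exact (Nat.le_add_right _ _).trans (hexp X hX)
  · have h1 := mul_le_mul_of_slack hν1 (K := K + 4) (a := q + 2 * Fintype.card ι + 1) hD
      (by convert h using 3; omega)
    have h2 := mul_le_mul_of_slack hν1 (K := 0) (a := K + q + 2 * Fintype.card ι + 5) hD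
      (by convert h using 3; omega)
    exact distributes_of_expansion H hsymm sd U K q D hexp hcl (by omega)
      (le_trans (Nat.mul_le_mul_left _ (by omega)) h1.2)

lemma perm_distributes_of_bipartite (hsymm : ∀ i j, H i j → H j i) (sd : ι → ℤ)
    (hsd : ∀ i, sd i = 1 ∨ sd i = -1) (hsd0 : ∑ i, sd i = 0) (hH : ∀ i j, H i j → sd i + sd j = 0)
    {ν : ℝ} (hν1 : ν ≤ 1) (D : ℕ) (hD : ν * Fintype.card ι / 8 ≤ D)
    (hD' : (D : ℝ) ≤ Fintype.card ι / 1000) (hN : 0 < Fintype.card ι)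
    (ζ : ℝ) (hζ : ζ ≤ 1 / 1000)
    (hdeg : ∀ i, (1 / 32 - ζ) * Fintype.card ι ≤ (Finset.univ.filter (H i)).card)
    (hlow : ((Finset.univ.filter (fun i => ((Finset.univ.filter (H i)).card : ℝ) <
      (1 / 3 - ζ) * Fintype.card ι)).card : ℝ) ≤ (1 / 64 + ζ) * Fintype.card ι) :
    (∃ σ : Equiv.Perm ι, ∀ i, H i (σ i)) ∧ ∀ U K q : ℕ,
      ((K + q + 2 * Fintype.card ι + 5 : ℕ) : ℝ) * 16 ≤ ν * U → Distributes H sd U K q := by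
  set A := Finset.univ.filter (fun i => sd i = 1) with hAdef
  set B := Finset.univ.filter (fun i => sd i = -1) with hBdef
  have hAm : ∀ i, i ∈ A ↔ sd i = 1 := fun i => by simp [hAdef]
  have hBm : ∀ i, i ∈ B ↔ sd i = -1 := fun i => by simp [hBdef]
  have hcompl : B = Finset.univ.filter (fun i => ¬ sd i = 1) := by
    ext i
    rcases hsd i with h | h <;> simp [hBdef, h]
  have hsum : A.card + B.card = Fintype.card ι := by
    rw [hcompl, hAdef, Finset.card_filter_add_card_filter_not, Finset.card_univ]
  have hdiff : (A.card : ℤ) - B.card = 0 := by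
    have h1 : ∀ i, sd i = (if sd i = 1 then 1 else 0) - (if sd i = -1 then 1 else 0) := by
      intro i
      rcases hsd i with h | h <;> simp [h]
    rw [Finset.sum_congr rfl (fun i _ => h1 i), Finset.sum_sub_distrib, Finset.sum_boole,
      Finset.sum_boole] at hsd0
    exact_mod_cast hsd0
  have hAB' : A.card = B.card := by omega
  have hsumR : (A.card : ℝ) + B.card = Fintype.card ι := by exact_mod_cast hsum
  have hABR : (A.card : ℝ) = B.card := by exact_mod_cast hAB'
  have hA : (A.card : ℝ) = Fintype.card ι / 2 := by linarith
  have hB : (B.card : ℝ) = Fintype.card ι / 2 := by linarith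
  have hAB : ∀ i ∈ A, ∀ j, H i j → j ∈ B := by
    intro i hi j hij
    have := hH i j hij
    rw [hAm] at hi; rw [hBm]; omega
  have hBA : ∀ i ∈ B, ∀ j, H i j → j ∈ A := by
    intro i hi j hij
    have := hH i j hij
    rw [hBm] at hi; rw [hAm]; omega
  have hexpA := expansion_of_bipartite H hsymm ζ hζ A B hA hB hAB hBA hdeg hlow D hD'
  have hexpB := expansion_of_bipartite H hsymm ζ hζ B A hB hA hBA hAB hdeg hlow D hD'
  have hhalf : ∀ S T : Finset ι, S.card = T.card → (∀ X : Finset ι, X.Nonempty → X ⊆ S →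
      T ⊆ nbr H X ∨ X.card + D ≤ ((nbr H X).filter (fun j => j ∈ T)).card) →
      ∀ X ⊆ S, X.card ≤ ((nbr H X).filter (fun j => j ∈ T)).card := by
    intro S T hST h X hX
    rcases X.eq_empty_or_nonempty with rfl | hne
    · simp
    rcases h X hne hX with h1 | h1
    · have h2 : T ⊆ (nbr H X).filter (fun j => j ∈ T) :=
        fun j hj => Finset.mem_filter.2 ⟨h1 hj, hj⟩
      exact (Finset.card_le_card hX).trans (hST.le.trans (Finset.card_le_card h2))
    · omega
  refine ⟨exists_perm_of_card_le_nbr H (fun X => ?_), fun U K q h => ?_⟩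
  · have h1 := hhalf A B hAB' hexpA (X.filter (· ∈ A)) (fun i hi => (Finset.mem_filter.1 hi).2)
    have h2 := hhalf B A hAB'.symm hexpB (X.filter (· ∈ B)) (fun i hi => (Finset.mem_filter.1 hi).2)
    have h3 : X.card = (X.filter (· ∈ A)).card + (X.filter (· ∈ B)).card := by
      rw [← Finset.card_filter_add_card_filter_not (s := X) (· ∈ A)]
      congr 2
      refine Finset.filter_congr (fun i _ => ?_)
      rw [hAm, hBm]
      rcases hsd i with h | h <;> simp [h]
    have h4 : ((nbr H X).filter (· ∈ A)).card + ((nbr H X).filter (· ∈ B)).card ≤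
        (nbr H X).card := by
      rw [← Finset.card_union_of_disjoint]
      · exact Finset.card_le_card (Finset.union_subset (Finset.filter_subset _ _)
          (Finset.filter_subset _ _))
      · rw [Finset.disjoint_left]
        intro i hi hi'
        have e1 := (hAm i).1 (Finset.mem_filter.1 hi).2
        have e2 := (hBm i).1 (Finset.mem_filter.1 hi').2
        omega
    have h5 := Finset.card_le_card (Finset.filter_subset_filter (· ∈ B)
      (nbr_mono (H := H) (Finset.filter_subset (· ∈ A) X)))
    have h6 := Finset.card_le_card (Finset.filter_subset_filter (· ∈ A)
      (nbr_mono (H := H) (Finset.filter_subset (· ∈ B) X)))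
    omega
  · have h1 := mul_le_mul_of_slack hν1 (K := K + q) (a := 2 * Fintype.card ι + 5) hD
      (by convert h using 3; omega)
    have hApos : 0 < A.card := by omega
    have hBpos : 0 < B.card := by omega
    obtain ⟨a, ha⟩ := Finset.card_pos.1 hApos
    obtain ⟨b, hb⟩ := Finset.card_pos.1 hBpos
    refine distributes_of_bipartite H sd U K q D hsd ⟨a, (hAm a).1 ha⟩ ⟨b, (hBm b).1 hb⟩ ?_
      (le_trans (Nat.mul_le_mul_left _ (by omega)) h1.2)
    intro X hne hX
    rcases hexpA X hne (fun i hi => (hAm i).2 (hX i hi)) with h2 | h2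
    · exact Or.inl (fun j hj => h2 ((hBm j).2 hj))
    · refine Or.inr (h2.trans (Finset.card_le_card ?_))
      intro j hj
      rw [Finset.mem_filter] at hj ⊢
      exact ⟨hj.1, (hBm j).1 hj.2⟩

end hall

open Classical in
/-- Disjoint clusters of equal size covering almost all vertices, each in few irregular pairs. -/
structure ClusterSystem [Fintype V] [DecidableEq V] {r : ℕ} {ι : Type*} [Fintype ι] (R : Fin r → V → V → Prop)
    [∀ c, DecidableRel (R c)] (ε : ℝ) (cl : ι → Finset V) (m : ℕ) : Prop where
  pos : 0 < m
  card_eq : ∀ i, (cl i).card = m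
  disj : ∀ i j, i ≠ j → Disjoint (cl i) (cl j)
  small : (m : ℝ) ≤ ε * Fintype.card V
  unc : ((Finset.univ \ Finset.univ.biUnion cl).card : ℝ) ≤ 2 * ε * Fintype.card V
  irr : ∀ i, (m : ℝ) * (Finset.univ.filter (fun j => Irreg R ε (cl i) (cl j) ∨
    Irreg R ε (cl j) (cl i))).card ≤ ε * Fintype.card V

section system
variable [Fintype V] [DecidableEq V] {r : ℕ} {ι : Type*} [Fintype ι] {R : Fin r → V → V → Prop}
  [∀ c, DecidableRel (R c)] {ε : ℝ} {cl : ι → Finset V} {m : ℕ}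

lemma ClusterSystem.card_mul_add (h : ClusterSystem R ε cl m) :
    Fintype.card ι * m + (Finset.univ \ Finset.univ.biUnion cl).card = Fintype.card V := by
  have h1 : (Finset.univ.biUnion cl).card = Fintype.card ι * m := by
    rw [Finset.card_biUnion (fun i _ j _ hij => h.disj i j hij),
      Finset.sum_congr rfl (fun i _ => h.card_eq i), Finset.sum_const, smul_eq_mul,
      Finset.card_univ]
  rw [← h1, Finset.card_sdiff_of_subset (Finset.subset_univ _), Finset.card_univ]
  exact Nat.add_sub_cancel' (Finset.card_le_univ _)

lemma ClusterSystem.card_mul_le (h : ClusterSystem R ε cl m) :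
    Fintype.card ι * m ≤ Fintype.card V := by
  have := h.card_mul_add
  omega

lemma ClusterSystem.le_card_mul (h : ClusterSystem R ε cl m) :
    (1 - 2 * ε) * (Fintype.card V : ℝ) ≤ Fintype.card ι * m := by
  have h1 := h.card_mul_add
  have h2 : (Fintype.card ι : ℝ) * m + (Finset.univ \ Finset.univ.biUnion cl).card =
    Fintype.card V := by exact_mod_cast h1
  have h3 := h.unc
  linarith

lemma ClusterSystem.card_pos (h : ClusterSystem R ε cl m) (hV : 0 < Fintype.card V)
    (hε : 2 * ε < 1) : 0 < Fintype.card ι := by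
  have h1 := h.le_card_mul
  have hV' : (0 : ℝ) < Fintype.card V := by exact_mod_cast hV
  have h2 : 0 < (1 - 2 * ε) * (Fintype.card V : ℝ) := mul_pos (by linarith) hV'
  by_contra h0
  rw [Nat.eq_zero_of_not_pos h0] at h1
  norm_num at h1
  linarith

lemma ClusterSystem.eight_le (h : ClusterSystem R ε cl m) (hV : 0 < Fintype.card V)
    {ν : ℝ} (hε : 16 * ε ≤ ν) (hε' : 4 * ε ≤ 1) : 8 ≤ ν * Fintype.card ι := by
  have hV' : (0 : ℝ) < Fintype.card V := by exact_mod_cast hV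
  have hN : (0 : ℝ) ≤ Fintype.card ι := Nat.cast_nonneg _
  have h1 := h.le_card_mul
  have h2 := mul_le_mul_of_nonneg_left h.small hN
  have h3 : (1 / 2) * (Fintype.card V : ℝ) ≤ (1 - 2 * ε) * (Fintype.card V : ℝ) :=
    mul_le_mul_of_nonneg_right (by linarith) hV'.le
  have h4 : 1 / 2 ≤ (Fintype.card ι : ℝ) * ε := by
    refine le_of_mul_le_mul_right ?_ hV'
    linarith
  have h5 := mul_le_mul_of_nonneg_right hε hN
  linarith

end system

section balance
variable [Fintype V] [DecidableEq V]

lemma card_filter_mul_le {𝓕 : Finset (Finset V)} (hd : DisjFam 𝓕) {m : ℕ}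
    (hm : ∀ C ∈ 𝓕, C.card = m) (side : V → Bool) (f : Finset V → Bool)
    (hf : ∀ C ∈ 𝓕, ∀ x ∈ C, side x = f C) (b : Bool) :
    (𝓕.filter (fun C => f C = b)).card * m ≤ (Finset.univ.filter (fun x => side x = b)).card := by
  have h1 : ((𝓕.filter (fun C => f C = b)).biUnion id).card =
      (𝓕.filter (fun C => f C = b)).card * m := by
    rw [Finset.card_biUnion (t := id) (fun C hC D hD hne =>
      hd C (Finset.mem_filter.1 hC).1 D (Finset.mem_filter.1 hD).1 hne)]
    simp only [id]
    rw [Finset.sum_congr rfl (fun C hC => hm C (Finset.mem_filter.1 hC).1), Finset.sum_const,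
      smul_eq_mul]
  rw [← h1]
  refine Finset.card_le_card (fun x hx => ?_)
  obtain ⟨C, hC, hxC⟩ := Finset.mem_biUnion.1 hx
  obtain ⟨hC1, hC2⟩ := Finset.mem_filter.1 hC
  exact Finset.mem_filter.2 ⟨Finset.mem_univ _, (hf C hC1 x hxC).trans hC2⟩

lemma exists_balanced_subfamily {𝓕 : Finset (Finset V)} (hd : DisjFam 𝓕) {m : ℕ}
    (hm : ∀ C ∈ 𝓕, C.card = m) (side : V → Bool) (f : Finset V → Bool)
    (hf : ∀ C ∈ 𝓕, ∀ x ∈ C, side x = f C)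
    (hbal : (Finset.univ.filter (fun x => side x = true)).card =
      (Finset.univ.filter (fun x => side x = false)).card) :
    ∃ 𝓠 ⊆ 𝓕, (𝓠.filter (fun C => f C = true)).card = (𝓠.filter (fun C => f C = false)).card ∧
      (uncov 𝓠).card ≤ 2 * (uncov 𝓕).card := by
  set 𝓣 := 𝓕.filter (fun C => f C = true) with h𝓣
  set 𝓢 := 𝓕.filter (fun C => f C = false) with h𝓢
  have hneg : ∀ {α : Type _} (s : Finset α) (g : α → Bool),
      (s.filter (fun C => g C = true)).card + (s.filter (fun C => g C = false)).card = s.card := by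
    intro α s g
    rw [← Finset.card_filter_add_card_filter_not (s := s) (fun C => g C = true)]
    simp only [Bool.not_eq_true]
  obtain ⟨𝓐, h𝓐, h𝓐c⟩ := Finset.exists_subset_card_eq (min_le_left 𝓣.card 𝓢.card)
  obtain ⟨𝓑, h𝓑, h𝓑c⟩ := Finset.exists_subset_card_eq (min_le_right 𝓣.card 𝓢.card)
  have hsub : 𝓐 ∪ 𝓑 ⊆ 𝓕 := Finset.union_subset (h𝓐.trans (Finset.filter_subset _ _))
    (h𝓑.trans (Finset.filter_subset _ _))
  have hA : ∀ C ∈ 𝓐, f C = true := fun C hC => (Finset.mem_filter.1 (h𝓐 hC)).2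
  have hB : ∀ C ∈ 𝓑, f C = false := fun C hC => (Finset.mem_filter.1 (h𝓑 hC)).2
  have e1 : (𝓐 ∪ 𝓑).filter (fun C => f C = true) = 𝓐 := by
    ext C
    rw [Finset.mem_filter, Finset.mem_union]
    constructor
    · rintro ⟨h | h, hC⟩
      · exact h
      · rw [hB C h] at hC; cases hC
    · exact fun h => ⟨Or.inl h, hA C h⟩
  have e2 : (𝓐 ∪ 𝓑).filter (fun C => f C = false) = 𝓑 := by
    ext C
    rw [Finset.mem_filter, Finset.mem_union]
    constructor
    · rintro ⟨h | h, hC⟩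
      · rw [hA C h] at hC; cases hC
      · exact h
    · exact fun h => ⟨Or.inr h, hB C h⟩
  refine ⟨𝓐 ∪ 𝓑, hsub, by rw [e1, e2, h𝓐c, h𝓑c], ?_⟩
  have hd' : DisjFam (𝓐 ∪ 𝓑) := fun C hC D hD => hd C (hsub hC) D (hsub hD)
  have n1 := card_mul_add_card_uncov hd hm
  have n2 := card_mul_add_card_uncov hd' (fun C hC => hm C (hsub hC))
  have n3 := card_filter_mul_le hd hm side f hf true
  have n4 := card_filter_mul_le hd hm side f hf false
  have n5 : (Finset.univ.filter (fun x => side x = true)).card +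
    (Finset.univ.filter (fun x => side x = false)).card = Fintype.card V := by
    rw [← Finset.card_univ, ← Finset.card_filter_add_card_filter_not (s := Finset.univ)
      (fun x => side x = true)]
    simp only [Bool.not_eq_true]
  have n6 := hneg 𝓕 f
  have n7 := hneg (𝓐 ∪ 𝓑) f
  rw [e1, e2, h𝓐c, h𝓑c] at n7
  rw [← h𝓣] at n3 n6
  rw [← h𝓢] at n4 n6
  rw [← n6] at n1
  rw [← n7] at n2
  rw [add_mul] at n1 n2
  rcases le_total 𝓣.card 𝓢.card with h | h
  · rw [min_eq_left h] at n2
    omega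
  · rw [min_eq_right h] at n2
    omega

end balance

theorem exists_clusterSystem (r : ℕ) (ε : ℝ) (hε : 0 < ε) (hε1 : ε ≤ 1) :
    ∃ K n₀ : ℕ, 0 < K ∧ ∀ (V : Type) [Fintype V] [DecidableEq V], n₀ ≤ Fintype.card V →
      ∀ (R : Fin r → V → V → Prop) [∀ c, DecidableRel (R c)] (side : V → Bool),
        ∃ (N m : ℕ) (cl : Fin N → Finset V) (f : Fin N → Bool), ClusterSystem R ε cl m ∧
          (∀ i, ∀ x ∈ cl i, side x = f i) ∧ Fintype.card V ≤ K * m ∧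
          ((Finset.univ.filter (fun x => side x = true)).card =
            (Finset.univ.filter (fun x => side x = false)).card →
            (Finset.univ.filter (fun i => f i = true)).card =
              (Finset.univ.filter (fun i => f i = false)).card) := by
  obtain ⟨K, n₀, hK, hreg⟩ := exists_regular_family r ε hε hε1
  refine ⟨K, n₀, hK, fun V _ _ hn R _ side => ?_⟩
  obtain ⟨𝓕, m, hm0, hm, hd, hconst, hKm, hmε, hunc, hirr⟩ := hreg V hn R side
  let f : Finset V → Bool := fun C => decide (∃ x ∈ C, side x = true)
  have hf : ∀ C ∈ 𝓕, ∀ x ∈ C, side x = f C := by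
    intro C hC x hx
    cases hx' : side x with
    | true => exact (decide_eq_true ⟨x, hx, hx'⟩).symm
    | false =>
      refine (decide_eq_false ?_).symm
      rintro ⟨y, hy, hy'⟩
      rw [hconst C hC y hy x hx, hx'] at hy'
      cases hy'
  have hex : ∃ 𝓠 ⊆ 𝓕, (uncov 𝓠).card ≤ 2 * (uncov 𝓕).card ∧
      ((Finset.univ.filter (fun x => side x = true)).card =
        (Finset.univ.filter (fun x => side x = false)).card →
        (𝓠.filter (fun C => f C = true)).card = (𝓠.filter (fun C => f C = false)).card) := by
    by_cases hbal : (Finset.univ.filter (fun x => side x = true)).card =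
        (Finset.univ.filter (fun x => side x = false)).card
    · obtain ⟨𝓠, h1, h2, h3⟩ := exists_balanced_subfamily hd hm side f hf hbal
      exact ⟨𝓠, h1, h3, fun _ => h2⟩
    · exact ⟨𝓕, Finset.Subset.refl _, by omega, fun h => absurd h hbal⟩
  obtain ⟨𝓠, hsub, hunc', hbal⟩ := hex
  let e := 𝓠.equivFin
  have hmem : ∀ i, (e.symm i : Finset V) ∈ 𝓕 := fun i => hsub (e.symm i).2
  have hinj : Function.Injective (fun i => (e.symm i : Finset V)) :=
    Subtype.val_injective.comp e.symm.injective
  have hcount : ∀ b, (Finset.univ.filter (fun i => f (e.symm i) = b)).card =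
      (𝓠.filter (fun C => f C = b)).card := by
    intro b
    rw [← Finset.card_image_of_injective _ hinj]
    congr 1
    ext C
    simp only [Finset.mem_image, Finset.mem_filter, Finset.mem_univ, true_and]
    constructor
    · rintro ⟨i, hi, rfl⟩
      exact ⟨(e.symm i).2, hi⟩
    · rintro ⟨hC, hfC⟩
      exact ⟨e ⟨C, hC⟩, by simpa using hfC, by simp⟩
  refine ⟨𝓠.card, m, fun i => e.symm i, fun i => f (e.symm i), ⟨hm0, fun i => hm _ (hmem i),
    fun i j hij => hd _ (hmem i) _ (hmem j) (hinj.ne hij), hmε, ?_, fun i => ?_⟩,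
    fun i => hf _ (hmem i), hKm, fun h => by rw [hcount, hcount]; exact hbal h⟩
  · have h1 : (Finset.univ \ Finset.univ.biUnion (fun i => (e.symm i : Finset V))).card ≤
        (uncov 𝓠).card := by
      refine Finset.card_le_card (fun x hx => ?_)
      refine Finset.mem_filter.2 ⟨Finset.mem_univ _, fun C hC hxC => ?_⟩
      refine (Finset.mem_sdiff.1 hx).2 (Finset.mem_biUnion.2 ⟨e ⟨C, hC⟩, Finset.mem_univ _, ?_⟩)
      simpa using hxC
    have h2 : ((Finset.univ \ Finset.univ.biUnion (fun i => (e.symm i : Finset V))).card : ℝ) ≤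
        2 * (uncov 𝓕).card := by exact_mod_cast h1.trans hunc'
    linarith
  · classical
    refine le_trans (mul_le_mul_of_nonneg_left (Nat.cast_le.2 ?_) (Nat.cast_nonneg m))
      (hirr _ (hmem i))
    rw [← Finset.card_image_of_injective _ hinj]
    refine Finset.card_le_card (fun C hC => ?_)
    obtain ⟨j, hj, rfl⟩ := Finset.mem_image.1 hC
    rw [Finset.mem_filter] at hj
    rw [irregNbrs, Finset.mem_filter]
    exact ⟨hmem j, hj.2⟩

lemma exists_rel_of_redGraph {r : ℕ} {ι : Type*} (R : Fin r → V → V → Prop)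
    [∀ c, DecidableRel (R c)] {ε d : ℝ} {cl : ι → Finset V} {m : ℕ} (hd : 0 < d) (hm0 : 0 < m) (hm : ∀ i, (cl i).card = m)
    {c : Fin r} {i j : ι} (h : (redGraph R ε d cl c).Adj i j) : ∃ u ∈ cl i, ∃ v ∈ cl j, R c u v := by
  have h1 := h.2.2.1
  rw [hm, hm] at h1
  have hm0' : (0 : ℝ) < m := by exact_mod_cast hm0
  have h2 : (0 : ℝ) < pairs (R c) (cl i) (cl j) := lt_of_lt_of_le (by positivity) h1
  have h3 : 0 < pairs (R c) (cl i) (cl j) := by exact_mod_cast h2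
  obtain ⟨p, hp⟩ := Finset.card_pos.1 h3
  obtain ⟨hp1, hp2⟩ := Finset.mem_filter.1 hp
  obtain ⟨hp3, hp4⟩ := Finset.mem_product.1 hp1
  exact ⟨p.1, hp3, p.2, hp4, hp2⟩

lemma exists_floor_expansion {ν : ℝ} {N : ℕ} (h : 8 ≤ ν * N) :
    ∃ D : ℕ, ν * N / 8 ≤ D ∧ (D : ℝ) ≤ ν * N / 4 := by
  refine ⟨⌊ν * N / 4⌋₊, ?_, Nat.floor_le (by linarith)⟩
  have := Nat.lt_floor_add_one (ν * N / 4)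
  linarith

section types
variable [Fintype V] [DecidableEq V] {r : ℕ} {ι : Type*} [Fintype ι] [DecidableEq ι]
  (G : SimpleGraph V) (R : Fin r → V → V → Prop) [∀ c, DecidableRel (R c)]
  {μ ν ε d : ℝ} {cl : ι → Finset V} {m : ℕ}

open Classical in
lemma perm_distributes_of_robMat1 (hr : 1 ≤ r) (hRG : ∀ u v, G.Adj u v → ∃ c, R c u v)
    (hsymm : ∀ c u v, R c u v → R c v u) (hV : 0 < Fintype.card V)
    (hμ : 0 < μ) (hμν : μ ≤ ν / 20) (hν1 : ν ≤ 1 / 1000) (hε : 0 < ε) (hd : 0 < d)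
    (hsmall : 4 * ε + 2 * d * r ≤ ν / 10 ^ 5) (hC : ClusterSystem R ε cl m)
    (hdeg : ∀ v, (1 / 2 - μ) * Fintype.card V ≤
      (Finset.univ.filter (fun y => ∃ c, R c v y)).card)
    (hG : ∀ S : Set V, (1 / 2 - ν) * (Nat.card V : ℝ) ≤ (S.ncard : ℝ) →
      ν * (Nat.card V : ℝ) ^ 2 ≤ (edgesIn G S : ℝ)) (sd : ι → ℤ) :
    (∃ σ : Equiv.Perm ι, ∀ i, bigAdj (redGraph R ε d cl) μ i (σ i)) ∧ ∀ U K q : ℕ,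
      ((K + q + 2 * Fintype.card ι + 5 : ℕ) : ℝ) * 16 ≤ ν * U →
        Distributes (bigAdj (redGraph R ε d cl) μ) sd U K q := by
  have hdr : 0 ≤ 2 * d * r := by positivity
  have hNpos := hC.card_pos hV (by linarith)
  have hN0 : (0 : ℝ) < Fintype.card ι := by exact_mod_cast hNpos
  obtain ⟨D, hD1, hD2⟩ := exists_floor_expansion (hC.eight_le hV (ν := ν) (by linarith)
    (by linarith))
  have hNm : (Fintype.card ι : ℝ) * m ≤ Fintype.card V := by exact_mod_cast hC.card_mul_le
  have hsymmH : ∀ i j, bigAdj (redGraph R ε d cl) μ i j → bigAdj (redGraph R ε d cl) μ j i :=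
    fun i j h => bigAdj_symm _ _ h
  have hdegH : ∀ i, (1 / 2 - (2 * μ + ν / 10)) * Fintype.card ι ≤
      (Finset.univ.filter (bigAdj (redGraph R ε d cl) μ i)).card := by
    intro i
    have h := le_card_bigAdj R hsymm ε d μ hd.le hμ.le hr cl m hC.pos hC.card_eq hNm hC.small
      hC.unc i (hC.irr i) (cl i) (Finset.Subset.refl _) 1 (ν / 10) (1 / 2 - μ) one_pos
      (by rw [hC.card_eq, one_mul]) (by linarith) (by linarith) (by linarith)
      (fun x _ => hdeg x)
    convert h using 2
    ring
  have hind := card_lt_of_independent R G hRG hsymm ε d μ ν hε.le hd.le hμ.le hr cl hC.disj m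
    hC.card_eq hNm hV hC.small hC.le_card_mul hC.irr (by linarith) (by linarith) (by linarith) hG
  refine perm_distributes_of_expansion _ hsymmH sd (by linarith) D hD1
    (expansion_of_large_degree _ hsymmH (2 * μ + ν / 10) ν hdegH hind D ?_) ?_
  · refine hD2.trans ?_
    have : ν / 4 * Fintype.card ι ≤ (ν / 2 - (2 * μ + ν / 10)) * Fintype.card ι :=
      mul_le_mul_of_nonneg_right (by linarith) hN0.le
    linarith
  · rintro X ⟨i, hi⟩ hX
    have h1 := hdegH i
    have h2 : ((Finset.univ.filter (bigAdj (redGraph R ε d cl) μ i)).card : ℝ) ≤ X.card := by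
      exact_mod_cast Finset.card_le_card ((filter_subset_nbr _ hi).trans hX)
    have h3 : 2 / 5 * (Fintype.card ι : ℝ) ≤ (1 / 2 - (2 * μ + ν / 10)) * Fintype.card ι :=
      mul_le_mul_of_nonneg_right (by linarith) hN0.le
    have h4 : (Fintype.card ι : ℝ) < 3 * X.card := by linarith
    exact_mod_cast h4

open Classical in
lemma perm_distributes_of_robMat2 (hr : 1 ≤ r)
    (hsymm : ∀ c u v, R c u v → R c v u) (hV : 0 < Fintype.card V)
    (hμ : 0 < μ) (hμν : μ ≤ ν / 20) (hν1 : ν ≤ 1 / 1000) (hε : 0 < ε) (hd : 0 < d)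
    (hsmall : 4 * ε + 2 * d * r ≤ ν / 10 ^ 5) (hC : ClusterSystem R ε cl m)
    (hdeg : ∀ v, (1 / 32 - μ) * Fintype.card V ≤
      (Finset.univ.filter (fun y => ∃ c, R c v y)).card)
    (hlow : ((Finset.univ.filter (fun v => ((Finset.univ.filter (fun y => ∃ c, R c v y)).card : ℝ) <
      (1 / 3 - μ) * Fintype.card V)).card : ℝ) ≤ (1 / 64 + μ) * Fintype.card V)
    (side : V → ℤ) (hside : ∀ c u v, R c u v → side u + side v = 0) (sd : ι → ℤ)
    (hsd : ∀ i, sd i = 1 ∨ sd i = -1) (hsd0 : ∑ i, sd i = 0)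
    (hsdcl : ∀ i, ∀ v ∈ cl i, side v = sd i) :
    (∃ σ : Equiv.Perm ι, ∀ i, bigAdj (redGraph R ε d cl) μ i (σ i)) ∧ ∀ U K q : ℕ,
      ((K + q + 2 * Fintype.card ι + 5 : ℕ) : ℝ) * 16 ≤ ν * U →
        Distributes (bigAdj (redGraph R ε d cl) μ) sd U K q := by
  have hdr : 0 ≤ 2 * d * r := by positivity
  have hNpos := hC.card_pos hV (by linarith)
  have hN0 : (0 : ℝ) < Fintype.card ι := by exact_mod_cast hNpos
  have hm0 : (0 : ℝ) < m := by exact_mod_cast hC.pos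
  obtain ⟨D, hD1, hD2⟩ := exists_floor_expansion (hC.eight_le hV (ν := ν) (by linarith)
    (by linarith))
  have hNm : (Fintype.card ι : ℝ) * m ≤ Fintype.card V := by exact_mod_cast hC.card_mul_le
  have hνN : ν * Fintype.card ι ≤ 1 / 1000 * Fintype.card ι :=
    mul_le_mul_of_nonneg_right hν1 hN0.le
  refine perm_distributes_of_bipartite (bigAdj (redGraph R ε d cl) μ) (fun i j h => bigAdj_symm _ _ h) sd hsd hsd0 ?_
    (by linarith) D hD1 (by linarith) hNpos (1 / 1000) le_rfl ?_ ?_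
  · rintro i j ⟨c, hc, -⟩
    obtain ⟨u, hu, v, hv, huv⟩ := exists_rel_of_redGraph R hd hC.pos hC.card_eq hc
    rw [← hsdcl i u hu, ← hsdcl j v hv]
    exact hside c u v huv
  · intro i
    have h := le_card_bigAdj R hsymm ε d μ hd.le hμ.le hr cl m hC.pos hC.card_eq hNm hC.small
      hC.unc i (hC.irr i) (cl i) (Finset.Subset.refl _) 1 (1 / 10000) (1 / 32 - μ) one_pos
      (by rw [hC.card_eq, one_mul]) (by linarith) (by linarith) (by linarith)
      (fun x _ => hdeg x)
    refine le_trans (mul_le_mul_of_nonneg_right ?_ hN0.le) h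
    linarith
  · set Low := Finset.univ.filter (fun v =>
      ((Finset.univ.filter (fun y => ∃ c, R c v y)).card : ℝ) < (1 / 3 - μ) * Fintype.card V)
      with hLow
    set 𝓛 := Finset.univ.filter (fun i =>
      ((Finset.univ.filter (bigAdj (redGraph R ε d cl) μ i)).card : ℝ) <
        (1 / 3 - 1 / 1000) * Fintype.card ι) with h𝓛
    have h1 : ∀ i ∈ 𝓛, (1 - 1 / 10000) * (m : ℝ) ≤ (cl i ∩ Low).card := by
      intro i hi
      by_contra hlt
      push Not at hlt
      have hsum : ((cl i \ Low).card : ℝ) + (cl i ∩ Low).card = m := by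
        rw [← hC.card_eq i]
        exact_mod_cast Finset.card_sdiff_add_card_inter (cl i) Low
      have h := le_card_bigAdj R hsymm ε d μ hd.le hμ.le hr cl m hC.pos hC.card_eq hNm hC.small
        hC.unc i (hC.irr i) (cl i \ Low) Finset.sdiff_subset (1 / 10000) (1 / 10000)
        (1 / 3 - μ) (by norm_num) (by linarith) (by linarith) (by linarith) (by linarith)
        (fun x hx => by
          by_contra hx'
          exact (Finset.mem_sdiff.1 hx).2
            (Finset.mem_filter.2 ⟨Finset.mem_univ _, not_le.1 hx'⟩))
      have h2 := (Finset.mem_filter.1 hi).2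
      have h3 : (1 / 3 - 1 / 1000) * (Fintype.card ι : ℝ) ≤
          (1 / 3 - μ - μ - 1 / 10000) * Fintype.card ι :=
        mul_le_mul_of_nonneg_right (by linarith) hN0.le
      exact absurd (h3.trans h) (not_le.2 h2)
    have h2 : ∑ i ∈ 𝓛, (cl i ∩ Low).card ≤ Low.card := by
      rw [← Finset.card_biUnion]
      · exact Finset.card_le_card (Finset.biUnion_subset.2 (fun i _ => Finset.inter_subset_right))
      · intro i _ j _ hij
        exact (hC.disj i j hij).mono Finset.inter_subset_left Finset.inter_subset_left
    have h3 : (𝓛.card : ℝ) * ((1 - 1 / 10000) * m) ≤ Low.card := by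
      refine le_trans ?_ (by exact_mod_cast h2 : ∑ i ∈ 𝓛, ((cl i ∩ Low).card : ℝ) ≤ Low.card)
      rw [← nsmul_eq_mul]
      exact Finset.card_nsmul_le_sum _ _ _ h1
    have h4 := hC.le_card_mul
    have hn0 : (0 : ℝ) ≤ Fintype.card V := Nat.cast_nonneg _
    have h5 : (1 - 1 / 10000) * (Fintype.card V : ℝ) ≤ (1 - 2 * ε) * Fintype.card V :=
      mul_le_mul_of_nonneg_right (by linarith) hn0
    have h6 : (1 / 64 + μ) * (Fintype.card V : ℝ) ≤ (1 / 64 + 1 / 10000) * Fintype.card V :=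
      mul_le_mul_of_nonneg_right (by linarith) hn0
    refine le_of_mul_le_mul_right ?_ hm0
    have h7 : (0 : ℝ) ≤ Fintype.card ι * m := by positivity
    linarith

open Classical in
/-- A cycle partition from a cluster system whose reduced graph has the matching properties. -/
lemma exists_partition_of_clusterSystem [Nonempty V] (hr : 1 ≤ r) (col : Sym2 V → Fin r)
    (hR : ∀ c u v, R c u v ↔ G.Adj u v ∧ col s(u, v) = c) (P : ℕ) (hP : 1000 ≤ P)
    (hPd : P * d = 1) (hμ : 0 < μ) (hν : 0 < ν) (hν1 : ν ≤ 1 / 1000) (hε0 : 0 < ε)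
    (hεd : ε ≤ d) (hε4 : 4 * ε ≤ 1)
    (hε : ε * (10 ^ 9 * (P : ℝ) ^ 2 * r ^ 2) = ν) (hC : ClusterSystem R ε cl m)
    (side : V → ℤ) (hside1 : ∀ v, |side v| ≤ 1) (hside : ∀ u v, G.Adj u v → side u + side v = 0)
    (hside0 : ∑ v, side v = 0) (sd : ι → ℤ) (hsd : ∀ i, ∀ v ∈ cl i, side v = sd i)
    (hsd0 : ∑ i, sd i = 0)
    (hpd : (∃ σ : Equiv.Perm ι, ∀ i, bigAdj (redGraph R ε d cl) μ i (σ i)) ∧ ∀ U K q : ℕ,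
      ((K + q + 2 * Fintype.card ι + 5 : ℕ) : ℝ) * 16 ≤ ν * U →
        Distributes (bigAdj (redGraph R ε d cl) μ) sd U K q)
    (hδ : ∀ z, (Fintype.card V : ℝ) / 40 ≤ (Finset.univ.filter (fun x => ∃ c, R c z x)).card)
    (hlarge : (((Fintype.card ι + Fintype.card ι ^ 2) * (Fintype.card ι + 3) +
      P * (Fintype.card ι + 100) + 42 * r ^ 2 : ℕ) : ℝ) ≤ ε * m) :
    ∃ k : ℕ, (k : ℝ) ≤ (1 / μ + 200) * (r : ℝ) ^ 2 ∧ MonoCyclePartition G col k := by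
  obtain ⟨⟨σ, hσ⟩, hdist⟩ := hpd
  have hNpos := hC.card_pos Fintype.card_pos (by linarith)
  have hm0 : (0 : ℝ) < m := by exact_mod_cast hC.pos
  obtain ⟨k₀, colr, key, hk₀, hcolr, hkey⟩ :=
    exists_component_keys hr (redGraph R ε d cl) μ hμ hNpos
  obtain ⟨k, hk, hpart⟩ := exists_partition_of_reduced hr G col R hR cl hC.disj m hC.card_eq
    (redGraph R ε d cl) P hP ν ε hν hν1 hε
    (halfGood_of_redGraph R ε d hεd cl m hC.card_eq (by positivity) P hPd.ge)
    (bigAdj (redGraph R ε d cl) μ) colr hcolr key hkey σ hσ side hside1 hside hside0 sd hsd hsd0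
    hdist hδ hC.unc hC.card_mul_le hNpos hlarge
  refine ⟨k, ?_, hpart⟩
  rw [Fintype.card_fin] at hk
  have hk' : (k : ℝ) ≤ k₀ + 84 * r ^ 2 + 2 := by exact_mod_cast hk
  have hr' : (1 : ℝ) ≤ r := by exact_mod_cast hr
  have hr2 : (1 : ℝ) ≤ (r : ℝ) ^ 2 := one_le_pow₀ hr'
  have : (1 / μ + 200) * (r : ℝ) ^ 2 = r ^ 2 / μ + 200 * r ^ 2 := by ring
  linarith

end types

lemma exists_parameters {r : ℕ} (hr : 1 ≤ r) {ν : ℝ} (hν : 0 < ν) (hν1 : ν ≤ 1 / 1000) :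
    ∃ (P : ℕ) (ε d : ℝ), 1000 ≤ P ∧ P * d = 1 ∧ 0 < ε ∧ 0 < d ∧ ε ≤ d ∧
      4 * ε + 2 * d * r ≤ ν / 10 ^ 5 ∧ ε * (10 ^ 9 * (P : ℝ) ^ 2 * r ^ 2) = ν := by
  have hr' : (1 : ℝ) ≤ r := by exact_mod_cast hr
  set P : ℕ := max 1000 ⌈4 * 10 ^ 5 * r / ν⌉₊ with hP
  have hP1 : 1000 ≤ P := le_max_left _ _
  have hP1' : (1000 : ℝ) ≤ P := by exact_mod_cast hP1
  have hP2 : 4 * 10 ^ 5 * r / ν ≤ (P : ℝ) :=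
    (Nat.le_ceil _).trans (Nat.cast_le.2 (le_max_right _ _))
  rw [div_le_iff₀ hν] at hP2
  have hP0 : (0 : ℝ) < P := by linarith
  have hr2 : (1 : ℝ) ≤ (r : ℝ) ^ 2 := one_le_pow₀ hr'
  have hPP : (P : ℝ) ≤ (P : ℝ) ^ 2 := by nlinarith only [hP1']
  have hprod : (P : ℝ) ≤ (P : ℝ) ^ 2 * r ^ 2 := by nlinarith only [hPP, hr2, hP0]
  have hε : 0 < ν / (10 ^ 9 * (P : ℝ) ^ 2 * r ^ 2) := by positivity
  have heq : ν / (10 ^ 9 * (P : ℝ) ^ 2 * r ^ 2) * (10 ^ 9 * (P : ℝ) ^ 2 * r ^ 2) = ν :=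
    div_mul_cancel₀ _ (by positivity)
  refine ⟨P, ν / (10 ^ 9 * (P : ℝ) ^ 2 * r ^ 2), 1 / P, hP1, by field_simp, hε, by positivity,
    ?_, ?_, heq⟩
  · rw [div_le_div_iff₀ (by positivity) hP0, one_mul]
    have : ν * P ≤ 1 / 1000 * P := mul_le_mul_of_nonneg_right hν1 hP0.le
    linarith
  · have h1 : ν / (10 ^ 9 * (P : ℝ) ^ 2 * r ^ 2) ≤ ν / 10 ^ 9 := by
      refine div_le_div_of_nonneg_left hν.le (by norm_num) ?_
      linarith
    have h2 : 2 * (1 / (P : ℝ)) * r ≤ ν / (2 * 10 ^ 5) := by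
      rw [mul_one_div, div_mul_eq_mul_div, div_le_div_iff₀ hP0 (by norm_num)]
      linarith
    linarith

lemma ncard_neighborSet_eq [Fintype V] {r : ℕ} (G : SimpleGraph V) (col : Sym2 V → Fin r)
    (R : Fin r → V → V → Prop) [∀ c, DecidableRel (R c)]
    (hR : ∀ c u v, R c u v ↔ G.Adj u v ∧ col s(u, v) = c) (v : V) :
    (G.neighborSet v).ncard = (Finset.univ.filter (fun y => ∃ c, R c v y)).card := by
  rw [← Set.ncard_coe_finset]
  congr 1
  ext y
  simp [hR]

lemma partition_of_robMat {r : ℕ} (hr : 1 ≤ r) {ν μ : ℝ} (hν : 0 < ν) (hν1 : ν ≤ 1 / 1000)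
    (hμ : 0 < μ) (hμν : μ ≤ ν / 20) :
    ∃ n₀ : ℕ, ∀ (V : Type) [Fintype V] (G : SimpleGraph V) (col : Sym2 V → Fin r),
      n₀ ≤ Fintype.card V → RobMat G μ ν →
        ∃ k : ℕ, (k : ℝ) ≤ (1 / μ + 200) * (r : ℝ) ^ 2 ∧ MonoCyclePartition G col k := by
  obtain ⟨P, ε, d, hP, hPd, hε0, hd0, hεd, hsmall, hε⟩ := exists_parameters hr hν hν1
  have hdr : 0 ≤ 2 * d * r := by positivity
  obtain ⟨K, n₁, hK, hsys⟩ := exists_clusterSystem r ε hε0 (by linarith)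
  set L : ℕ := (K + K ^ 2) * (K + 3) + P * (K + 100) + 42 * r ^ 2 with hL
  refine ⟨max (max n₁ 1) ⌈K * L / ε⌉₊, fun V _ G col hn hrob => ?_⟩
  classical
  have hn1 : n₁ ≤ Fintype.card V := (le_max_left _ _).trans ((le_max_left _ _).trans hn)
  have hV : 0 < Fintype.card V := (le_max_right n₁ 1).trans ((le_max_left _ _).trans hn)
  have hVne : Nonempty V := Fintype.card_pos_iff.1 hV
  have hV0 : (0 : ℝ) < Fintype.card V := by exact_mod_cast hV
  have hn2 : K * L / ε ≤ (Fintype.card V : ℝ) :=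
    (Nat.le_ceil _).trans (by exact_mod_cast (le_max_right _ _).trans hn)
  rw [div_le_iff₀ hε0] at hn2
  set R : Fin r → V → V → Prop := fun c u v => G.Adj u v ∧ col s(u, v) = c with hRdef
  have hR : ∀ c u v, R c u v ↔ G.Adj u v ∧ col s(u, v) = c := fun c u v => Iff.rfl
  have hsymm : ∀ c u v, R c u v → R c v u :=
    fun c u v h => ⟨h.1.symm, by rw [Sym2.eq_swap]; exact h.2⟩
  have hRG : ∀ u v, G.Adj u v → ∃ c, R c u v := fun u v h => ⟨_, h, rfl⟩
  have hlarge : ∀ N m : ℕ, ∀ cl : Fin N → Finset V, ClusterSystem R ε cl m →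
      Fintype.card V ≤ K * m → (((Fintype.card (Fin N) + Fintype.card (Fin N) ^ 2) *
        (Fintype.card (Fin N) + 3) + P * (Fintype.card (Fin N) + 100) + 42 * r ^ 2 : ℕ) : ℝ) ≤
          ε * m := by
    intro N m cl hC hKm
    have h1 : N ≤ K := by
      have h2 := hC.card_mul_le.trans hKm
      rw [Fintype.card_fin] at h2
      exact Nat.le_of_mul_le_mul_right h2 hC.pos
    rw [Fintype.card_fin]
    have h3 : (N + N ^ 2) * (N + 3) + P * (N + 100) + 42 * r ^ 2 ≤ L := by
      rw [hL]
      gcongr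
    refine le_trans (Nat.cast_le.2 h3) ?_
    have hK' : (0 : ℝ) < K := by exact_mod_cast hK
    have h4 : (Fintype.card V : ℝ) ≤ K * m := by exact_mod_cast hKm
    have h5 := mul_le_mul_of_nonneg_right h4 hε0.le
    refine le_of_mul_le_mul_left ?_ hK'
    linarith
  have hdegR : ∀ v, ((G.neighborSet v).ncard : ℝ) =
      ((Finset.univ.filter (fun y => ∃ c, R c v y)).card : ℝ) := fun v => by
    rw [ncard_neighborSet_eq G col R hR v]
  rcases hrob with ⟨hdeg, hG⟩ | ⟨A, B, hAB, hdisj, hcard, hbip, hdeg, hlow⟩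
  · obtain ⟨N, m, cl, -, hC, -, hKm, -⟩ := hsys V hn1 R (fun _ => true)
    rw [Nat.card_eq_fintype_card] at hdeg
    have hdeg' : ∀ v, (1 / 2 - μ) * (Fintype.card V : ℝ) ≤
        (Finset.univ.filter (fun y => ∃ c, R c v y)).card := fun v => hdegR v ▸ hdeg v
    have hpd := perm_distributes_of_robMat1 G R hr hRG hsymm hV hμ hμν hν1 hε0 hd0 hsmall hC
      hdeg' hG (fun _ => 0)
    refine exists_partition_of_clusterSystem G R hr col hR P hP hPd hμ hν hν1 hε0 hεd
      (by linarith) hε hC (fun _ => 0) (by simp) (by simp) (by simp) (fun _ => 0) (by simp)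
      (by simp) hpd (fun z => ?_) (hlarge N m cl hC hKm)
    refine le_trans ?_ (hdeg' z)
    rw [div_eq_inv_mul]
    exact mul_le_mul_of_nonneg_right (by linarith) hV0.le
  · obtain ⟨N, m, cl, f, hC, hf, hKm, hbal⟩ := hsys V hn1 R (fun v => decide (v ∈ A))
    have hBiff : ∀ v, v ∈ B ↔ v ∉ A := by
      intro v
      refine ⟨fun hB hA => Set.disjoint_left.1 hdisj hA hB, fun hA => ?_⟩
      have : v ∈ A ∪ B := by rw [hAB]; trivial
      exact this.resolve_left hA
    have hcT : (Finset.univ.filter (fun v => decide (v ∈ A) = true)).card = A.ncard := by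
      rw [← Set.ncard_coe_finset]
      congr 1
      ext v
      simp
    have hcF : (Finset.univ.filter (fun v => decide (v ∈ A) = false)).card = B.ncard := by
      rw [← Set.ncard_coe_finset]
      congr 1
      ext v
      simp [hBiff]
    have hbal' := hbal (by rw [hcT, hcF, hcard])
    have hsum : ∀ {α : Type} [Fintype α] (g : α → Bool),
        (Finset.univ.filter (fun i => g i = true)).card =
          (Finset.univ.filter (fun i => g i = false)).card →
        ∑ i, (if g i = true then (1 : ℤ) else -1) = 0 := by
      intro α _ g hg
      rw [Finset.sum_ite, Finset.sum_const, Finset.sum_const]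
      simp only [Bool.not_eq_true, hg]
      simp
    set side : V → ℤ := fun v => if decide (v ∈ A) = true then 1 else -1 with hsidedef
    set sd : Fin N → ℤ := fun i => if f i = true then 1 else -1 with hsddef
    have hside : ∀ u v, G.Adj u v → side u + side v = 0 := by
      intro u v huv
      rcases hbip u v huv with ⟨hu, hv⟩ | ⟨hu, hv⟩
      · rw [hBiff] at hv
        simp [hsidedef, hu, hv]
      · rw [hBiff] at hu
        simp [hsidedef, hu, hv]
    have hside1 : ∀ v, |side v| ≤ 1 := by
      intro v
      by_cases hv : v ∈ A <;> simp [hsidedef, hv]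
    have hsdcl : ∀ i, ∀ v ∈ cl i, side v = sd i := by
      intro i v hv
      simp only [hsidedef, hsddef, hf i v hv]
    have hsd : ∀ i, sd i = 1 ∨ sd i = -1 := by
      intro i
      by_cases hi : f i = true <;> simp [hsddef, hi]
    rw [Nat.card_eq_fintype_card] at hdeg hlow
    have hdeg' : ∀ v, (1 / 32 - μ) * (Fintype.card V : ℝ) ≤
        (Finset.univ.filter (fun y => ∃ c, R c v y)).card := fun v => hdegR v ▸ hdeg v
    have hlow' : ((Finset.univ.filter (fun v =>
        ((Finset.univ.filter (fun y => ∃ c, R c v y)).card : ℝ) <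
          (1 / 3 - μ) * Fintype.card V)).card : ℝ) ≤ (1 / 64 + μ) * Fintype.card V := by
      refine le_trans (le_of_eq ?_) hlow
      rw [← Set.ncard_coe_finset]
      congr 2
      ext v
      simp only [hdegR, Finset.coe_filter, Finset.mem_univ, true_and]
    have hsd0 : ∑ i, sd i = 0 := hsum f hbal'
    have hpd := perm_distributes_of_robMat2 R hr hsymm hV hμ hμν hν1 hε0 hd0 hsmall hC hdeg' hlow'
      side (fun c u v h => hside u v h.1) sd hsd hsd0 hsdcl
    refine exists_partition_of_clusterSystem G R hr col hR P hP hPd hμ hν hν1 hε0 hεd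
      (by linarith) hε hC side hside1 hside (hsum _ (by rw [hcT, hcF, hcard])) sd hsdcl hsd0 hpd
      (fun z => ?_) (hlarge N m cl hC hKm)
    refine le_trans ?_ (hdeg' z)
    rw [div_eq_inv_mul]
    exact mul_le_mul_of_nonneg_right (by linarith) hV0.le

theorem robustly_matchable_cycle_partition :
    ∃ ν₀ : ℝ, 0 < ν₀ ∧ ∀ ν : ℝ, 0 < ν → ν ≤ ν₀ → ∀ μ : ℝ, 0 < μ → μ ≤ ν / 20 →
      ∀ r : ℕ, ∃ n₀ : ℕ, ∀ n : ℕ, n₀ ≤ n →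
        ∀ (W : Type) [Fintype W], ∀ (G : SimpleGraph W) (c : Sym2 W → Fin r),
          Fintype.card W = n → RobMat G μ ν →
          ∃ k : ℕ, (k : ℝ) ≤ (1 / μ + 200) * (r : ℝ) ^ 2 ∧ MonoCyclePartition G c k := by
  refine ⟨1 / 1000, by norm_num, fun ν hν hν1 μ hμ hμν r => ?_⟩
  rcases Nat.eq_zero_or_pos r with rfl | hr
  · refine ⟨1, fun n hn W _ G c hW _ => ?_⟩
    obtain ⟨w⟩ : Nonempty W := Fintype.card_pos_iff.1 (by omega)
    exact (c s(w, w)).elim0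
  · obtain ⟨n₀, h⟩ := partition_of_robMat hr hν hν1 hμ hμν
    exact ⟨n₀, fun n hn W _ G c hW hrob => h W G c (hW ▸ hn) hrob⟩

end Paper
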